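/- arXiv:2512.23164 — 6 statements merged into one kernel-verified Lean document; each statement's English description precedes it below -/
import Mathlib

section
/- For all a, b, c, d > 0, the random variable X_{a,b,c,d} exists if and only if E^{a+b}_{d, c+bd}(−t) ≥ 0 for every t > 0. Moreover, when X_{a,b,c,d} exists, the law of its reciprocal has density t ↦ (Γ(c)·Γ(a+b)/(Γ(a)·Γ(b)))·t^{b−1}·E^{a+b}_{d, c+bd}(−t) on (0,∞). -/
open MeasureTheory Real

/-- `μ` is a law of the random variable `X_{a,b,c,d}`: a probability measure on `(0,∞)`
whose fractional moments are `Γ(c)/(Γ(a)Γ(b)) · Γ(a+s)Γ(b−s)/Γ(c+d·s)` for `s ∈ (−a,b)`. -/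
def IsXLaw (a b c d : ℝ) (μ : Measure ℝ) : Prop :=
  IsProbabilityMeasure μ ∧ μ (Set.Ioi (0 : ℝ))ᶜ = 0 ∧
    ∀ s ∈ Set.Ioo (-a) b,
      ∫⁻ x, ENNReal.ofReal (x ^ s) ∂μ =
        ENNReal.ofReal (Real.Gamma c / (Real.Gamma a * Real.Gamma b) *
          (Real.Gamma (a + s) * Real.Gamma (b - s) / Real.Gamma (c + d * s)))

/-- The random variable `X_{a,b,c,d}` exists. -/
def XExists (a b c d : ℝ) : Prop :=
  ∃ μ : Measure ℝ, IsXLaw a b c d μ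

/-- The three-parametric Mittag-Leffler function
`E^γ_{ρ,μ}(z) = Σ_{n≥0} Γ(γ+n)/(Γ(γ)Γ(1+n)Γ(μ+ρn)) · z^n`. -/
noncomputable def mittagLeffler3 (ρ μ γ : ℝ) (z : ℝ) : ℝ :=
  ∑' n : ℕ,
    Real.Gamma (γ + n) / (Real.Gamma γ * Real.Gamma (1 + n) * Real.Gamma (μ + ρ * n)) * z ^ n

open ProbabilityTheory

lemma ringChoose_eq_Gamma_div {γ : ℝ} (hγ : 0 < γ) (n : ℕ) :
    Ring.choose (γ + n - 1) n = Gamma (γ + n) / (Gamma γ * Gamma (1 + n)) := by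
  have h1 : (n.factorial : ℝ) * Ring.choose (γ + n - 1) n = (ascPochhammer ℝ n).eval γ := by
    have := Ring.factorial_nsmul_multichoose_eq_ascPochhammer γ n
    rw [Polynomial.ascPochhammer_smeval_eq_eval, nsmul_eq_mul] at this
    rw [← this, Ring.choose]
    congr 2
    ring
  have h2 : Gamma (γ + n) = (ascPochhammer ℝ n).eval γ * Gamma γ := by
    clear h1
    induction n with
    | zero => simp
    | succ k ih =>
      rw [ascPochhammer_succ_eval, show γ + ((k + 1 : ℕ) : ℝ) = (γ + k) + 1 by push_cast; ring,
        Gamma_add_one (by positivity), ih]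
      ring
  have h3 : Gamma (1 + n : ℝ) = n.factorial := by rw [add_comm, Gamma_nat_eq_factorial]
  rw [h2, ← h1, h3]
  have := (Gamma_pos_of_pos hγ).ne'
  have := n.factorial_pos
  field_simp

lemma hasSum_Gamma_mul_pow {γ x : ℝ} (hγ : 0 < γ) (hx : |x| < 1) :
    HasSum (fun n : ℕ => Gamma (γ + n) / (Gamma γ * Gamma (1 + n)) * x ^ n)
      ((1 - x) ^ (-γ)) := by
  have h := (one_div_one_sub_rpow_hasFPowerSeriesOnBall_zero γ).hasSum (y := x)
    (by simpa [enorm_eq_nnnorm] using! hx)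
  simp only [zero_add] at h
  rw [rpow_neg (by linarith [(abs_lt.1 hx).2]), ← one_div]
  convert! h using 2 with n
  rw [FormalMultilinearSeries.ofScalars_apply_eq, ringChoose_eq_Gamma_div hγ, smul_eq_mul]

lemma integrableExpSet_mono_of_nonpos {M : Measure ℝ} {Y : ℝ → ℝ} (hY : Measurable Y)
    (hY0 : ∀ᵐ t ∂M, Y t ≤ 0) {p q : ℝ} (hpq : p ≤ q) (hp : p ∈ integrableExpSet Y M) :
    q ∈ integrableExpSet Y M := by
  refine Integrable.mono' (g := fun t => exp (p * Y t)) hp (by fun_prop) ?_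
  filter_upwards [hY0] with t ht
  rw [norm_of_nonneg (exp_pos _).le]
  exact exp_le_exp.2 (mul_le_mul_of_nonpos_right hpq ht)

/-- Landau's theorem for Laplace transforms of positive measures: if the transform agrees near
infinity with a function that is analytic on `(0, ∞)`, then it converges on all of `(0, ∞)`. -/
lemma mem_integrableExpSet_of_analyticOnNhd {M : Measure ℝ} {Y G : ℝ → ℝ} (hY : Measurable Y)
    (hY0 : ∀ᵐ t ∂M, Y t ≤ 0) (hG : AnalyticOnNhd ℝ G (Set.Ioi 0))
    (h1 : ∀ p, 1 < p → p ∈ integrableExpSet Y M) (hGeq : ∀ p, 1 < p → mgf Y M p = G p)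
    {p : ℝ} (hp : 0 < p) : p ∈ integrableExpSet Y M ∧ mgf Y M p = G p := by
  have key : ∀ a, 0 ≤ a → Set.Ioi a ⊆ integrableExpSet Y M →
      Set.EqOn (mgf Y M) G (Set.Ioi a) := by
    intro a ha hsub
    have hint : Set.Ioi a ⊆ interior (integrableExpSet Y M) := interior_maximal hsub isOpen_Ioi
    refine AnalyticOnNhd.eqOn_of_preconnected_of_eventuallyEq (z₀ := a + 2)
      (analyticOnNhd_mgf.mono hint)
      (hG.mono (Set.Ioi_subset_Ioi ha)) isPreconnected_Ioi (by simp) ?_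
    filter_upwards [Ioi_mem_nhds (show (1 : ℝ) < a + 2 by linarith)] with q hq
    exact hGeq q hq
  suffices hall : Set.Ioi 0 ⊆ integrableExpSet Y M from ⟨hall hp, key 0 le_rfl hall hp⟩
  by_contra hcon
  obtain ⟨p₁, hp₁, hp₁S⟩ := Set.not_subset.1 hcon
  have hp₁' : (0 : ℝ) < p₁ := hp₁
  have hlb : ∀ q ∈ integrableExpSet Y M, p₁ ≤ q := fun q hq => by
    by_contra! h
    exact hp₁S (integrableExpSet_mono_of_nonpos hY hY0 h.le hq)
  have hbdd : BddBelow (integrableExpSet Y M) := ⟨p₁, hlb⟩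
  have hne : (integrableExpSet Y M).Nonempty := ⟨2, h1 2 (by norm_num)⟩
  set p₀ := sInf (integrableExpSet Y M) with hp₀
  have hp₀1 : p₁ ≤ p₀ := le_csInf hne hlb
  have hsub : Set.Ioi p₀ ⊆ integrableExpSet Y M := fun q hq => by
    obtain ⟨r, hr, hrq⟩ := exists_lt_of_csInf_lt hne hq
    exact integrableExpSet_mono_of_nonpos hY hY0 hrq.le hr
  have heq := key p₀ (by linarith) hsub
  obtain ⟨P, r, hPr⟩ := hG p₀ (show (0 : ℝ) < p₀ by linarith)
  obtain ⟨δ, hδ, hδr⟩ : ∃ δ : NNReal, 0 < δ ∧ (4 * δ : ENNReal) < r := by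
    obtain ⟨ε, hε, hεr⟩ := ENNReal.lt_iff_exists_nnreal_btwn.1 hPr.r_pos
    refine ⟨ε / 4, by simpa using hε, ?_⟩
    rw [ENNReal.coe_div (by norm_num)]
    have : (4 : ENNReal) * (ε / (4 : NNReal)) = ε := by
      exact ENNReal.mul_div_cancel (by norm_num) (by norm_num)
    rwa [this]
  have hδ' : (0 : ℝ) < δ := hδ
  set q : ℝ := p₀ + δ with hq
  have hnn : ‖(δ : ℝ)‖₊ = δ := by simp
  have hδr1 : (δ : ENNReal) < r := lt_of_le_of_lt
    (by exact_mod_cast (show δ ≤ 4 * δ from le_mul_of_one_le_left' (by norm_num))) hδr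
  have hB := hPr.changeOrigin (y := (δ : ℝ)) (by rw [hnn]; exact hδr1)
  rw [hnn] at hB
  have hqint : q ∈ interior (integrableExpSet Y M) :=
    interior_maximal hsub isOpen_Ioi (show p₀ < q by linarith)
  have hser := (hasFPowerSeriesAt_mgf hqint).eq_formalMultilinearSeries_of_eventually
    hB.hasFPowerSeriesAt (by
      filter_upwards [Ioi_mem_nhds (show p₀ < q by linarith)] with z hz using heq hz)
  rw [← hser] at hB
  have hsum := (hB.hasSum (y := -(2 * (δ : ℝ))) (by
    have : (‖-(2 * (δ : ℝ))‖₊ : ENNReal) = 2 * δ := by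
      rw [nnnorm_neg, nnnorm_mul, hnn]; simp
    rw [Metric.mem_eball, edist_zero_right, enorm_eq_nnnorm, this]
    refine lt_tsub_iff_right.2 (lt_of_le_of_lt ?_ hδr)
    calc (2 * δ + δ : ENNReal) = 3 * δ := by ring
      _ ≤ 4 * δ := by gcongr; norm_num)).summable
  have hmem : p₀ - δ ∈ integrableExpSet Y M := by
    simp only [FormalMultilinearSeries.ofScalars_apply_eq, smul_eq_mul] at hsum
    have hterm : ∀ n : ℕ, ∫⁻ t, ENNReal.ofReal
        ((2 * δ) ^ n / n.factorial * ((-Y t) ^ n * exp (q * Y t))) ∂M =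
        ENNReal.ofReal ((∫ t, Y t ^ n * exp (q * Y t) ∂M) / n.factorial * (-(2 * (δ : ℝ))) ^ n) := by
      intro n
      have hi := (integrable_pow_mul_exp_of_mem_interior_integrableExpSet hqint n).const_mul
        ((-(2 * δ : ℝ)) ^ n / n.factorial)
      have hfun : ∀ t, (2 * δ : ℝ) ^ n / n.factorial * ((-Y t) ^ n * exp (q * Y t)) =
          (-(2 * δ : ℝ)) ^ n / n.factorial * (Y t ^ n * exp (q * Y t)) := fun t => by
        rw [neg_pow, neg_pow (2 * (δ : ℝ))]; ring
      simp_rw [hfun]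
      rw [← ofReal_integral_eq_lintegral_ofReal hi, integral_const_mul]
      · congr 1; ring
      · filter_upwards [hY0] with t ht
        rw [← hfun]
        have : 0 ≤ -Y t := by linarith
        positivity
    have hterm_nonneg : ∀ n : ℕ, 0 ≤
        (∫ t, Y t ^ n * exp (q * Y t) ∂M) / n.factorial * (-(2 * (δ : ℝ))) ^ n := fun n => by
      rw [div_mul_eq_mul_div, ← integral_mul_const]
      refine div_nonneg (integral_nonneg_of_ae ?_) (by positivity)
      filter_upwards [hY0] with t ht
      have : 0 ≤ Y t * -(2 * (δ : ℝ)) := mul_nonneg_of_nonpos_of_nonpos ht (by linarith)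
      calc (0 : ℝ) ≤ (Y t * -(2 * (δ : ℝ))) ^ n * exp (q * Y t) := by positivity
        _ = _ := by rw [mul_pow]; ring
    have hexp : ∀ᵐ t ∂M, ENNReal.ofReal (exp ((p₀ - δ) * Y t)) =
        ∑' n : ℕ, ENNReal.ofReal ((2 * δ) ^ n / n.factorial * ((-Y t) ^ n * exp (q * Y t))) := by
      filter_upwards [hY0] with t ht
      have h0 : 0 ≤ -Y t := by linarith
      have hs : HasSum (fun n : ℕ => (2 * δ : ℝ) ^ n / n.factorial * ((-Y t) ^ n * exp (q * Y t)))
          (exp ((p₀ - δ) * Y t)) := by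
        have := (NormedSpace.expSeries_div_hasSum_exp (2 * δ * -Y t : ℝ)).mul_right (exp (q * Y t))
        rw [← Real.exp_eq_exp_ℝ, ← exp_add] at this
        convert! this using 2 with n
        · rw [mul_pow (2 * (δ : ℝ)) (-Y t)]; ring
        · rw [hq]; ring
      rw [← hs.tsum_eq, ENNReal.ofReal_tsum_of_nonneg (fun n => by positivity) hs.summable]
    have hlt : ∫⁻ t, ENNReal.ofReal (exp ((p₀ - δ) * Y t)) ∂M < ⊤ := by
      rw [lintegral_congr_ae hexp, lintegral_tsum (fun n => by fun_prop)]
      simp_rw [hterm]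
      rw [← ENNReal.ofReal_tsum_of_nonneg hterm_nonneg hsum]
      exact ENNReal.ofReal_lt_top
    exact ⟨by fun_prop, by
      rw [hasFiniteIntegral_iff_ofReal (.of_forall fun t => (exp_pos _).le)]; exact hlt⟩
  linarith [csInf_le hbdd hmem]

lemma mem_integrableExpSet_iff_lintegral_ne_top {M : Measure ℝ} {φ : ℝ → ℝ} (hφ : Measurable φ)
    {s : ℝ} : s ∈ integrableExpSet φ M ↔ ∫⁻ t, ENNReal.ofReal (exp (s * φ t)) ∂M ≠ ⊤ := by
  rw [integrableExpSet, Set.mem_ofPred_eq, Integrable,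
    hasFiniteIntegral_iff_ofReal (.of_forall fun t => (exp_pos _).le), lt_top_iff_ne_top,
    and_iff_right (by fun_prop)]

lemma mgf_eq_toReal_lintegral {M : Measure ℝ} {φ : ℝ → ℝ} (hφ : Measurable φ) (s : ℝ) :
    mgf φ M s = (∫⁻ t, ENNReal.ofReal (exp (s * φ t)) ∂M).toReal := by
  rw [mgf, integral_eq_lintegral_of_nonneg_ae (.of_forall fun t => (exp_pos _).le) (by fun_prop)]

lemma charFun_map_withDensity_exp {M : Measure ℝ} {φ : ℝ → ℝ} (hφ : Measurable φ) (s y : ℝ) :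
    charFun ((M.withDensity fun t => ENNReal.ofReal (exp (s * φ t))).map φ) y =
      complexMGF φ M (s + y * Complex.I) := by
  rw [charFun_apply_real, integral_map hφ.aemeasurable (by fun_prop),
    integral_withDensity_eq_integral_toReal_smul (by fun_prop)
      (.of_forall fun _ => ENNReal.ofReal_lt_top), complexMGF]
  refine integral_congr_ae (.of_forall fun t => ?_)
  simp only
  rw [ENNReal.toReal_ofReal (exp_pos _).le, Complex.real_smul, Complex.ofReal_exp,
    ← Complex.exp_add]
  congr 1
  push_cast
  ring

/-- Two measures on `(0, ∞)` with the same finite exponential moments of an injective function `φ`,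
for almost every exponent in an interval, are equal. -/
lemma ext_of_lintegral_exp_mul_eq {M₁ M₂ : Measure ℝ} {φ ψ : ℝ → ℝ} (hφ : Measurable φ)
    (hψ : Measurable ψ) (hψφ : ∀ t, 0 < t → ψ (φ t) = t)
    (h₁ : M₁ (Set.Ioi 0)ᶜ = 0) (h₂ : M₂ (Set.Ioi 0)ᶜ = 0) {α β : ℝ} (hαβ : α < β)
    (hfin : ∀ᵐ s, s ∈ Set.Ioo α β → ∫⁻ t, ENNReal.ofReal (exp (s * φ t)) ∂M₁ ≠ ⊤)
    (heq : ∀ᵐ s, s ∈ Set.Ioo α β → ∫⁻ t, ENNReal.ofReal (exp (s * φ t)) ∂M₁ =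
      ∫⁻ t, ENNReal.ofReal (exp (s * φ t)) ∂M₂) : M₁ = M₂ := by
  have hdense := Measure.dense_of_ae (hfin.and heq)
  set m := (α + β) / 2 with hm
  obtain ⟨s₁, hs₁, hs₁'⟩ := hdense.exists_between (show α < m by linarith)
  obtain ⟨s₂, hs₂, hs₂'⟩ := hdense.exists_between (show m < β by linarith)
  obtain ⟨s₀, hs₀, hs₀'⟩ := hdense.exists_between (hs₁'.2.trans hs₂'.1)
  have hmem₁ : ∀ s, s ∈ Set.Ioo α β → s ∈ {x | (x ∈ Set.Ioo α β →
      ∫⁻ t, ENNReal.ofReal (exp (x * φ t)) ∂M₁ ≠ ⊤) ∧ (x ∈ Set.Ioo α β →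
      ∫⁻ t, ENNReal.ofReal (exp (x * φ t)) ∂M₁ = ∫⁻ t, ENNReal.ofReal (exp (x * φ t)) ∂M₂)} →
      s ∈ integrableExpSet φ M₁ ∧ s ∈ integrableExpSet φ M₂ ∧ mgf φ M₁ s = mgf φ M₂ s := by
    intro s hs hs'
    rw [mem_integrableExpSet_iff_lintegral_ne_top hφ, mem_integrableExpSet_iff_lintegral_ne_top hφ,
      mgf_eq_toReal_lintegral hφ, mgf_eq_toReal_lintegral hφ, ← hs'.2 hs]
    exact ⟨hs'.1 hs, hs'.1 hs, rfl⟩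
  have hsI₁ : s₁ ∈ Set.Ioo α β := ⟨hs₁'.1, by linarith [hs₁'.2]⟩
  have hsI₂ : s₂ ∈ Set.Ioo α β := ⟨by linarith [hs₂'.1], hs₂'.2⟩
  have hint : ∀ M : Measure ℝ, s₁ ∈ integrableExpSet φ M → s₂ ∈ integrableExpSet φ M →
      Set.Ioo s₁ s₂ ⊆ interior (integrableExpSet φ M) := fun M ha hb =>
    interior_maximal (Set.Ioo_subset_Icc_self.trans
      (convex_integrableExpSet.ordConnected.out ha hb)) isOpen_Ioo
  obtain ⟨ha₁, ha₂, -⟩ := hmem₁ s₁ hsI₁ hs₁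
  obtain ⟨hb₁, hb₂, -⟩ := hmem₁ s₂ hsI₂ hs₂
  have hEqOn : Set.EqOn (complexMGF φ M₁) (complexMGF φ M₂) {z | z.re ∈ Set.Ioo s₁ s₂} := by
    refine AnalyticOnNhd.eqOn_of_preconnected_of_frequently_eq (z₀ := (s₀ : ℂ))
      (analyticOnNhd_complexMGF.mono fun z hz => hint M₁ ha₁ hb₁ hz)
      (analyticOnNhd_complexMGF.mono fun z hz => hint M₂ ha₂ hb₂ hz)
      ((convex_Ioo s₁ s₂).linear_preimage Complex.reLm).isPreconnected (by simpa using hs₀') ?_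
    have hfreq : ∃ᶠ s in nhdsWithin s₀ {s₀}ᶜ, mgf φ M₁ s = mgf φ M₂ s := by
      have h := mem_closure_ne_iff_frequently_within.1 ((hdense.sdiff_singleton s₀) s₀)
      refine (h.and_eventually (mem_nhdsWithin_of_mem_nhds
        (Ioo_mem_nhds hs₀'.1 hs₀'.2))).mono fun s hs => ?_
      exact (hmem₁ s ⟨hs₁'.1.trans hs.2.1, hs.2.2.trans hs₂'.2⟩ hs.1).2.2
    rw [Filter.frequently_iff_seq_forall] at hfreq ⊢
    obtain ⟨xs, hx, hxe⟩ := hfreq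
    refine ⟨fun n => (xs n : ℂ), ?_, fun n => ?_⟩
    · rw [tendsto_nhdsWithin_iff] at hx ⊢
      exact ⟨(Complex.continuous_ofReal.tendsto _).comp hx.1, by simpa using hx.2⟩
    · rw [complexMGF_ofReal, complexMGF_ofReal, hxe n]
  set w : ℝ → ENNReal := fun t => ENNReal.ofReal (exp (s₀ * φ t)) with hw
  have hwm : Measurable w := by fun_prop
  have hfm : ∀ M : Measure ℝ, s₀ ∈ integrableExpSet φ M → IsFiniteMeasure (M.withDensity w) :=
    fun M h => isFiniteMeasure_withDensity ((mem_integrableExpSet_iff_lintegral_ne_top hφ).1 h)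
  have := hfm M₁ (interior_subset (hint M₁ ha₁ hb₁ hs₀'))
  have := hfm M₂ (interior_subset (hint M₂ ha₂ hb₂ hs₀'))
  have hmap : (M₁.withDensity w).map φ = (M₂.withDensity w).map φ := by
    refine Measure.ext_of_charFun (funext fun y => ?_)
    rw [charFun_map_withDensity_exp hφ, charFun_map_withDensity_exp hφ]
    exact hEqOn (by simpa using hs₀')
  have hback : ∀ M : Measure ℝ, M (Set.Ioi 0)ᶜ = 0 →
      ((M.withDensity w).map φ).map ψ = M.withDensity w := by
    intro M hM
    rw [Measure.map_map hψ hφ]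
    have : ψ ∘ φ =ᵐ[M.withDensity w] id := by
      refine (withDensity_absolutelyContinuous M w).ae_le ?_
      have : ∀ᵐ t ∂M, t ∈ Set.Ioi (0 : ℝ) := mem_ae_iff.2 hM
      filter_upwards [this] with t ht using hψφ t ht
    rw [Measure.map_congr this, Measure.map_id]
  have hwd : M₁.withDensity w = M₂.withDensity w := by
    rw [← hback M₁ h₁, ← hback M₂ h₂, hmap]
  have hinv : ∀ M : Measure ℝ, (M.withDensity w).withDensity w⁻¹ = M := fun M =>
    withDensity_inv_same hwm (.of_forall fun t => by simp [hw, exp_pos])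
      (.of_forall fun t => ENNReal.ofReal_ne_top)
  rw [← hinv M₁, hwd, hinv M₂]

lemma lintegral_rpow_mul_exp_neg_mul_rpow {p q b : ℝ} (hp : 0 < p) (hq : -1 < q) (hb : 0 < b) :
    ∫⁻ x in Set.Ioi (0 : ℝ), ENNReal.ofReal (x ^ q * exp (-b * x ^ p)) =
      ENNReal.ofReal (b ^ (-(q + 1) / p) * (1 / p) * Gamma ((q + 1) / p)) := by
  rw [← integral_rpow_mul_exp_neg_mul_rpow hp hq hb,
    ofReal_integral_eq_lintegral_ofReal (integrableOn_rpow_mul_exp_neg_mul_rpow hq hp hb)]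
  filter_upwards [ae_restrict_mem measurableSet_Ioi] with x hx
  have : (0 : ℝ) < x := hx
  positivity

lemma lintegral_rpow_mul_exp_neg_mul {z b : ℝ} (hz : 0 < z) (hb : 0 < b) :
    ∫⁻ x in Set.Ioi (0 : ℝ), ENNReal.ofReal (x ^ (z - 1) * exp (-b * x)) =
      ENNReal.ofReal (b ^ (-z) * Gamma z) := by
  have := lintegral_rpow_mul_exp_neg_mul_rpow (q := z - 1) one_pos (by linarith) hb
  simpa using this

lemma lintegral_rpow_mul_one_add_rpow {d α β : ℝ} (hd : 0 < d) (hα : 0 < α) (hβ : 0 < β) :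
    ∫⁻ p in Set.Ioi (0 : ℝ), ENNReal.ofReal (p ^ (d * α - 1) * (1 + p ^ d) ^ (-(α + β))) =
      ENNReal.ofReal (Gamma α * Gamma β / (d * Gamma (α + β))) := by
  have hγ := Gamma_pos_of_pos (add_pos hα hβ)
  have hmeas : Measurable (Function.uncurry fun p y : ℝ => ENNReal.ofReal
      (p ^ (d * α - 1) * (y ^ (α + β - 1) * exp (-(1 + p ^ d) * y)))) := by
    unfold Function.uncurry; fun_prop
  have h1 : ∀ p ∈ Set.Ioi (0 : ℝ), ENNReal.ofReal (Gamma (α + β)) *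
      ENNReal.ofReal (p ^ (d * α - 1) * (1 + p ^ d) ^ (-(α + β))) =
      ∫⁻ y in Set.Ioi (0 : ℝ), ENNReal.ofReal
        (p ^ (d * α - 1) * (y ^ (α + β - 1) * exp (-(1 + p ^ d) * y))) := by
    intro p hp
    have hp' : (0 : ℝ) < p := hp
    simp_rw [ENNReal.ofReal_mul (rpow_nonneg hp'.le (d * α - 1))]
    rw [lintegral_const_mul _ (by fun_prop),
      lintegral_rpow_mul_exp_neg_mul (by positivity) (by positivity),
      ENNReal.ofReal_mul (by positivity)]
    ring
  have h2 : ∀ y ∈ Set.Ioi (0 : ℝ), ∫⁻ p in Set.Ioi (0 : ℝ), ENNReal.ofReal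
        (p ^ (d * α - 1) * (y ^ (α + β - 1) * exp (-(1 + p ^ d) * y))) =
      ENNReal.ofReal (1 / d * Gamma α) * ENNReal.ofReal (y ^ (β - 1) * exp (-1 * y)) := by
    intro y hy
    have hy' : (0 : ℝ) < y := hy
    have : ∀ p : ℝ, ENNReal.ofReal
        (p ^ (d * α - 1) * (y ^ (α + β - 1) * exp (-(1 + p ^ d) * y))) =
        ENNReal.ofReal (y ^ (α + β - 1) * exp (-1 * y)) *
        ENNReal.ofReal (p ^ (d * α - 1) * exp (-y * p ^ d)) := fun p => by
      rw [← ENNReal.ofReal_mul (by positivity),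
        show -(1 + p ^ d) * y = -1 * y + -y * p ^ d by ring, exp_add]
      congr 1; ring
    simp_rw [this]
    rw [lintegral_const_mul _ (by fun_prop), lintegral_rpow_mul_exp_neg_mul_rpow hd
      (by have := mul_pos hd hα; linarith) hy',
      ← ENNReal.ofReal_mul (by positivity), ← ENNReal.ofReal_mul
        (mul_nonneg (by positivity) (Gamma_pos_of_pos hα).le),
      show -(d * α - 1 + 1) / d = -α by field_simp; ring,
      show (d * α - 1 + 1) / d = α by field_simp; ring,
      show β - 1 = (α + β - 1) + -α by ring, rpow_add hy']
    congr 1; ring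
  have h0 : ENNReal.ofReal (Gamma (α + β)) ≠ 0 := by simpa using hγ
  rw [← ENNReal.mul_right_inj h0 ENNReal.ofReal_ne_top, ← lintegral_const_mul _ (by fun_prop),
    setLIntegral_congr_fun measurableSet_Ioi h1, lintegral_lintegral_swap hmeas.aemeasurable,
    setLIntegral_congr_fun measurableSet_Ioi h2, lintegral_const_mul _ (by fun_prop),
    lintegral_rpow_mul_exp_neg_mul hβ one_pos, ← ENNReal.ofReal_mul
        (mul_nonneg (by positivity) (Gamma_pos_of_pos hα).le), ← ENNReal.ofReal_mul hγ.le]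
  congr 1
  rw [one_rpow]
  field_simp

/-- The Mellin transform of a Laplace transform. -/
lemma lintegral_rpow_mul_lintegral_exp_neg {M : Measure ℝ} [SFinite M] (hM : M (Set.Ioi 0)ᶜ = 0)
    {r z : ℝ} (hz : 0 < z) :
    ∫⁻ p in Set.Ioi (0 : ℝ), ENNReal.ofReal (p ^ (z - 1)) *
        ∫⁻ t, ENNReal.ofReal (exp (p * -t ^ r)) ∂M =
      ENNReal.ofReal (Gamma z) * ∫⁻ t, ENNReal.ofReal (t ^ (-(z * r))) ∂M := by
  have hmeas : Measurable (Function.uncurry fun p t : ℝ => ENNReal.ofReal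
      (p ^ (z - 1)) * ENNReal.ofReal (exp (p * -t ^ r))) := by
    unfold Function.uncurry; fun_prop
  simp_rw [← fun p : ℝ => lintegral_const_mul (μ := M) (ENNReal.ofReal (p ^ (z - 1)))
    (f := fun t => ENNReal.ofReal (exp (p * -t ^ r))) (by fun_prop)]
  rw [lintegral_lintegral_swap hmeas.aemeasurable, ← lintegral_const_mul _ (by fun_prop)]
  have hae : ∀ᵐ t ∂M, t ∈ Set.Ioi (0 : ℝ) := mem_ae_iff.2 hM
  refine lintegral_congr_ae ?_
  filter_upwards [hae] with t ht
  have ht' : (0 : ℝ) < t := ht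
  rw [setLIntegral_congr_fun measurableSet_Ioi (g := fun p => ENNReal.ofReal
      (p ^ (z - 1) * exp (-t ^ r * p))) (fun p hp => by
        rw [← ENNReal.ofReal_mul (rpow_nonneg (le_of_lt hp) _), mul_comm p]),
    lintegral_rpow_mul_exp_neg_mul hz (by positivity),
    ← ENNReal.ofReal_mul (Gamma_pos_of_pos hz).le, ← rpow_mul ht'.le, mul_comm]
  congr 3; ring

section MittagLeffler

variable {ρ m γ : ℝ}

/-- The `n`-th Taylor coefficient of `mittagLeffler3 ρ m γ`. -/
noncomputable def mittagLeffler3Coeff (ρ m γ : ℝ) (n : ℕ) : ℝ :=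
  Gamma (γ + n) / (Gamma γ * Gamma (1 + n) * Gamma (m + ρ * n))

/-- The `n`-th term of the series of `t ^ (m / ρ - 1) * E(-t)`, damped by `exp (-p t ^ (1 / ρ))`. -/
noncomputable def mittagLeffler3Term (ρ m γ p : ℝ) (n : ℕ) (t : ℝ) : ℝ :=
  mittagLeffler3Coeff ρ m γ n * (-t) ^ n * (t ^ (m / ρ - 1) * exp (-p * t ^ (1 / ρ)))

lemma mittagLeffler3Coeff_pos (hρ : 0 < ρ) (hm : 0 < m) (hγ : 0 < γ) (n : ℕ) :
    0 < mittagLeffler3Coeff ρ m γ n :=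
  div_pos (Gamma_pos_of_pos (by positivity)) (mul_pos (mul_pos (Gamma_pos_of_pos hγ)
    (Gamma_pos_of_pos (by positivity))) (Gamma_pos_of_pos (by positivity)))

lemma integrableOn_mittagLeffler3Term (hρ : 0 < ρ) (hm : 0 < m) {p : ℝ} (hp : 0 < p) (n : ℕ) :
    IntegrableOn (mittagLeffler3Term ρ m γ p n) (Set.Ioi 0) := by
  have hmρ := div_pos hm hρ
  have h := integrableOn_rpow_mul_exp_neg_mul_rpow (s := m / ρ - 1 + n) (p := 1 / ρ)
    (by have := n.cast_nonneg (α := ℝ); linarith) (by positivity) hp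
  refine IntegrableOn.congr_fun (Integrable.const_mul h
    (mittagLeffler3Coeff ρ m γ n * (-1) ^ n)) (fun t ht => ?_) measurableSet_Ioi
  have ht' : (0 : ℝ) < t := ht
  simp only [mittagLeffler3Term]
  rw [rpow_add ht', rpow_natCast, neg_pow t]
  ring

lemma integral_mittagLeffler3Term (hρ : 0 < ρ) (hm : 0 < m) {p : ℝ} (hp : 0 < p)
    (n : ℕ) : ∫ t in Set.Ioi 0, mittagLeffler3Term ρ m γ p n t =
      ρ * p ^ (-m) * (Gamma (γ + n) / (Gamma γ * Gamma (1 + n)) * (-p ^ (-ρ)) ^ n) := by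
  have hmρ := div_pos hm hρ
  have hΓ : 0 < Gamma (m + ρ * n) := Gamma_pos_of_pos (by positivity)
  have h := integral_rpow_mul_exp_neg_mul_rpow (q := m / ρ - 1 + n) (p := 1 / ρ)
    (by positivity) (by have := n.cast_nonneg (α := ℝ); linarith) hp
  have e1 : (m / ρ - 1 + n + 1) / (1 / ρ) = m + ρ * n := by field_simp; ring
  rw [neg_div, e1] at h
  have : ∫ t in Set.Ioi 0, mittagLeffler3Term ρ m γ p n t = ∫ t in Set.Ioi 0,
      mittagLeffler3Coeff ρ m γ n * (-1) ^ n *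
        (t ^ (m / ρ - 1 + n) * exp (-p * t ^ (1 / ρ))) := by
    refine setIntegral_congr_fun measurableSet_Ioi fun t ht => ?_
    have ht' : (0 : ℝ) < t := ht
    simp only [mittagLeffler3Term]
    rw [rpow_add ht', rpow_natCast, neg_pow t]
    ring
  rw [this, integral_const_mul, h, mittagLeffler3Coeff, neg_add, rpow_add hp, neg_pow (p ^ (-ρ)),
    ← rpow_natCast (p ^ (-ρ)), ← rpow_mul hp.le, neg_mul]
  field_simp

lemma norm_mittagLeffler3Term (hρ : 0 < ρ) (hm : 0 < m) (hγ : 0 < γ) {p t : ℝ} (ht : 0 < t)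
    (n : ℕ) : ‖mittagLeffler3Term ρ m γ p n t‖ = (-1) ^ n * mittagLeffler3Term ρ m γ p n t := by
  have := mittagLeffler3Coeff_pos hρ hm hγ n
  have h : (-1) ^ n * mittagLeffler3Term ρ m γ p n t =
      mittagLeffler3Coeff ρ m γ n * t ^ n * (t ^ (m / ρ - 1) * exp (-p * t ^ (1 / ρ))) := by
    rw [mittagLeffler3Term, neg_pow t]
    have : ((-1 : ℝ) ^ n) * (-1) ^ n = 1 := by rw [← mul_pow]; simp
    linear_combination (mittagLeffler3Coeff ρ m γ n * t ^ n *
      (t ^ (m / ρ - 1) * exp (-p * t ^ (1 / ρ)))) * this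
  rw [h, mittagLeffler3Term]
  simp only [norm_mul, norm_pow, norm_neg]
  rw [norm_of_nonneg this.le, norm_of_nonneg ht.le, norm_of_nonneg (rpow_nonneg ht.le _),
    norm_of_nonneg (exp_pos _).le]

lemma abs_rpow_neg_lt_one (hρ : 0 < ρ) {p : ℝ} (hp : 1 < p) : |p ^ (-ρ)| < 1 := by
  rw [abs_of_pos (by positivity)]
  exact rpow_lt_one_of_one_lt_of_neg hp (by linarith)

lemma summable_integral_norm_mittagLeffler3Term (hρ : 0 < ρ) (hm : 0 < m) (hγ : 0 < γ) {p : ℝ}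
    (hp : 1 < p) :
    Summable fun n => ∫ t in Set.Ioi 0, ‖mittagLeffler3Term ρ m γ p n t‖ := by
  refine ((hasSum_Gamma_mul_pow hγ (abs_rpow_neg_lt_one hρ hp)).summable.mul_left
    (ρ * p ^ (-m))).congr fun n => ?_
  rw [setIntegral_congr_fun measurableSet_Ioi fun t ht => norm_mittagLeffler3Term hρ hm hγ ht n,
    integral_const_mul, integral_mittagLeffler3Term hρ hm (by linarith), neg_pow (p ^ (-ρ))]
  have : ((-1 : ℝ) ^ n) * (-1) ^ n = 1 := by rw [← mul_pow]; simp
  linear_combination (-(ρ * p ^ (-m) * (Gamma (γ + n) / (Gamma γ * Gamma (1 + n)) *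
    (p ^ (-ρ)) ^ n))) * this

lemma lintegral_tsum_enorm_mittagLeffler3Term (hρ : 0 < ρ) (hm : 0 < m) (hγ : 0 < γ) {p : ℝ}
    (hp : 1 < p) :
    ∫⁻ t in Set.Ioi 0, ∑' n, ‖mittagLeffler3Term ρ m γ p n t‖ₑ ≠ ⊤ := by
  have hint := fun n =>
    integrableOn_mittagLeffler3Term (γ := γ) hρ hm (show 0 < p by linarith) n
  rw [lintegral_tsum fun n => (hint n).aestronglyMeasurable.enorm]
  simp_rw [← fun n => ofReal_integral_norm_eq_lintegral_enorm (hint n)]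
  exact (summable_integral_norm_mittagLeffler3Term hρ hm hγ hp).tsum_ofReal_ne_top

lemma summable_mittagLeffler3 (hρ : 0 < ρ) (hm : 0 < m) (hγ : 0 < γ) (x : ℝ) :
    Summable fun n => mittagLeffler3Coeff ρ m γ n * x ^ n := by
  have hae := ae_lt_top' (by
    refine AEMeasurable.tsum fun n => ?_
    exact (integrableOn_mittagLeffler3Term (γ := γ) hρ hm two_pos n).aestronglyMeasurable.enorm)
    (lintegral_tsum_enorm_mittagLeffler3Term hρ hm hγ one_lt_two)
  rw [ae_restrict_iff' measurableSet_Ioi] at hae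
  obtain ⟨t, ht, ht'⟩ := (Measure.dense_of_ae hae).exists_between
    (show max |x| 0 < max |x| 0 + 1 by linarith)
  have ht0 : 0 < t := lt_of_le_of_lt (le_max_right _ _) ht'.1
  have htx : |x| < t := lt_of_le_of_lt (le_max_left _ _) ht'.1
  have hs : Summable fun n => ‖mittagLeffler3Term ρ m γ 2 n t‖ := by
    have := ENNReal.summable_toReal (ht ht0).ne
    simpa using this
  set w := t ^ (m / ρ - 1) * exp (-2 * t ^ (1 / ρ)) with hw
  have hw0 : 0 < w := by positivity
  refine Summable.of_norm_bounded (hs.mul_right w⁻¹) fun n => ?_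
  rw [mittagLeffler3Term, ← hw, norm_mul _ w, norm_of_nonneg hw0.le,
    mul_inv_cancel_right₀ hw0.ne', norm_mul, norm_mul, norm_pow, norm_pow, norm_neg,
    norm_of_nonneg ht0.le, norm_eq_abs x]
  gcongr

lemma continuous_mittagLeffler3 (hρ : 0 < ρ) (hm : 0 < m) (hγ : 0 < γ) :
    Continuous (mittagLeffler3 ρ m γ) := by
  rw [continuous_iff_continuousAt]
  intro x
  have : ContinuousOn (mittagLeffler3 ρ m γ) (Metric.ball 0 (|x| + 1)) := by
    refine continuousOn_tsum (u := fun n => mittagLeffler3Coeff ρ m γ n * (|x| + 1) ^ n)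
      (fun n => by fun_prop) (summable_mittagLeffler3 hρ hm hγ _) fun n y hy => ?_
    have hc := mittagLeffler3Coeff_pos hρ hm hγ n
    rw [norm_mul, norm_pow, ← mittagLeffler3Coeff, norm_of_nonneg hc.le]
    gcongr
    exact (mem_ball_zero_iff.1 hy).le
  exact this.continuousAt (Metric.isOpen_ball.mem_nhds (by simp))

lemma tsum_mittagLeffler3Term (p t : ℝ) : ∑' n, mittagLeffler3Term ρ m γ p n t =
    exp (p * -t ^ (1 / ρ)) * (t ^ (m / ρ - 1) * mittagLeffler3 ρ m γ (-t)) := by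
  simp only [mittagLeffler3Term, tsum_mul_right]
  rw [mittagLeffler3, mul_neg, neg_mul]
  simp only [mittagLeffler3Coeff]
  ring

lemma integrableOn_exp_mul_mittagLeffler3 (hρ : 0 < ρ) (hm : 0 < m) (hγ : 0 < γ) {p : ℝ}
    (hp : 1 < p) : IntegrableOn (fun t => exp (p * -t ^ (1 / ρ)) *
      (t ^ (m / ρ - 1) * mittagLeffler3 ρ m γ (-t))) (Set.Ioi 0) := by
  have hc := (continuous_mittagLeffler3 hρ hm hγ).measurable
  refine ⟨by fun_prop, lt_of_le_of_lt (lintegral_mono fun t => ?_)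
    (lintegral_tsum_enorm_mittagLeffler3Term hρ hm hγ hp).lt_top⟩
  beta_reduce
  rw [← tsum_mittagLeffler3Term]
  exact enorm_tsum_le_tsum_enorm

/-- The Laplace transform of `t ^ (m / ρ - 1) * E(-t)` in the variable `t ^ (1 / ρ)`. -/
lemma integral_exp_mul_mittagLeffler3 (hρ : 0 < ρ) (hm : 0 < m) (hγ : 0 < γ) {p : ℝ}
    (hp : 1 < p) : ∫ t in Set.Ioi 0, exp (p * -t ^ (1 / ρ)) *
      (t ^ (m / ρ - 1) * mittagLeffler3 ρ m γ (-t)) =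
      ρ * (p ^ (ρ * γ - m) * (1 + p ^ ρ) ^ (-γ)) := by
  have hp0 : 0 < p := by linarith
  have h1 := hasSum_integral_of_summable_integral_norm
    (fun n => integrableOn_mittagLeffler3Term (γ := γ) hρ hm hp0 n)
    (summable_integral_norm_mittagLeffler3Term hρ hm hγ hp)
  simp_rw [integral_mittagLeffler3Term hρ hm hp0, tsum_mittagLeffler3Term] at h1
  have h2 := (hasSum_Gamma_mul_pow hγ (x := -p ^ (-ρ))
    (by rw [abs_neg]; exact abs_rpow_neg_lt_one hρ hp)).mul_left (ρ * p ^ (-m))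
  rw [h1.unique h2, show 1 - -p ^ (-ρ) = p ^ (-ρ) * (1 + p ^ ρ) by
      rw [mul_add, ← rpow_add hp0]; simp; ring,
    mul_rpow (by positivity) (by positivity), ← rpow_mul hp0.le,
    show ρ * γ - m = -m + -ρ * -γ by ring, rpow_add hp0]
  ring

end MittagLeffler

/-- `ν` is the law of `1 / X_{a,b,c,d}`. -/
def IsReciprocalXLaw (a b c d : ℝ) (ν : Measure ℝ) : Prop :=
  ν (Set.Ioi (0 : ℝ))ᶜ = 0 ∧ ∀ s ∈ Set.Ioo (-a) b,
    ∫⁻ t, ENNReal.ofReal (t ^ (-s)) ∂ν = ENNReal.ofReal (Gamma c / (Gamma a * Gamma b) *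
      (Gamma (a + s) * Gamma (b - s) / Gamma (c + d * s)))

lemma ofReal_exp_mul_log {p : ℝ} (hp : 0 < p) (σ : ℝ) :
    ENNReal.ofReal (exp (σ * log p)) = ENNReal.ofReal (p ^ σ) := by
  rw [rpow_def_of_pos hp, mul_comm]

lemma lintegral_exp_mul_log_withDensity {H : ℝ → ENNReal} (hH : Measurable H) (σ : ℝ) :
    ∫⁻ p, ENNReal.ofReal (exp (σ * log p)) ∂(volume.restrict (Set.Ioi 0)).withDensity H =
      ∫⁻ p in Set.Ioi 0, ENNReal.ofReal (p ^ σ) * H p := by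
  rw [lintegral_withDensity_eq_lintegral_mul _ hH (by fun_prop)]
  refine setLIntegral_congr_fun measurableSet_Ioi fun p hp => ?_
  simp only [Pi.mul_apply]
  rw [ofReal_exp_mul_log hp, mul_comm]

lemma withDensity_restrict_compl_Ioi (f : ℝ → ENNReal) :
    (volume.restrict (Set.Ioi (0 : ℝ))).withDensity f (Set.Ioi 0)ᶜ = 0 :=
  withDensity_absolutelyContinuous _ _ (by
    rw [Measure.restrict_apply measurableSet_Ioi.compl, Set.compl_inter_self, measure_empty])

section

variable {a b c d : ℝ}

lemma ext_of_isReciprocalXLaw (ha : 0 < a) (hb : 0 < b) {ν₁ ν₂ : Measure ℝ}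
    (h₁ : IsReciprocalXLaw a b c d ν₁) (h₂ : IsReciprocalXLaw a b c d ν₂) : ν₁ = ν₂ := by
  have key : ∀ ν, IsReciprocalXLaw a b c d ν → ∀ s ∈ Set.Ioo (-b) a,
      ∫⁻ t, ENNReal.ofReal (exp (s * log t)) ∂ν = ENNReal.ofReal (Gamma c / (Gamma a * Gamma b) *
      (Gamma (a + -s) * Gamma (b - -s) / Gamma (c + d * -s))) := by
    intro ν hν s hs
    rw [← hν.2 (-s) ⟨by linarith [hs.2], by linarith [hs.1]⟩]
    have hae : ∀ᵐ t ∂ν, t ∈ Set.Ioi (0 : ℝ) := mem_ae_iff.2 hν.1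
    refine lintegral_congr_ae ?_
    filter_upwards [hae] with t ht
    rw [ofReal_exp_mul_log ht, neg_neg]
  refine ext_of_lintegral_exp_mul_eq measurable_log measurable_exp (fun t ht => exp_log ht)
    h₁.1 h₂.1 (show -b < a by linarith) (.of_forall fun s hs => ?_) (.of_forall fun s hs => ?_)
  · rw [key _ h₁ s hs]; exact ENNReal.ofReal_ne_top
  · rw [key _ h₁ s hs, key _ h₂ s hs]

lemma lintegral_rpow_mul_laplace (hd : 0 < d) {s : ℝ} (hs : s ∈ Set.Ioo (-a) b) :
    ∫⁻ p in Set.Ioi (0 : ℝ), ENNReal.ofReal (p ^ (c + d * s - 1)) * ENNReal.ofReal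
        (d * (p ^ (d * (a + b) - (c + b * d)) * (1 + p ^ d) ^ (-(a + b)))) =
      ENNReal.ofReal (Gamma (a + s) * Gamma (b - s) / Gamma (a + b)) := by
  have h1 : 0 < a + s := by linarith [hs.1]
  have h2 : 0 < b - s := by linarith [hs.2]
  have hΓ := Gamma_pos_of_pos (show 0 < a + b by linarith)
  have h3 := lintegral_rpow_mul_one_add_rpow hd h1 h2
  rw [show a + s + (b - s) = a + b by ring] at h3
  calc _ = ∫⁻ p in Set.Ioi (0 : ℝ), ENNReal.ofReal d * ENNReal.ofReal
        (p ^ (d * (a + s) - 1) * (1 + p ^ d) ^ (-(a + b))) := by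
        refine setLIntegral_congr_fun measurableSet_Ioi fun p hp => ?_
        have hp' : (0 : ℝ) < p := hp
        rw [← ENNReal.ofReal_mul (by positivity), ← ENNReal.ofReal_mul hd.le,
          show d * (a + s) - 1 = (c + d * s - 1) + (d * (a + b) - (c + b * d)) by ring,
          rpow_add hp']
        congr 1; ring
    _ = _ := by
        rw [lintegral_const_mul _ (by fun_prop), h3, ← ENNReal.ofReal_mul hd.le]
        congr 1
        field_simp

lemma IsReciprocalXLaw.isProbabilityMeasure (ha : 0 < a) (hb : 0 < b) (hc : 0 < c)
    {ν : Measure ℝ} (h : IsReciprocalXLaw a b c d ν) : IsProbabilityMeasure ν := by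
  constructor
  have := h.2 0 ⟨by linarith, hb⟩
  have h1 := (Gamma_pos_of_pos ha).ne'
  have h2 := (Gamma_pos_of_pos hb).ne'
  have h3 := (Gamma_pos_of_pos hc).ne'
  simp only [neg_zero, rpow_zero, ENNReal.ofReal_one, lintegral_one, add_zero, sub_zero,
    mul_zero] at this
  rw [this, ← ENNReal.ofReal_one]
  congr 1
  field_simp

/-- The Laplace transform in the variable `t ^ (1 / d)` of `t ^ (c / d)` times the law of
`1 / X_{a,b,c,d}`. -/
lemma IsReciprocalXLaw.ae_lintegral_exp_eq (ha : 0 < a) (hb : 0 < b) (hc : 0 < c) (hd : 0 < d)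
    {ν : Measure ℝ} (h : IsReciprocalXLaw a b c d ν) :
    ∀ᵐ p ∂volume.restrict (Set.Ioi (0 : ℝ)), ∫⁻ t, ENNReal.ofReal (exp (p * -t ^ (1 / d)))
        ∂ν.withDensity (fun t => ENNReal.ofReal (t ^ (c / d))) =
      ENNReal.ofReal (Gamma c / (Gamma a * Gamma b) * Gamma (a + b)) * ENNReal.ofReal
        (d * (p ^ (d * (a + b) - (c + b * d)) * (1 + p ^ d) ^ (-(a + b)))) := by
  have := h.isProbabilityMeasure ha hb hc
  have hK : 0 < Gamma c / (Gamma a * Gamma b) := div_pos (Gamma_pos_of_pos hc)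
    (mul_pos (Gamma_pos_of_pos ha) (Gamma_pos_of_pos hb))
  have hΓ := Gamma_pos_of_pos (add_pos ha hb)
  set M := ν.withDensity (fun t => ENNReal.ofReal (t ^ (c / d))) with hM
  have hM0 : M (Set.Ioi 0)ᶜ = 0 := withDensity_absolutelyContinuous _ _ h.1
  set H : ℝ → ENNReal := fun p => ∫⁻ t, ENNReal.ofReal (exp (p * -t ^ (1 / d))) ∂M with hH
  have hHm : Measurable H := by
    refine Measurable.lintegral_prod_right' (f := fun q : ℝ × ℝ =>
      ENNReal.ofReal (exp (q.1 * -q.2 ^ (1 / d)))) ?_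
    fun_prop
  set L : ℝ → ENNReal := fun p => ENNReal.ofReal (Gamma c / (Gamma a * Gamma b) * Gamma (a + b)) *
    ENNReal.ofReal (d * (p ^ (d * (a + b) - (c + b * d)) * (1 + p ^ d) ^ (-(a + b)))) with hL
  have hLm : Measurable L := by fun_prop
  have hmom : ∀ s ∈ Set.Ioo (-a) b, 0 < c + d * s →
      ∫⁻ p in Set.Ioi 0, ENNReal.ofReal (p ^ (c + d * s - 1)) * H p =
        ENNReal.ofReal (Gamma c / (Gamma a * Gamma b) * (Gamma (a + s) * Gamma (b - s))) := by
    intro s hs hz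
    have hΓz := Gamma_pos_of_pos hz
    rw [lintegral_rpow_mul_lintegral_exp_neg hM0 hz,
      lintegral_withDensity_eq_lintegral_mul _ (by fun_prop) (by fun_prop)]
    have hae : ∀ᵐ t ∂ν, t ∈ Set.Ioi (0 : ℝ) := mem_ae_iff.2 h.1
    rw [lintegral_congr_ae (g := fun t => ENNReal.ofReal (t ^ (-s))), h.2 s hs,
      ← ENNReal.ofReal_mul hΓz.le]
    · congr 1; field_simp
    · filter_upwards [hae] with t ht
      have ht' : (0 : ℝ) < t := ht
      simp only [Pi.mul_apply]
      rw [← ENNReal.ofReal_mul (by positivity), ← rpow_add ht']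
      congr 2; field_simp; ring
  have hmomL : ∀ s ∈ Set.Ioo (-a) b,
      ∫⁻ p in Set.Ioi 0, ENNReal.ofReal (p ^ (c + d * s - 1)) * L p =
        ENNReal.ofReal (Gamma c / (Gamma a * Gamma b) * (Gamma (a + s) * Gamma (b - s))) := by
    intro s hs
    have := lintegral_rpow_mul_laplace (c := c) hd hs
    simp only [hL, mul_left_comm (ENNReal.ofReal (_ ^ (c + d * s - 1)))]
    rw [lintegral_const_mul _ (by fun_prop), this, ← ENNReal.ofReal_mul (by positivity)]
    congr 1; field_simp
  suffices hsuff : (volume.restrict (Set.Ioi (0 : ℝ))).withDensity H =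
      (volume.restrict (Set.Ioi (0 : ℝ))).withDensity L from
    (withDensity_eq_iff_of_sigmaFinite hHm.aemeasurable hLm.aemeasurable).1 hsuff
  have hσ : ∀ σ ∈ Set.Ioo (max (-1) (c - 1 - d * a)) (c - 1 + d * b),
      ∃ s ∈ Set.Ioo (-a) b, 0 < c + d * s ∧ σ = c + d * s - 1 := by
    intro σ hσ
    have h1 := (max_lt_iff.1 hσ.1)
    refine ⟨(σ + 1 - c) / d, ⟨?_, ?_⟩, ?_, ?_⟩
    · rw [lt_div_iff₀ hd]; linarith
    · rw [div_lt_iff₀ hd]; linarith [hσ.2]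
    · field_simp; linarith
    · field_simp; ring
  have hlt : max (-1) (c - 1 - d * a) < c - 1 + d * b := by
    have := mul_pos hd hb
    have := mul_pos hd ha
    exact max_lt (by linarith) (by linarith)
  refine ext_of_lintegral_exp_mul_eq measurable_log measurable_exp (fun t ht => exp_log ht)
    (withDensity_restrict_compl_Ioi _) (withDensity_restrict_compl_Ioi _) hlt
    (.of_forall fun σ h' => ?_) (.of_forall fun σ h' => ?_)
  all_goals obtain ⟨s, hs, hz, rfl⟩ := hσ σ h'
  · rw [lintegral_exp_mul_log_withDensity hHm, hmom s hs hz]; exact ENNReal.ofReal_ne_top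
  · rw [lintegral_exp_mul_log_withDensity hHm, lintegral_exp_mul_log_withDensity hLm,
      hmom s hs hz, hmomL s hs]

/-- If `1 / X_{a,b,c,d}` has a law, its would-be density is nonnegative. -/
lemma IsReciprocalXLaw.mittagLeffler3_nonneg (ha : 0 < a) (hb : 0 < b) (hc : 0 < c) (hd : 0 < d)
    {ν : Measure ℝ} (h : IsReciprocalXLaw a b c d ν) {t : ℝ} (ht : 0 < t) :
    0 ≤ mittagLeffler3 d (c + b * d) (a + b) (-t) := by
  have hm : 0 < c + b * d := by positivity
  have hγ := add_pos ha hb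
  have hcont := continuous_mittagLeffler3 hd hm hγ
  have hmeas := hcont.measurable
  have hC : 0 < Gamma c / (Gamma a * Gamma b) * Gamma (a + b) :=
    mul_pos (div_pos (Gamma_pos_of_pos hc) (mul_pos (Gamma_pos_of_pos ha) (Gamma_pos_of_pos hb)))
      (Gamma_pos_of_pos hγ)
  have hlap := h.ae_lintegral_exp_eq ha hb hc hd
  set C := Gamma c / (Gamma a * Gamma b) * Gamma (a + b)
  set E := mittagLeffler3 d (c + b * d) (a + b)
  set M := ν.withDensity (fun t => ENNReal.ofReal (t ^ (c / d)))
  set f : ℝ → ℝ := fun t => C * (t ^ ((c + b * d) / d - 1) * E (-t)) with hf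
  have hfm : Measurable f := by fun_prop
  set V := volume.restrict (Set.Ioi (0 : ℝ))
  have hlin : ∀ g : ℝ → ℝ, Measurable g → ∀ p : ℝ,
      ∫⁻ t, ENNReal.ofReal (exp (p * -t ^ (1 / d))) ∂V.withDensity (fun t => ENNReal.ofReal (g t)) =
      ∫⁻ t, ENNReal.ofReal (exp (p * -t ^ (1 / d)) * g t) ∂V := by
    intro g hg p
    rw [lintegral_withDensity_eq_lintegral_mul _ (by fun_prop) (by fun_prop)]
    refine lintegral_congr fun t => ?_
    rw [Pi.mul_apply, ENNReal.ofReal_mul (exp_pos _).le, mul_comm]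
  have hint : ∀ p, 1 < p → Integrable (fun t => exp (p * -t ^ (1 / d)) * f t) V := by
    intro p hp
    refine (Integrable.const_mul (integrableOn_exp_mul_mittagLeffler3 hd hm hγ hp) C).congr
      (.of_forall fun t => ?_)
    simp only [hf]; ring
  have hsplit : ∀ᵐ p, p ∈ Set.Ioo (1 : ℝ) 2 →
      ∫⁻ t, ENNReal.ofReal (exp (p * -t ^ (1 / d)))
        ∂(M + V.withDensity (fun t => ENNReal.ofReal (-f t))) =
      ∫⁻ t, ENNReal.ofReal (exp (p * -t ^ (1 / d)))
        ∂V.withDensity (fun t => ENNReal.ofReal (f t)) := by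
    rw [ae_restrict_iff' measurableSet_Ioi] at hlap
    filter_upwards [hlap] with p hp' hp
    have hp0 : 0 < p := by linarith [hp.1]
    rw [lintegral_add_measure, hp' hp0, hlin f hfm, hlin (fun t => -f t) hfm.neg,
      ← ENNReal.ofReal_mul hC.le]
    have hI : ∫ t, exp (p * -t ^ (1 / d)) * f t ∂V =
        C * (d * (p ^ (d * (a + b) - (c + b * d)) * (1 + p ^ d) ^ (-(a + b)))) := by
      rw [← integral_exp_mul_mittagLeffler3 hd hm hγ hp.1, ← integral_const_mul]
      refine integral_congr_ae (.of_forall fun t => ?_)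
      simp only [hf]; ring
    have hneg : ∫⁻ t, ENNReal.ofReal (exp (p * -t ^ (1 / d)) * -f t) ∂V ≠ ⊤ := by
      simpa using (hint p hp.1).neg.lintegral_lt_top.ne
    have hpos := (hint p hp.1).lintegral_lt_top.ne
    have hI' := integral_eq_lintegral_pos_part_sub_lintegral_neg_part (hint p hp.1)
    simp only [← mul_neg] at hI'
    rw [← hI, hI', ENNReal.ofReal_sub _ ENNReal.toReal_nonneg, ENNReal.ofReal_toReal hpos,
      ENNReal.ofReal_toReal hneg, tsub_add_cancel_of_le]
    rw [← ENNReal.toReal_le_toReal hneg hpos, ← sub_nonneg, ← hI', hI]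
    positivity
  have hMM : M + V.withDensity (fun t => ENNReal.ofReal (-f t)) =
      V.withDensity (fun t => ENNReal.ofReal (f t)) := by
    symm
    refine ext_of_lintegral_exp_mul_eq (φ := fun t => -t ^ (1 / d)) (ψ := fun y => (-y) ^ d)
      (by fun_prop) (by fun_prop) (fun t ht => ?_) (withDensity_restrict_compl_Ioi _) ?_
      one_lt_two (.of_forall fun p hp => ?_) ?_
    · simp only [neg_neg]
      rw [← rpow_mul ht.le, one_div_mul_cancel hd.ne', rpow_one]
    · rw [Measure.add_apply, withDensity_restrict_compl_Ioi, add_zero]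
      exact withDensity_absolutelyContinuous _ _ h.1
    · rw [hlin f hfm]
      exact (hint p hp.1).lintegral_lt_top.ne
    · filter_upwards [hsplit] with p hp hp' using (hp hp').symm
  set N : Set ℝ := Set.Ioi 0 ∩ {t | E (-t) < 0} with hN
  have hNo : IsOpen N := isOpen_Ioi.inter (isOpen_lt (by fun_prop) continuous_const)
  have hfN : ∀ t ∈ N, f t < 0 := fun t ht =>
    mul_neg_of_pos_of_neg hC (mul_neg_of_pos_of_neg (rpow_pos_of_pos ht.1 _) ht.2)
  have hN2 : V.withDensity (fun t => ENNReal.ofReal (f t)) N = 0 := by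
    rw [withDensity_apply_eq_zero (by fun_prop)]
    convert measure_empty (μ := V)
    ext t
    simp only [Set.mem_inter_iff, Set.mem_ofPred_eq, Set.mem_empty_iff_false, iff_false, not_and]
    intro h1 h2
    exact h1 (ENNReal.ofReal_eq_zero.2 (hfN t h2).le)
  rw [← hMM, Measure.add_apply, add_eq_zero] at hN2
  have hRN : V N = 0 := by
    refine measure_mono_null (Set.subset_inter (fun t ht => ?_) subset_rfl)
      ((withDensity_apply_eq_zero (by fun_prop)).1 hN2.2)
    simpa using hfN t ht
  have hvol : volume N = 0 := by
    rwa [Measure.restrict_apply hNo.measurableSet, Set.inter_eq_self_of_subset_left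
      Set.inter_subset_left] at hRN
  rw [hNo.measure_eq_zero_iff volume] at hvol
  by_contra hcon
  exact (hvol ▸ Set.notMem_empty t) ⟨ht, not_le.1 hcon⟩

end

lemma mittagLeffler3_zero (ρ m γ : ℝ) : mittagLeffler3 ρ m γ 0 = mittagLeffler3Coeff ρ m γ 0 := by
  rw [mittagLeffler3, tsum_eq_single 0 fun n hn => by simp [hn]]
  simp [mittagLeffler3Coeff]

lemma analyticAt_rpow_const {x : ℝ} (hx : 0 < x) (y : ℝ) : AnalyticAt ℝ (fun x : ℝ => x ^ y) x :=
  (contDiffAt_rpow_const_of_ne hx.ne').analyticAt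

section

variable {a b c d : ℝ}

lemma lintegral_exp_mittagLeffler3_eq {ρ m γ : ℝ} (hρ : 0 < ρ) (hm : 0 < m) (hγ : 0 < γ)
    (hE : ∀ t, 0 < t → 0 ≤ mittagLeffler3 ρ m γ (-t)) {p : ℝ} (hp : 0 < p) :
    ∫⁻ t, ENNReal.ofReal (exp (p * -t ^ (1 / ρ))) ∂(volume.restrict (Set.Ioi 0)).withDensity
      (fun t => ENNReal.ofReal (t ^ (m / ρ - 1) * mittagLeffler3 ρ m γ (-t))) =
      ENNReal.ofReal (ρ * (p ^ (ρ * γ - m) * (1 + p ^ ρ) ^ (-γ))) := by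
  have hmeas := (continuous_mittagLeffler3 hρ hm hγ).measurable
  have hY : Measurable fun t : ℝ => -t ^ (1 / ρ) := by fun_prop
  set M := (volume.restrict (Set.Ioi 0)).withDensity
      (fun t => ENNReal.ofReal (t ^ (m / ρ - 1) * mittagLeffler3 ρ m γ (-t))) with hM
  set G : ℝ → ℝ := fun p => ρ * (p ^ (ρ * γ - m) * (1 + p ^ ρ) ^ (-γ)) with hG
  have hG0 : ∀ p, 0 < p → 0 ≤ G p := fun p hp => by positivity
  have h1 : ∀ p, 1 < p →
      ∫⁻ t, ENNReal.ofReal (exp (p * -t ^ (1 / ρ))) ∂M = ENNReal.ofReal (G p) := by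
    intro p hp
    rw [lintegral_withDensity_eq_lintegral_mul _ (by fun_prop) (by fun_prop)]
    simp only [hG]
    rw [← integral_exp_mul_mittagLeffler3 hρ hm hγ hp, ofReal_integral_eq_lintegral_ofReal
        (integrableOn_exp_mul_mittagLeffler3 hρ hm hγ hp)]
    · refine lintegral_congr fun t => ?_
      rw [Pi.mul_apply, ENNReal.ofReal_mul (exp_pos _).le, mul_comm]
    · filter_upwards [ae_restrict_mem measurableSet_Ioi] with t ht
      exact mul_nonneg (exp_pos _).le (mul_nonneg (rpow_nonneg (le_of_lt ht) _) (hE t ht))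
  have hGan : AnalyticOnNhd ℝ G (Set.Ioi 0) := by
    intro p hp
    have hp' : (0 : ℝ) < p := hp
    exact analyticAt_const.mul ((analyticAt_rpow_const hp' _).mul
      ((analyticAt_rpow_const (by positivity) (-γ)).fun_comp
        (analyticAt_const.add (analyticAt_rpow_const hp' ρ))))
  have hM0 : ∀ᵐ t ∂M, t ∈ Set.Ioi (0 : ℝ) := mem_ae_iff.2 (withDensity_restrict_compl_Ioi _)
  have hL := mem_integrableExpSet_of_analyticOnNhd hY
    (by filter_upwards [hM0] with t ht using neg_nonpos.2 (rpow_nonneg (le_of_lt ht) _)) hGan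
    (fun p hp => by
      rw [mem_integrableExpSet_iff_lintegral_ne_top hY, h1 p hp]; exact ENNReal.ofReal_ne_top)
    (fun p hp => by
      rw [mgf_eq_toReal_lintegral hY, h1 p hp,
        ENNReal.toReal_ofReal (hG0 p (by linarith))]) hp
  rw [mem_integrableExpSet_iff_lintegral_ne_top hY, mgf_eq_toReal_lintegral hY] at hL
  rw [← ENNReal.ofReal_toReal hL.1, hL.2]

/-- The Mellin transform of a nonnegative Mittag-Leffler function. -/
lemma lintegral_rpow_mul_mittagLeffler3 (ha : 0 < a) (hb : 0 < b) (hc : 0 < c) (hd : 0 < d)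
    (hE : ∀ t, 0 < t → 0 ≤ mittagLeffler3 d (c + b * d) (a + b) (-t)) {s : ℝ}
    (hs : s ∈ Set.Ioo (-a) b) (hz : 0 < c + d * s) :
    ENNReal.ofReal (Gamma (c + d * s)) * ∫⁻ t in Set.Ioi (0 : ℝ),
        ENNReal.ofReal (t ^ (b - 1 - s) * mittagLeffler3 d (c + b * d) (a + b) (-t)) =
      ENNReal.ofReal (Gamma (a + s) * Gamma (b - s) / Gamma (a + b)) := by
  have hm : 0 < c + b * d := by positivity
  have hγ := add_pos ha hb
  have hmeas := (continuous_mittagLeffler3 hd hm hγ).measurable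
  have h := lintegral_rpow_mul_lintegral_exp_neg (r := 1 / d) (withDensity_restrict_compl_Ioi
    (fun t => ENNReal.ofReal (t ^ ((c + b * d) / d - 1) *
      mittagLeffler3 d (c + b * d) (a + b) (-t)))) hz
  rw [setLIntegral_congr_fun measurableSet_Ioi fun p hp => by
      rw [lintegral_exp_mittagLeffler3_eq hd hm hγ hE hp], lintegral_rpow_mul_laplace hd hs,
    lintegral_withDensity_eq_lintegral_mul _ (by fun_prop) (by fun_prop)] at h
  rw [h]
  congr 1
  refine setLIntegral_congr_fun measurableSet_Ioi fun t ht => ?_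
  have ht' : (0 : ℝ) < t := ht
  rw [Pi.mul_apply, mul_comm (ENNReal.ofReal _), ← ENNReal.ofReal_mul (by positivity),
    ← mul_assoc, ← rpow_add ht']
  congr 3
  field_simp
  ring

/-- Nonnegativity of the Mittag-Leffler function forces `a d ≤ c`. -/
lemma mul_le_of_mittagLeffler3_nonneg (ha : 0 < a) (hb : 0 < b) (hc : 0 < c) (hd : 0 < d)
    (hE : ∀ t, 0 < t → 0 ≤ mittagLeffler3 d (c + b * d) (a + b) (-t)) : d * a ≤ c := by
  by_contra! hcon
  have hm : 0 < c + b * d := by positivity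
  have hγ := add_pos ha hb
  have hcont := continuous_mittagLeffler3 hd hm hγ
  have hmeas := hcont.measurable
  have hE0 : 0 < mittagLeffler3 d (c + b * d) (a + b) 0 := by
    rw [mittagLeffler3_zero]; exact mittagLeffler3Coeff_pos hd hm hγ 0
  have hmellin := fun s => lintegral_rpow_mul_mittagLeffler3 (s := s) ha hb hc hd hE
  set E := mittagLeffler3 d (c + b * d) (a + b)
  set κ := ∫⁻ t in Set.Ioc (0 : ℝ) 1, ENNReal.ofReal (t ^ (b - 1 + c / d) * E (-t)) with hκ
  have hκ0 : 0 < κ := by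
    rw [hκ, setLIntegral_pos_iff (by fun_prop)]
    have hopen : IsOpen (Set.Ioo (0 : ℝ) 1 ∩ {t | 0 < E (-t)}) :=
      isOpen_Ioo.inter (isOpen_lt continuous_const (by fun_prop))
    have hne : (Set.Ioo (0 : ℝ) 1 ∩ {t | 0 < E (-t)}).Nonempty := by
      have hev : ∀ᶠ t in nhds (0 : ℝ), 0 < E (-t) :=
        (hcont.comp continuous_neg).continuousAt.eventually (lt_mem_nhds (by simpa using hE0))
      exact Filter.nonempty_of_mem (Filter.inter_mem (Ioo_mem_nhdsGT (zero_lt_one (α := ℝ)))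
        (nhdsWithin_le_nhds hev))
    refine (hopen.measure_pos volume hne).trans_le (measure_mono fun t ht => ⟨?_, ht.1.1, ht.1.2.le⟩)
    simpa using mul_pos (rpow_pos_of_pos ht.1.1 _) ht.2
  have hle : ∀ᶠ z in nhdsWithin (0 : ℝ) (Set.Ioi 0), ENNReal.ofReal (Gamma (z + 1)) * κ ≤
      ENNReal.ofReal (z * (Gamma (a + (z - c) / d) * Gamma (b - (z - c) / d) / Gamma (a + b))) := by
    filter_upwards [Ioo_mem_nhdsGT hc] with z hz
    have hs : (z - c) / d ∈ Set.Ioo (-a) b := by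
      constructor
      · rw [lt_div_iff₀ hd]; linarith [hz.1]
      · exact (div_neg_of_neg_of_pos (by linarith [hz.2]) hd).trans hb
    have hzs : c + d * ((z - c) / d) = z := by field_simp; ring
    have := hmellin _ hs (by rw [hzs]; exact hz.1)
    rw [hzs] at this
    rw [ENNReal.ofReal_mul hz.1.le, ← this, Gamma_add_one hz.1.ne', ENNReal.ofReal_mul hz.1.le,
      mul_assoc]
    gcongr
    refine (setLIntegral_mono' measurableSet_Ioc fun t ht => ?_).trans
      (lintegral_mono_set Set.Ioc_subset_Ioi_self)
    refine ENNReal.ofReal_le_ofReal (mul_le_mul_of_nonneg_right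
      (rpow_le_rpow_of_exponent_ge ht.1 ht.2 ?_) (hE t ht.1))
    rw [sub_div]
    have := div_pos hz.1 hd
    linarith
  have hlim1 : Filter.Tendsto (fun z => ENNReal.ofReal (Gamma (z + 1)) * κ)
      (nhdsWithin (0 : ℝ) (Set.Ioi 0)) (nhds (ENNReal.ofReal 1 * κ)) := by
    refine ENNReal.Tendsto.mul_const (ENNReal.tendsto_ofReal ?_) (.inl (by simp))
    have : ContinuousAt (fun z : ℝ => Gamma (z + 1)) 0 := by
      refine ContinuousAt.comp (g := Gamma) ?_ (by fun_prop)
      refine (differentiableAt_Gamma fun n => ?_).continuousAt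
      have := n.cast_nonneg (α := ℝ)
      intro h
      linarith
    have := this.tendsto
    simp only [zero_add, Gamma_one] at this
    exact this.mono_left nhdsWithin_le_nhds
  have hΓc : ∀ x : ℝ, 0 < x → ContinuousAt Gamma x := fun x hx =>
    (differentiableAt_Gamma fun n => by
      have := n.cast_nonneg (α := ℝ)
      intro h
      linarith).continuousAt
  have hlim2 : Filter.Tendsto (fun z => ENNReal.ofReal
      (z * (Gamma (a + (z - c) / d) * Gamma (b - (z - c) / d) / Gamma (a + b))))
      (nhdsWithin (0 : ℝ) (Set.Ioi 0)) (nhds 0) := by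
    have hca : 0 < a + (0 - c) / d := by
      have : c / d < a := by rw [div_lt_iff₀ hd]; linarith
      rw [zero_sub, neg_div]; linarith
    have hcb : 0 < b - (0 - c) / d := by
      have := div_pos hc hd
      rw [zero_sub, neg_div]; linarith
    have : ContinuousAt (fun z : ℝ =>
        z * (Gamma (a + (z - c) / d) * Gamma (b - (z - c) / d) / Gamma (a + b))) 0 :=
      continuousAt_id.mul (((ContinuousAt.comp (g := Gamma)
        (f := fun z => a + (z - c) / d) (hΓc _ hca) (by fun_prop)).mul
        (ContinuousAt.comp (g := Gamma)
        (f := fun z => b - (z - c) / d) (hΓc _ hcb) (by fun_prop))).div_const _)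
    have := ENNReal.tendsto_ofReal this.tendsto
    simp only [zero_mul, ENNReal.ofReal_zero] at this
    exact this.mono_left nhdsWithin_le_nhds
  have := le_of_tendsto_of_tendsto hlim1 hlim2 hle
  simp only [ENNReal.ofReal_one, one_mul] at this
  exact absurd this (not_le.2 hκ0)

lemma isReciprocalXLaw_withDensity (ha : 0 < a) (hb : 0 < b) (hc : 0 < c) (hd : 0 < d)
    (hE : ∀ t, 0 < t → 0 ≤ mittagLeffler3 d (c + b * d) (a + b) (-t)) :
    IsReciprocalXLaw a b c d ((volume.restrict (Set.Ioi (0 : ℝ))).withDensity fun t =>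
      ENNReal.ofReal (Gamma c * Gamma (a + b) / (Gamma a * Gamma b) * t ^ (b - 1) *
        mittagLeffler3 d (c + b * d) (a + b) (-t))) := by
  refine ⟨withDensity_restrict_compl_Ioi _, fun s hs => ?_⟩
  have hcd := mul_le_of_mittagLeffler3_nonneg ha hb hc hd hE
  have hz : 0 < c + d * s := by
    have := mul_lt_mul_of_pos_left hs.1 hd
    linarith
  have hm : 0 < c + b * d := by positivity
  have hγ := add_pos ha hb
  have hmeas := (continuous_mittagLeffler3 hd hm hγ).measurable
  have h := lintegral_rpow_mul_mittagLeffler3 ha hb hc hd hE hs hz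
  have hΓa := Gamma_pos_of_pos ha
  have hΓb := Gamma_pos_of_pos hb
  have hΓc := Gamma_pos_of_pos hc
  have hΓγ := Gamma_pos_of_pos hγ
  have hΓz := Gamma_pos_of_pos hz
  set K := Gamma c * Gamma (a + b) / (Gamma a * Gamma b) with hK
  have hK0 : 0 < K := by positivity
  have hJ : ∫⁻ t, ENNReal.ofReal (t ^ (-s)) ∂((volume.restrict (Set.Ioi (0 : ℝ))).withDensity
      fun t => ENNReal.ofReal (K * t ^ (b - 1) * mittagLeffler3 d (c + b * d) (a + b) (-t))) =
      ENNReal.ofReal K * ∫⁻ t in Set.Ioi (0 : ℝ),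
        ENNReal.ofReal (t ^ (b - 1 - s) * mittagLeffler3 d (c + b * d) (a + b) (-t)) := by
    rw [lintegral_withDensity_eq_lintegral_mul _ (by fun_prop) (by fun_prop),
      ← lintegral_const_mul _ (by fun_prop)]
    refine setLIntegral_congr_fun measurableSet_Ioi fun t ht => ?_
    have ht' : (0 : ℝ) < t := ht
    rw [Pi.mul_apply, mul_comm, ← ENNReal.ofReal_mul (by positivity), ← ENNReal.ofReal_mul hK0.le,
      show b - 1 - s = -s + (b - 1) by ring, rpow_add ht']
    congr 1; ring
  rw [hJ, ← ENNReal.mul_right_inj (a := ENNReal.ofReal (Gamma (c + d * s))) (by simpa using hΓz)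
    ENNReal.ofReal_ne_top, mul_left_comm, h, ← ENNReal.ofReal_mul hK0.le,
    ← ENNReal.ofReal_mul hΓz.le]
  congr 1
  rw [hK]
  generalize Gamma (c + d * s) = w at hΓz
  field_simp

lemma IsXLaw.isReciprocalXLaw {μ : Measure ℝ} (h : IsXLaw a b c d μ) :
    IsReciprocalXLaw a b c d (μ.map fun x => x⁻¹) := by
  refine ⟨?_, fun s hs => ?_⟩
  · rw [Measure.map_apply measurable_inv measurableSet_Ioi.compl]
    convert h.2.1 using 2
    ext x
    simp
  · rw [lintegral_map (by fun_prop) measurable_inv, ← h.2.2 s hs]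
    have hae : ∀ᵐ x ∂μ, x ∈ Set.Ioi (0 : ℝ) := mem_ae_iff.2 h.2.1
    refine lintegral_congr_ae ?_
    filter_upwards [hae] with x hx
    rw [inv_rpow (le_of_lt hx), rpow_neg (le_of_lt hx), inv_inv]

lemma IsReciprocalXLaw.isXLaw (ha : 0 < a) (hb : 0 < b) (hc : 0 < c) {ν : Measure ℝ}
    (h : IsReciprocalXLaw a b c d ν) : IsXLaw a b c d (ν.map fun t => t⁻¹) := by
  have := h.isProbabilityMeasure ha hb hc
  refine ⟨Measure.isProbabilityMeasure_map measurable_inv.aemeasurable, ?_, fun s hs => ?_⟩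
  · rw [Measure.map_apply measurable_inv measurableSet_Ioi.compl]
    convert h.1 using 2
    ext x
    simp
  · rw [lintegral_map (by fun_prop) measurable_inv, ← h.2 s hs]
    have hae : ∀ᵐ x ∂ν, x ∈ Set.Ioi (0 : ℝ) := mem_ae_iff.2 h.1
    refine lintegral_congr_ae ?_
    filter_upwards [hae] with x hx
    rw [inv_rpow (le_of_lt hx), rpow_neg (le_of_lt hx)]

end

/-- `X_{a,b,c,d}` exists iff `E^{a+b}_{d,c+bd}(−t) ≥ 0` for all `t > 0`; moreover any law of
`X_{a,b,c,d}` has reciprocal whose law has density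
`(Γ(c)Γ(a+b)/(Γ(a)Γ(b))) · t^{b−1} · E^{a+b}_{d,c+bd}(−t)` on `(0,∞)`. -/
theorem XExists_iff_mittagLeffler3_nonneg (a b c d : ℝ)
    (ha : 0 < a) (hb : 0 < b) (hc : 0 < c) (hd : 0 < d) :
    (XExists a b c d ↔ ∀ t : ℝ, 0 < t → 0 ≤ mittagLeffler3 d (c + b * d) (a + b) (-t)) ∧
    (∀ μ : Measure ℝ, IsXLaw a b c d μ →
      Measure.map (fun x : ℝ => x⁻¹) μ =
        (volume.restrict (Set.Ioi (0 : ℝ))).withDensity fun t =>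
          ENNReal.ofReal (Real.Gamma c * Real.Gamma (a + b) / (Real.Gamma a * Real.Gamma b) *
            t ^ (b - 1) * mittagLeffler3 d (c + b * d) (a + b) (-t))) := by
  have hnonneg : ∀ μ, IsXLaw a b c d μ →
      ∀ t : ℝ, 0 < t → 0 ≤ mittagLeffler3 d (c + b * d) (a + b) (-t) := fun μ hμ t ht =>
    hμ.isReciprocalXLaw.mittagLeffler3_nonneg ha hb hc hd ht
  refine ⟨⟨fun ⟨μ, hμ⟩ => hnonneg μ hμ, fun hE =>
    ⟨_, (isReciprocalXLaw_withDensity ha hb hc hd hE).isXLaw ha hb hc⟩⟩, fun μ hμ => ?_⟩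
  exact ext_of_isReciprocalXLaw ha hb hμ.isReciprocalXLaw
    (isReciprocalXLaw_withDensity ha hb hc hd (hnonneg μ hμ))
end

section
/- For all a, b, c, d > 0 with d > 2, the random variable X_{a,b,c,d} does not exist; that is, there is no probability measure μ on (0,∞) with ∫ x^s dμ(x) = (Γ(c)/(Γ(a)·Γ(b)))·Γ(a+s)·Γ(b−s)/Γ(c+d·s) for every s ∈ (−a, b). -/
open MeasureTheory Real

open Complex in
/-- The modulus of the beta integral is bounded in terms of the real parts of its parameters. -/
theorem norm_betaIntegral_le (u v : ℂ) :
    ‖betaIntegral u v‖ ≤ ∫ x : ℝ in 0..1, x ^ (u.re - 1) * (1 - x) ^ (v.re - 1) := by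
  unfold betaIntegral
  refine (intervalIntegral.norm_integral_le_integral_norm zero_le_one).trans_eq ?_
  rw [intervalIntegral.integral_of_le zero_le_one, intervalIntegral.integral_of_le zero_le_one,
    integral_Ioc_eq_integral_Ioo, integral_Ioc_eq_integral_Ioo]
  refine setIntegral_congr_fun measurableSet_Ioo fun x hx => ?_
  have h : (1 : ℂ) - x = ((1 - x : ℝ) : ℂ) := by push_cast; rfl
  simp only [norm_mul, h]
  rw [norm_cpow_eq_rpow_re_of_pos hx.1, norm_cpow_eq_rpow_re_of_pos (by linarith [hx.2])]
  simp

open Complex in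
/-- On vertical lines in the right half-plane, `|Γ|` is up to constants monotone in the real
part. -/
theorem exists_norm_Gamma_le_of_le {x x' : ℝ} (hx : 0 < x) (hxx' : x ≤ x') :
    ∃ C : ℝ, 0 < C ∧ ∀ y : ℝ, ‖Gamma (x + y * I)‖ ≤ C * ‖Gamma (x' + y * I)‖ := by
  rcases hxx'.eq_or_lt with rfl | hlt
  · exact ⟨1, one_pos, fun y => by simp⟩
  have hh : 0 < x' - x := sub_pos.2 hlt
  set B : ℝ := ∫ t : ℝ in 0..1, t ^ (x - 1) * (1 - t) ^ (x' - x - 1) with hB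
  have hG : 0 < Real.Gamma (x' - x) := Real.Gamma_pos_of_pos hh
  have key : ∀ y : ℝ, ‖Gamma (x + y * I)‖ ≤ (B / Real.Gamma (x' - x)) * ‖Gamma (x' + y * I)‖ := by
    intro y
    have h := Gamma_mul_Gamma_eq_betaIntegral (s := x + y * I) (t := ((x' - x : ℝ) : ℂ))
      (by simpa using hx) (by simpa using hh)
    have e : (x + y * I : ℂ) + ((x' - x : ℝ) : ℂ) = x' + y * I := by push_cast; ring
    have hb := norm_betaIntegral_le (x + y * I) ((x' - x : ℝ) : ℂ)
    have e1 : (x + y * I : ℂ).re = x := by simp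
    rw [e1, ofReal_re, ← hB] at hb
    rw [e, Gamma_ofReal] at h
    have h2 := congrArg norm h
    rw [norm_mul, norm_mul, norm_real, Real.norm_of_nonneg hG.le] at h2
    rw [div_mul_eq_mul_div, le_div_iff₀ hG, h2, mul_comm B]
    gcongr
  refine ⟨|B / Real.Gamma (x' - x)| + 1, by positivity, fun y => (key y).trans ?_⟩
  gcongr
  exact (le_abs_self _).trans (by linarith)

open Complex in
theorem norm_Gamma_sub_mul_I (x y : ℝ) : ‖Gamma (x - y * I)‖ = ‖Gamma (x + y * I)‖ := by
  have h : (x - y * I : ℂ) = (starRingEnd ℂ) (x + y * I) := by simp [sub_eq_add_neg]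
  rw [h, Gamma_conj, RCLike.norm_conj]

open Complex in
/-- The modulus of `Γ` on the line of real part `1`. -/
theorem sq_norm_Gamma_one_add_mul_I {y : ℝ} (hy : 0 < y) :
    ‖Gamma ((1 : ℝ) + y * I)‖ ^ 2 = π * y / Real.sinh (π * y) := by
  have hne : (y * I : ℂ) ≠ 0 := by simp [hy.ne']
  have h1 := Gamma_add_one (y * I) hne
  have h2 := Gamma_mul_Gamma_one_sub (y * I)
  have h3 : sin (π * (y * I)) = ((Real.sinh (π * y) : ℝ) : ℂ) * I := by
    rw [← mul_assoc, sin_mul_I]; push_cast; rfl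
  have hs : 0 < Real.sinh (π * y) := Real.sinh_pos_iff.2 (by positivity)
  have h4 : Gamma ((1 : ℝ) + y * I) * Gamma ((1 : ℝ) - y * I)
      = ((π * y / Real.sinh (π * y) : ℝ) : ℂ) := by
    have e : ((1 : ℝ) + y * I : ℂ) = y * I + 1 := by push_cast; ring
    rw [e, h1, mul_assoc, ofReal_one, h2, h3]
    have : ((Real.sinh (π * y) : ℝ) : ℂ) ≠ 0 := ofReal_ne_zero.2 hs.ne'
    rw [ofReal_div, ofReal_mul]
    field_simp
  have h5 := congrArg norm h4
  rw [norm_mul, norm_Gamma_sub_mul_I, norm_real, Real.norm_of_nonneg (by positivity)] at h5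
  rw [sq, h5]

open Complex in
theorem norm_add_mul_I_le {x y : ℝ} (hx : 0 ≤ x) (hy : 1 ≤ y) : ‖(x + y * I : ℂ)‖ ≤ (x + 1) * y := by
  refine (norm_add_le _ _).trans ?_
  simp only [norm_mul, norm_real, norm_I, mul_one, Real.norm_of_nonneg hx,
    Real.norm_of_nonneg (zero_le_one.trans hy)]
  nlinarith

open Complex in
theorem exists_norm_Gamma_le_pow {x : ℝ} (hx : 0 < x) :
    ∃ (C : ℝ) (n : ℕ), 0 < C ∧ ∀ y : ℝ, 1 ≤ y →
      ‖Gamma (x + y * I)‖ ≤ C * y ^ n * ‖Gamma ((1 : ℝ) + y * I)‖ := by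
  have hnat : ∀ n : ℕ, ∃ C : ℝ, 0 < C ∧ ∀ y : ℝ, 1 ≤ y →
      ‖Gamma (((n + 1 : ℝ) : ℂ) + y * I)‖ ≤ C * y ^ n * ‖Gamma ((1 : ℝ) + y * I)‖ := by
    intro n
    induction n with
    | zero => exact ⟨1, one_pos, fun y _ => by simp⟩
    | succ n ih =>
      obtain ⟨C, hC, h⟩ := ih
      refine ⟨(n + 1 + 1) * C, by positivity, fun y hy => ?_⟩
      have hne : (((n + 1 : ℝ) : ℂ) + y * I) ≠ 0 := by
        intro h0
        have := congrArg re h0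
        simp at this
        linarith [n.cast_nonneg (α := ℝ)]
      have e : (((n + 1 : ℕ) + 1 : ℝ) : ℂ) + y * I = (((n + 1 : ℝ) : ℂ) + y * I) + 1 := by
        push_cast; ring
      rw [e, Gamma_add_one _ hne, norm_mul]
      calc _ ≤ ((n + 1 + 1) * y) * (C * y ^ n * ‖Gamma ((1 : ℝ) + y * I)‖) := by
            gcongr
            · exact norm_add_mul_I_le (by positivity) hy
            · exact h y hy
        _ = _ := by ring
  obtain ⟨n, hn⟩ := exists_nat_ge x
  obtain ⟨C, hC, h⟩ := hnat n
  obtain ⟨D, hD, h'⟩ := exists_norm_Gamma_le_of_le hx (hn.trans (le_add_of_nonneg_right zero_le_one))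
  refine ⟨D * C, n, by positivity, fun y hy => (h' y).trans ?_⟩
  rw [mul_assoc, mul_assoc, ← mul_assoc C]
  exact mul_le_mul_of_nonneg_left (h y hy) hD.le

open Complex in
theorem exists_norm_Gamma_one_add_le {x : ℝ} (hx : 0 < x) :
    ∃ C : ℝ, 0 < C ∧ ∀ y : ℝ, 1 ≤ y →
      ‖Gamma ((1 : ℝ) + y * I)‖ ≤ C * y * ‖Gamma (x + y * I)‖ := by
  obtain ⟨C, hC, h⟩ := exists_norm_Gamma_le_of_le one_pos (show 1 ≤ x + 1 by linarith)
  refine ⟨C * (x + 1), by positivity, fun y hy => (h y).trans ?_⟩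
  have hne : (x + y * I : ℂ) ≠ 0 := by
    intro h0
    have := congrArg re h0
    simp at this
    linarith
  have e : ((x + 1 : ℝ) : ℂ) + y * I = (x + y * I) + 1 := by push_cast; ring
  rw [e, Gamma_add_one _ hne, norm_mul]
  calc _ ≤ C * (((x + 1) * y) * ‖Gamma (x + y * I)‖) := by
        gcongr
        exact norm_add_mul_I_le hx.le hy
    _ = _ := by ring

open Complex in
/-- If `d > 2`, no bound `|Γ(a+it) Γ(b-it)| ≲ |Γ(c+idt)|` holds for all large `t`. -/
theorem not_forall_norm_Gamma_mul_Gamma_le {a b c d K : ℝ} (ha : 0 < a) (hb : 0 < b) (hc : 0 < c)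
    (hd : 2 < d) (hK : 0 < K) :
    ¬ ∀ t : ℝ, 1 ≤ t → K * (‖Gamma (a + t * I)‖ * ‖Gamma (b - t * I)‖) ≤
      ‖Gamma (c + (d * t : ℝ) * I)‖ := by
  intro H
  obtain ⟨A, hA, hAle⟩ := exists_norm_Gamma_one_add_le ha
  obtain ⟨B, hB, hBle⟩ := exists_norm_Gamma_one_add_le hb
  obtain ⟨C, n, hC, hCle⟩ := exists_norm_Gamma_le_pow hc
  set M : ℝ := (A * B * C * d ^ n) ^ 2 * (4 * (π * d)) with hM
  have hMpos : 0 < M := by positivity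
  have key : ∀ t : ℝ, 1 ≤ t →
      K ^ 2 / M ≤ t ^ ((2 * (n + 2) + 1 : ℕ) : ℝ) * Real.exp (-(π * (d - 2)) * t) := by
    intro t ht
    have ht0 : 0 < t := by linarith
    have hdt : 1 ≤ d * t := by nlinarith
    have hlow : Real.exp (-(π * t)) ≤ ‖Gamma ((1 : ℝ) + t * I)‖ ^ 2 := by
      rw [sq_norm_Gamma_one_add_mul_I ht0, Real.exp_neg, inv_eq_one_div]
      have hs : 0 < Real.sinh (π * t) := Real.sinh_pos_iff.2 (by positivity)
      rw [div_le_div_iff₀ (Real.exp_pos _) hs, Real.sinh_eq]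
      have : 1 ≤ π * t := by nlinarith [Real.pi_gt_three]
      nlinarith [Real.exp_pos (π * t), Real.exp_pos (-(π * t))]
    have hup : ‖Gamma ((1 : ℝ) + (d * t : ℝ) * I)‖ ^ 2 ≤
        4 * (π * d) * t * Real.exp (-(π * (d * t))) := by
      rw [sq_norm_Gamma_one_add_mul_I (by positivity), Real.exp_neg]
      have h1 : 1 ≤ π * (d * t) := by nlinarith [Real.pi_gt_three]
      have h2 : Real.exp (π * (d * t)) / 4 ≤ Real.sinh (π * (d * t)) := by
        rw [Real.sinh_eq]
        have := Real.add_one_le_exp (π * (d * t))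
        have : Real.exp (-(π * (d * t))) ≤ 1 := Real.exp_le_one_iff.2 (by linarith)
        linarith
      calc _ ≤ π * (d * t) / (Real.exp (π * (d * t)) / 4) := by gcongr
        _ = _ := by field_simp
    have h1 : K * ‖Gamma ((1 : ℝ) + t * I)‖ ^ 2 ≤
        A * B * C * d ^ n * t ^ (n + 2) * ‖Gamma ((1 : ℝ) + (d * t : ℝ) * I)‖ := by
      have hba := hBle t ht
      rw [← norm_Gamma_sub_mul_I b] at hba
      calc K * ‖Gamma ((1 : ℝ) + t * I)‖ ^ 2
          = K * (‖Gamma ((1 : ℝ) + t * I)‖ * ‖Gamma ((1 : ℝ) + t * I)‖) := by rw [sq]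
        _ ≤ K * ((A * t * ‖Gamma (a + t * I)‖) * (B * t * ‖Gamma (b - t * I)‖)) := by
            gcongr
            exact hAle t ht
        _ = A * B * t ^ 2 * (K * (‖Gamma (a + t * I)‖ * ‖Gamma (b - t * I)‖)) := by ring
        _ ≤ A * B * t ^ 2 * (C * (d * t) ^ n * ‖Gamma ((1 : ℝ) + (d * t : ℝ) * I)‖) := by
            exact mul_le_mul_of_nonneg_left ((H t ht).trans (hCle _ hdt)) (by positivity)
        _ = _ := by rw [mul_pow]; ring
    have h2 : K ^ 2 * Real.exp (-(π * t)) ^ 2 ≤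
        M * t ^ (2 * (n + 2) + 1) * Real.exp (-(π * (d * t))) := by
      calc K ^ 2 * Real.exp (-(π * t)) ^ 2 ≤ K ^ 2 * (‖Gamma ((1 : ℝ) + t * I)‖ ^ 2) ^ 2 := by
            gcongr
        _ = (K * ‖Gamma ((1 : ℝ) + t * I)‖ ^ 2) ^ 2 := by ring
        _ ≤ (A * B * C * d ^ n * t ^ (n + 2) * ‖Gamma ((1 : ℝ) + (d * t : ℝ) * I)‖) ^ 2 := by
            gcongr
        _ = (A * B * C * d ^ n * t ^ (n + 2)) ^ 2 *
              ‖Gamma ((1 : ℝ) + (d * t : ℝ) * I)‖ ^ 2 := by ring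
        _ ≤ (A * B * C * d ^ n * t ^ (n + 2)) ^ 2 *
              (4 * (π * d) * t * Real.exp (-(π * (d * t)))) := by gcongr
        _ = _ := by rw [hM]; ring
    have e : Real.exp (-(π * (d * t))) =
        Real.exp (-(π * (d - 2)) * t) * Real.exp (-(π * t)) ^ 2 := by
      rw [← Real.exp_nat_mul, ← Real.exp_add]; congr 1; push_cast; ring
    rw [e, ← mul_assoc] at h2
    have h3 := le_of_mul_le_mul_right h2 (by positivity)
    rw [Real.rpow_natCast, div_le_iff₀ hMpos]
    linarith
  have hlim := tendsto_rpow_mul_exp_neg_mul_atTop_nhds_zero ((2 * (n + 2) + 1 : ℕ) : ℝ)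
    (π * (d - 2)) (mul_pos Real.pi_pos (by linarith))
  have := ge_of_tendsto hlim ((Filter.eventually_ge_atTop 1).mono key)
  have : 0 < K ^ 2 / M := by positivity
  linarith

/-- Near the imaginary axis, the real moment formula extends to the complex moments. -/
theorem IsXLaw.complexMGF_log_mul_Gamma {a b c d : ℝ} {μ : Measure ℝ} (h : IsXLaw a b c d μ)
    (ha : 0 < a) (hb : 0 < b) (hc : 0 < c) (hd : 0 < d) (t : ℝ) :
    ProbabilityTheory.complexMGF Real.log μ (t * Complex.I) *
        Complex.Gamma (c + (d * t : ℝ) * Complex.I) =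
      ((Real.Gamma c / (Real.Gamma a * Real.Gamma b) : ℝ) : ℂ) *
        (Complex.Gamma (a + t * Complex.I) * Complex.Gamma (b - t * Complex.I)) := by
  obtain ⟨hprob, hpos, hmom⟩ := h
  have hae : ∀ᵐ x ∂μ, 0 < x := by
    rw [ae_iff]; exact hpos
  set K := Real.Gamma c / (Real.Gamma a * Real.Gamma b) with hK
  have hK0 : 0 < K := div_pos (Real.Gamma_pos_of_pos hc)
    (mul_pos (Real.Gamma_pos_of_pos ha) (Real.Gamma_pos_of_pos hb))
  obtain ⟨ε, hε, hεa, hεb, hεc⟩ : ∃ ε : ℝ, 0 < ε ∧ ε ≤ a ∧ ε ≤ b ∧ d * ε ≤ c := by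
    refine ⟨min a (min b (c / d)), by positivity, by simp, by simp, ?_⟩
    rw [mul_comm, ← le_div_iff₀ hd]; simp
  have hGpos : ∀ s ∈ Set.Ioo (-ε) ε, 0 < a + s ∧ 0 < b - s ∧ 0 < c + d * s := by
    rintro s ⟨h1, h2⟩
    exact ⟨by linarith, by linarith, by nlinarith⟩
  have hreal : ∀ s ∈ Set.Ioo (-ε) ε, Integrable (fun x => Real.exp (s * Real.log x)) μ ∧
      ProbabilityTheory.mgf Real.log μ s =
        K * (Real.Gamma (a + s) * Real.Gamma (b - s) / Real.Gamma (c + d * s)) := by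
    intro s hs
    obtain ⟨h1, h2, h3⟩ := hGpos s hs
    have hl : ∫⁻ x, ENNReal.ofReal (Real.exp (s * Real.log x)) ∂μ = ENNReal.ofReal
        (K * (Real.Gamma (a + s) * Real.Gamma (b - s) / Real.Gamma (c + d * s))) := by
      rw [← hmom s ⟨by linarith [hs.1], by linarith [hs.2]⟩]
      refine lintegral_congr_ae (hae.mono fun x hx => ?_)
      simp only [Real.rpow_def_of_pos hx, mul_comm]
    have hm : AEStronglyMeasurable (fun x => Real.exp (s * Real.log x)) μ := by fun_prop
    have hnn : 0 ≤ᵐ[μ] fun x => Real.exp (s * Real.log x) :=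
      Filter.Eventually.of_forall fun x => (Real.exp_pos _).le
    refine ⟨(lintegral_ofReal_ne_top_iff_integrable hm hnn).1 (by rw [hl]; simp), ?_⟩
    have := Real.Gamma_pos_of_pos h1
    have := Real.Gamma_pos_of_pos h2
    have := Real.Gamma_pos_of_pos h3
    rw [ProbabilityTheory.mgf, integral_eq_lintegral_of_nonneg_ae hnn hm, hl,
      ENNReal.toReal_ofReal (by positivity)]
  have hsub : Set.Ioo (-ε) ε ⊆
      interior (ProbabilityTheory.integrableExpSet Real.log μ) :=
    interior_maximal (fun s hs => (hreal s hs).1) isOpen_Ioo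
  set U : Set ℂ := Complex.re ⁻¹' Set.Ioo (-ε) ε with hU
  have hUo : IsOpen U := isOpen_Ioo.preimage Complex.continuous_re
  have hUc : IsPreconnected U :=
    ((convex_Ioo (-ε) ε).linear_preimage Complex.reLm).isPreconnected
  have hGd : ∀ z : ℂ, 0 < z.re → DifferentiableAt ℂ Complex.Gamma z := by
    intro z hz
    refine Complex.differentiableAt_Gamma z fun m hm => ?_
    rw [hm] at hz
    simp at hz
    linarith [m.cast_nonneg (α := ℝ)]
  have hF : AnalyticOnNhd ℂ (fun z : ℂ => ProbabilityTheory.complexMGF Real.log μ z *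
      Complex.Gamma (c + d * z)) U := by
    refine DifferentiableOn.analyticOnNhd (fun z hz => ?_) hUo
    have h1 := (ProbabilityTheory.hasDerivAt_complexMGF (hsub hz)).differentiableAt
    have h2 : DifferentiableAt ℂ (fun z : ℂ => Complex.Gamma (c + d * z)) z :=
      (hGd (c + d * z) (by simpa using (hGpos _ hz).2.2)).comp z (by fun_prop)
    exact (h1.mul h2).differentiableWithinAt
  have hG : AnalyticOnNhd ℂ (fun z : ℂ => (K : ℂ) *
      (Complex.Gamma (a + z) * Complex.Gamma (b - z))) U := by
    refine DifferentiableOn.analyticOnNhd (fun z hz => ?_) hUo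
    have h1 : DifferentiableAt ℂ (fun z : ℂ => Complex.Gamma (a + z)) z :=
      (hGd (a + z) (by simpa using (hGpos _ hz).1)).comp z (by fun_prop)
    have h2 : DifferentiableAt ℂ (fun z : ℂ => Complex.Gamma (b - z)) z :=
      (hGd (b - z) (by simpa using (hGpos _ hz).2.1)).comp z (by fun_prop)
    exact ((h1.mul h2).const_mul _).differentiableWithinAt
  have hfreq : ∃ᶠ z in nhdsWithin (0 : ℂ) {0}ᶜ, ProbabilityTheory.complexMGF Real.log μ z *
      Complex.Gamma (c + d * z) =
        (K : ℂ) * (Complex.Gamma (a + z) * Complex.Gamma (b - z)) := by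
    have htend : Filter.Tendsto ((↑) : ℝ → ℂ) (nhdsWithin (0 : ℝ) {0}ᶜ)
        (nhdsWithin (0 : ℂ) {0}ᶜ) := by
      refine Filter.Tendsto.inf ?_ ?_
      · exact Complex.continuous_ofReal.tendsto' 0 0 rfl
      · exact Filter.tendsto_principal_principal.2 fun x hx => by simpa using hx
    refine htend.frequently (Filter.Eventually.frequently ?_)
    filter_upwards [mem_nhdsWithin_of_mem_nhds (Ioo_mem_nhds (neg_lt_zero.2 hε) hε)] with s hs
    have h3 := (Real.Gamma_pos_of_pos (hGpos s hs).2.2).ne'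
    rw [ProbabilityTheory.complexMGF_ofReal, (hreal s hs).2]
    have e1 : (c + d * s : ℂ) = ((c + d * s : ℝ) : ℂ) := by push_cast; rfl
    have e2 : (a + s : ℂ) = ((a + s : ℝ) : ℂ) := by push_cast; rfl
    have e3 : (b - s : ℂ) = ((b - s : ℝ) : ℂ) := by push_cast; rfl
    rw [e1, e2, e3, Complex.Gamma_ofReal, Complex.Gamma_ofReal, Complex.Gamma_ofReal,
      ← Complex.ofReal_mul, ← Complex.ofReal_mul, ← Complex.ofReal_mul, mul_assoc,
      div_mul_cancel₀ _ h3]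
  have hfin := hF.eqOn_of_preconnected_of_frequently_eq hG hUc (z₀ := 0) (by simp [hU, hε]) hfreq
    (show (t * Complex.I : ℂ) ∈ U by simp [hU, hε])
  have e : (c + (d * t : ℝ) * Complex.I : ℂ) = c + d * (t * Complex.I) := by push_cast; ring
  rw [e]
  exact hfin

theorem XExists_not_of_two_lt (a b c d : ℝ) (ha : 0 < a) (hb : 0 < b) (hc : 0 < c)
    (hd : 2 < d) : ¬ XExists a b c d := by
  rintro ⟨μ, h⟩
  have hK0 : 0 < Real.Gamma c / (Real.Gamma a * Real.Gamma b) :=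
    div_pos (Real.Gamma_pos_of_pos hc)
      (mul_pos (Real.Gamma_pos_of_pos ha) (Real.Gamma_pos_of_pos hb))
  have := h.1
  refine not_forall_norm_Gamma_mul_Gamma_le ha hb hc hd hK0 fun t _ => ?_
  have h1 := congrArg norm (h.complexMGF_log_mul_Gamma ha hb hc (by linarith) t)
  rw [norm_mul, norm_mul, norm_mul, Complex.norm_real, Real.norm_of_nonneg hK0.le] at h1
  rw [← h1]
  refine mul_le_of_le_one_left (norm_nonneg _) ?_
  refine ProbabilityTheory.norm_complexMGF_le_mgf.trans_eq ?_
  simp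
end

section
/- For all a, b, c, d > 0 with d ≤ 1 and c ≥ a·d, the random variable X_{a,b,c,d} exists; that is, there is a probability measure μ on (0,∞) with ∫ x^s dμ(x) = (Γ(c)/(Γ(a)·Γ(b)))·Γ(a+s)·Γ(b−s)/Γ(c+d·s) for every s ∈ (−a, b). -/
open MeasureTheory Real

open Filter Topology ProbabilityTheory

/-- The bilateral Laplace transform of a measure on the real line, with values in `[0, ∞]`. -/
noncomputable def bilateralLaplace (μ : Measure ℝ) (s : ℝ) : ENNReal :=
  ∫⁻ x, ENNReal.ofReal (exp (s * x)) ∂μ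

lemma bilateralLaplace_conv (μ ν : Measure ℝ) [SFinite ν] (s : ℝ) :
    bilateralLaplace (μ.conv ν) s = bilateralLaplace μ s * bilateralLaplace ν s := by
  unfold bilateralLaplace
  rw [Measure.lintegral_conv (by fun_prop), ← lintegral_mul_const _ (by fun_prop)]
  refine lintegral_congr fun x ↦ ?_
  rw [← lintegral_const_mul _ (by fun_prop)]
  refine lintegral_congr fun y ↦ ?_
  rw [mul_add, exp_add, ENNReal.ofReal_mul (exp_pos _).le]

lemma bilateralLaplace_dirac (t s : ℝ) :
    bilateralLaplace (Measure.dirac t) s = ENNReal.ofReal (exp (s * t)) := by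
  unfold bilateralLaplace
  rw [lintegral_dirac' _ (by fun_prop)]

lemma measurable_gammaPDF (a r : ℝ) : Measurable (gammaPDF a r) :=
  (measurable_gammaPDFReal a r).ennreal_ofReal

lemma bilateralLaplace_map_neg_expMeasure {α s : ℝ} (hα : 0 < α) (hs : 0 < α + s) :
    bilateralLaplace ((expMeasure α).map Neg.neg) s = ENNReal.ofReal (α / (α + s)) := by
  unfold bilateralLaplace
  rw [lintegral_map (by fun_prop) measurable_neg]
  change ∫⁻ x, _ ∂(volume.withDensity (gammaPDF 1 α)) = _
  rw [lintegral_withDensity_eq_lintegral_mul _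
    (measurable_gammaPDF 1 α) (by fun_prop)]
  have key : ∀ x, (gammaPDF 1 α * fun x ↦ ENNReal.ofReal (exp (s * -x))) x =
      ENNReal.ofReal (α / (α + s)) * exponentialPDF (α + s) x := by
    intro x
    change exponentialPDF α x * _ = _
    rcases lt_or_ge x 0 with hx | hx
    · simp [exponentialPDF_of_neg hx]
    · rw [exponentialPDF_of_nonneg hx, exponentialPDF_of_nonneg hx,
        ← ENNReal.ofReal_mul (by positivity), ← ENNReal.ofReal_mul (by positivity), mul_assoc,
        ← exp_add]
      congr 1
      field_simp
      ring_nf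
  rw [lintegral_congr key, lintegral_const_mul' _ _ ENNReal.ofReal_ne_top,
    lintegral_exponentialPDF_eq_one hs, mul_one]

lemma exists_isProbabilityMeasure_bilateralLaplace_div {α β : ℝ} (hα : 0 < α) (hαβ : α ≤ β) :
    ∃ μ : Measure ℝ, IsProbabilityMeasure μ ∧ ∀ s, -α < s →
      bilateralLaplace μ s = ENNReal.ofReal (α / β * ((s + β) / (s + α))) := by
  have hβ : 0 < β := hα.trans_le hαβ
  have hle : α / β ≤ 1 := (div_le_one hβ).2 hαβ
  have := isProbabilityMeasure_expMeasure hα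
  have : IsProbabilityMeasure ((expMeasure α).map Neg.neg) :=
    Measure.isProbabilityMeasure_map measurable_neg.aemeasurable
  refine ⟨ENNReal.ofReal (α / β) • Measure.dirac 0 +
    ENNReal.ofReal (1 - α / β) • (expMeasure α).map Neg.neg, ⟨?_⟩, fun s hs ↦ ?_⟩
  · simp only [Measure.coe_add, Measure.coe_smul, Pi.add_apply, Pi.smul_apply, measure_univ,
      smul_eq_mul, mul_one]
    rw [← ENNReal.ofReal_add (by positivity) (by linarith)]
    simp
  · have hs' : 0 < α + s := by linarith
    have h0 := bilateralLaplace_dirac 0 s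
    have h1 := bilateralLaplace_map_neg_expMeasure hα hs'
    unfold bilateralLaplace at h0 h1 ⊢
    rw [lintegral_add_measure, lintegral_smul_measure, lintegral_smul_measure, h0, h1,
      smul_eq_mul, smul_eq_mul, ← ENNReal.ofReal_mul (by positivity),
      ← ENNReal.ofReal_mul (by linarith), ← ENNReal.ofReal_add (by positivity)
        (mul_nonneg (by linarith) (by positivity))]
    congr 1
    have : s + α ≠ 0 := by linarith
    have : α + s ≠ 0 := by linarith
    simp only [mul_zero, exp_zero]
    field_simp
    ring

lemma exists_isProbabilityMeasure_bilateralLaplace_Gamma {b : ℝ} (hb : 0 < b) :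
    ∃ μ : Measure ℝ, IsProbabilityMeasure μ ∧ ∀ s, s < b →
      bilateralLaplace μ s = ENNReal.ofReal (Gamma (b - s) / Gamma b) := by
  have := isProbabilityMeasure_gammaMeasure hb one_pos
  have hm : Measurable fun x ↦ -log x := by fun_prop
  refine ⟨(gammaMeasure b 1).map fun x ↦ -log x,
    Measure.isProbabilityMeasure_map hm.aemeasurable, fun s hs ↦ ?_⟩
  unfold bilateralLaplace
  rw [lintegral_map (by fun_prop) hm, gammaMeasure,
    lintegral_withDensity_eq_lintegral_mul _
      (measurable_gammaPDF b 1) (by fun_prop)]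
  have hs' : 0 < b - s := by linarith
  have hG := Gamma_pos_of_pos hb
  have hG' := Gamma_pos_of_pos hs'
  have key : (gammaPDF b 1 * fun x ↦ ENNReal.ofReal (exp (s * -log x))) =ᵐ[volume]
      fun x ↦ ENNReal.ofReal (Gamma (b - s) / Gamma b) * gammaPDF (b - s) 1 x := by
    filter_upwards [(measure_eq_zero_iff_ae_notMem.1 (measure_singleton (0 : ℝ)))] with x hx0
    rcases lt_or_ge x 0 with hx | hx
    · simp [gammaPDF_of_neg hx]
    · have hx' : 0 < x := lt_of_le_of_ne hx (Ne.symm hx0)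
      rw [Pi.mul_apply, gammaPDF_of_nonneg hx, gammaPDF_of_nonneg hx,
        ← ENNReal.ofReal_mul (by positivity), ← ENNReal.ofReal_mul (by positivity)]
      congr 1
      have : exp (s * -log x) = x ^ (-s) := by
        rw [rpow_def_of_pos hx']
        ring_nf
      rw [this, show b - s - 1 = (b - 1) + -s by ring, rpow_add hx']
      simp only [one_rpow]
      field_simp
  rw [lintegral_congr_ae key, lintegral_const_mul' _ _ ENNReal.ofReal_ne_top,
    lintegral_gammaPDF_eq_one hs' one_pos, mul_one]

lemma exists_isProbabilityMeasure_bilateralLaplace_prod {a c d : ℝ} (ha : 0 < a)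
    (hd : 0 < d) (hd1 : d ≤ 1) (h : a * d ≤ c) (n : ℕ) :
    ∃ μ : Measure ℝ, IsProbabilityMeasure μ ∧ ∀ s, -a < s → bilateralLaplace μ s =
      ENNReal.ofReal (∏ j ∈ Finset.range n, (a + j) / (a + s + j) * ((c + d * s + j) / (c + j))) := by
  induction n with
  | zero => exact ⟨Measure.dirac 0, inferInstance, fun s _ ↦ by simp [bilateralLaplace_dirac]⟩
  | succ n ih =>
    obtain ⟨μ, hμ, hL⟩ := ih
    have hn : (0 : ℝ) ≤ n := n.cast_nonneg
    have hc : 0 < c := lt_of_lt_of_le (by positivity) h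
    obtain ⟨ν, hν, hL'⟩ := exists_isProbabilityMeasure_bilateralLaplace_div
      (α := a + n) (β := (c + n) / d) (by positivity) (by
        rw [le_div_iff₀ hd]
        nlinarith)
    refine ⟨μ.conv ν, inferInstance, fun s hs ↦ ?_⟩
    have hcs : 0 < c + d * s := by nlinarith
    rw [bilateralLaplace_conv, hL s hs, hL' s (by linarith), ← ENNReal.ofReal_mul
      (Finset.prod_nonneg fun j _ ↦ ?_), Finset.prod_range_succ]
    · congr 2
      have : s + (a + n) ≠ 0 := by linarith
      have : a + s + n ≠ 0 := by linarith
      field_simp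
      ring
    · have : 0 < a + s := by linarith
      positivity

lemma exists_isProbabilityMeasure_bilateralLaplace_GammaSeq {a b c d : ℝ} (ha : 0 < a)
    (hb : 0 < b) (hd : 0 < d) (hd1 : d ≤ 1) (h : a * d ≤ c) {n : ℕ} (hn : 0 < n) :
    ∃ μ : Measure ℝ, IsProbabilityMeasure μ ∧ ∀ s ∈ Set.Ioo (-a) b, bilateralLaplace μ s =
      ENNReal.ofReal (GammaSeq c n / (GammaSeq a n * Gamma b) *
        (GammaSeq (a + s) n * Gamma (b - s) / GammaSeq (c + d * s) n)) := by
  obtain ⟨μ, hμ, hL⟩ := exists_isProbabilityMeasure_bilateralLaplace_prod ha hd hd1 h (n + 1)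
  obtain ⟨ν, hν, hL'⟩ := exists_isProbabilityMeasure_bilateralLaplace_Gamma hb
  have hc : 0 < c := lt_of_lt_of_le (by positivity) h
  refine ⟨(μ.conv ν).conv (Measure.dirac ((1 - d) * log n)), inferInstance, fun s hs ↦ ?_⟩
  have has : 0 < a + s := by linarith [hs.1]
  have hcs : 0 < c + d * s := by nlinarith [hs.1]
  have hn' : (0 : ℝ) < n := by exact_mod_cast hn
  have hbs := Gamma_pos_of_pos (sub_pos.2 hs.2)
  have hb' := Gamma_pos_of_pos hb
  rw [bilateralLaplace_conv, bilateralLaplace_conv, bilateralLaplace_dirac, hL s hs.1, hL' s hs.2,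
    ← ENNReal.ofReal_mul (by positivity), ← ENNReal.ofReal_mul (by positivity)]
  congr 1
  have hpow : exp (s * ((1 - d) * log n)) =
      (n : ℝ) ^ c / (n : ℝ) ^ a * ((n : ℝ) ^ (a + s) / (n : ℝ) ^ (c + d * s)) := by
    rw [← rpow_sub hn', ← rpow_sub hn', ← rpow_add hn', rpow_def_of_pos hn']
    ring_nf
  have hP : ∀ t : ℝ, 0 < t → 0 < ∏ j ∈ Finset.range (n + 1), (t + j) :=
    fun t ht ↦ Finset.prod_pos fun j _ ↦ by positivity
  have h1 := hP a ha
  have h2 := hP c hc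
  have h3 := hP _ has
  have h4 := hP _ hcs
  rw [hpow, Finset.prod_mul_distrib, Finset.prod_div_distrib, Finset.prod_div_distrib]
  unfold GammaSeq
  have h5 : (0 : ℝ) < n.factorial := by exact_mod_cast n.factorial_pos
  have h6 := rpow_pos_of_pos hn' a
  have h7 := rpow_pos_of_pos hn' c
  have h8 := rpow_pos_of_pos hn' (a + s)
  have h9 := rpow_pos_of_pos hn' (c + d * s)
  generalize (∏ j ∈ Finset.range (n + 1), (a + j : ℝ)) = A at *
  generalize (∏ j ∈ Finset.range (n + 1), (c + j : ℝ)) = C at *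
  generalize (∏ j ∈ Finset.range (n + 1), (a + s + j : ℝ)) = A' at *
  generalize (∏ j ∈ Finset.range (n + 1), (c + d * s + j : ℝ)) = C' at *
  generalize (n : ℝ) ^ a = x at *
  generalize (n : ℝ) ^ c = y at *
  generalize (n : ℝ) ^ (a + s) = z at *
  generalize (n : ℝ) ^ (c + d * s) = w at *
  field_simp

lemma measure_compl_closedBall_le (μ : Measure ℝ) {ε : ℝ} (hε : 0 < ε) (r : ℝ) :
    μ (Metric.closedBall 0 r)ᶜ ≤
      ENNReal.ofReal (exp (-(ε * r))) * (bilateralLaplace μ ε + bilateralLaplace μ (-ε)) := by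
  unfold bilateralLaplace
  rw [← lintegral_add_left (by fun_prop), ← lintegral_const_mul _ (by fun_prop),
    ← lintegral_indicator_one Metric.isClosed_closedBall.measurableSet.compl]
  refine lintegral_mono fun x ↦ ?_
  by_cases hx : x ∈ (Metric.closedBall (0 : ℝ) r)ᶜ
  swap
  · rw [Set.indicator_of_notMem hx]
    exact bot_le
  rw [Set.indicator_of_mem hx]
  rw [← ENNReal.ofReal_add (exp_pos _).le (exp_pos _).le, ← ENNReal.ofReal_mul (exp_pos _).le,
    Pi.one_apply, ENNReal.one_le_ofReal, mul_add, ← exp_add, ← exp_add]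
  have hx : r < |x| := by simpa using hx
  rcases lt_abs.1 hx with hx | hx
  · linarith [exp_pos (-(ε * r) + -ε * x), one_le_exp (x := -(ε * r) + ε * x) (by nlinarith)]
  · linarith [exp_pos (-(ε * r) + ε * x), one_le_exp (x := -(ε * r) + -ε * x) (by nlinarith)]

/-- The continuous bounded function `x ↦ min (exp (s * x)) N`. -/
noncomputable def truncatedExp (s : ℝ) (N : NNReal) : BoundedContinuousFunction ℝ NNReal :=
  BoundedContinuousFunction.mkOfBound ⟨fun x ↦ min (exp (s * x)).toNNReal N, by fun_prop⟩ N
    fun x y ↦ by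
      rw [NNReal.dist_eq, abs_le]
      have h1 : ((min (exp (s * x)).toNNReal N : NNReal) : ℝ) ≤ N := by
        exact_mod_cast min_le_right _ _
      have h2 : ((min (exp (s * y)).toNNReal N : NNReal) : ℝ) ≤ N := by
        exact_mod_cast min_le_right _ _
      have h3 := (min (exp (s * x)).toNNReal N).coe_nonneg
      have h4 := (min (exp (s * y)).toNNReal N).coe_nonneg
      constructor <;> simp only [ContinuousMap.coe_mk] <;> linarith

lemma truncatedExp_le (s : ℝ) (N : NNReal) (x : ℝ) :
    (truncatedExp s N x : ENNReal) ≤ ENNReal.ofReal (exp (s * x)) :=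
  ENNReal.coe_le_coe.2 (min_le_left _ _)

lemma ofReal_exp_le_truncatedExp_add (s x : ℝ) {N : NNReal} (hN : 0 < N) {δ : ℝ} (hδ : 0 < δ) :
    ENNReal.ofReal (exp (s * x)) ≤ truncatedExp s N x +
      ENNReal.ofReal ((N : ℝ) ^ (-δ)) * ENNReal.ofReal (exp (s * (1 + δ) * x)) := by
  rcases le_total (exp (s * x)).toNNReal N with h | h
  · have : truncatedExp s N x = (exp (s * x)).toNNReal := min_eq_left h
    rw [this]
    exact le_self_add
  · refine le_add_left ?_
    have hN' : (0 : ℝ) < N := hN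
    rw [← ENNReal.ofReal_mul (by positivity)]
    refine ENNReal.ofReal_le_ofReal ?_
    have hle : (N : ℝ) ≤ exp (s * x) := (Real.le_toNNReal_iff_coe_le (exp_pos _).le).1 h
    have hp : (N : ℝ) ^ δ ≤ exp (s * x * δ) := by
      rw [exp_mul]
      exact rpow_le_rpow hN'.le hle hδ.le
    have hq : 0 < (N : ℝ) ^ δ := by positivity
    rw [rpow_neg hN'.le, show s * (1 + δ) * x = s * x * δ + s * x by ring, exp_add, ← mul_assoc]
    refine le_mul_of_one_le_left (exp_pos _).le ?_
    rw [← div_eq_inv_mul]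
    exact (one_le_div hq).2 hp

/-- A continuity theorem for bilateral Laplace transforms: pointwise convergence on an open
interval around `0` implies that the limit is again a bilateral Laplace transform. -/
theorem exists_isProbabilityMeasure_bilateralLaplace_of_tendsto {a b : ℝ} (ha : 0 < a)
    (hb : 0 < b) {ν : ℕ → Measure ℝ} (hν : ∀ n, IsProbabilityMeasure (ν n)) {g : ℕ → ℝ → ℝ}
    {φ : ℝ → ℝ} (hg : ∀ n, ∀ s ∈ Set.Ioo (-a) b, bilateralLaplace (ν n) s = ENNReal.ofReal (g n s))
    (hφ : ∀ s ∈ Set.Ioo (-a) b, Tendsto (fun n ↦ g n s) atTop (𝓝 (φ s))) :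
    ∃ μ : Measure ℝ, IsProbabilityMeasure μ ∧
      ∀ s ∈ Set.Ioo (-a) b, bilateralLaplace μ s = ENNReal.ofReal (φ s) := by
  obtain ⟨ε, hε, hεa, hεb⟩ : ∃ ε, 0 < ε ∧ ε < a ∧ ε < b :=
    ⟨min a b / 2, by positivity, by linarith [min_le_left a b, lt_min ha hb],
      by linarith [min_le_right a b, lt_min ha hb]⟩
  have hε1 : ε ∈ Set.Ioo (-a) b := ⟨by linarith, hεb⟩
  have hε2 : -ε ∈ Set.Ioo (-a) b := ⟨by linarith, by linarith⟩
  obtain ⟨C₁, hC₁⟩ := (hφ ε hε1).bddAbove_range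
  obtain ⟨C₂, hC₂⟩ := (hφ (-ε) hε2).bddAbove_range
  let u : ℕ → NNReal := fun m ↦ (exp (-(ε * m))).toNNReal * (C₁.toNNReal + C₂.toNNReal)
  have hu : Tendsto u atTop (𝓝 0) := by
    have h1 : Tendsto (fun m : ℕ ↦ exp (-(ε * m))) atTop (𝓝 0) :=
      tendsto_exp_neg_atTop_nhds_zero.comp
        (tendsto_natCast_atTop_atTop.const_mul_atTop hε)
    have h2 := ((continuous_real_toNNReal.tendsto 0).comp h1).mul_const
      (C₁.toNNReal + C₂.toNNReal)
    simpa [u] using h2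
  have hcpt := isCompact_setOfPred_probabilityMeasure_mass_eq_compl_isCompact_le hu
    (fun m : ℕ ↦ isCompact_closedBall (0 : ℝ) m) (Or.inl inferInstance)
  let P : ℕ → ProbabilityMeasure ℝ := fun n ↦ ⟨ν n, hν n⟩
  have hmem : ∀ n, P n ∈ {μ : ProbabilityMeasure ℝ |
      ∀ m : ℕ, μ (Metric.closedBall 0 (m : ℝ))ᶜ ≤ u m} := by
    intro n m
    rw [← ENNReal.coe_le_coe, ProbabilityMeasure.ennreal_coeFn_eq_coeFn_toMeasure]
    refine (measure_compl_closedBall_le (ν n) hε m).trans ?_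
    rw [hg n _ hε1, hg n _ hε2, ENNReal.coe_mul, ENNReal.coe_add]
    gcongr
    · exact le_rfl
    · exact ENNReal.ofReal_le_ofReal (hC₁ (Set.mem_range_self n))
    · exact ENNReal.ofReal_le_ofReal (hC₂ (Set.mem_range_self n))
  let U : Ultrafilter ℕ := hyperfilter ℕ
  have hU : (U : Filter ℕ) ≤ atTop := Nat.hyperfilter_le_atTop
  obtain ⟨μ, -, hμ⟩ := hcpt.ultrafilter_le_nhds (U.map P)
    (le_principal_iff.2 (Filter.mem_map.2 (Filter.univ_mem' hmem)))
  have hlim : Tendsto P U (𝓝 μ) := hμ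
  rw [ProbabilityMeasure.tendsto_iff_forall_lintegral_tendsto] at hlim
  refine ⟨μ, μ.2, fun s hs ↦ le_antisymm ?_ ?_⟩
  · have hsup : bilateralLaplace μ s ≤
        ⨆ N : ℕ, ∫⁻ x, truncatedExp s N x ∂(μ : Measure ℝ) := by
      rw [← lintegral_iSup (fun N ↦ by fun_prop)]
      · refine lintegral_mono fun x ↦ ?_
        obtain ⟨N, hN⟩ := exists_nat_ge (exp (s * x)).toNNReal
        refine le_trans (le_of_eq ?_) (le_iSup _ N)
        exact congrArg _ (min_eq_left hN).symm
      · intro N M hNM x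
        exact ENNReal.coe_le_coe.2 (min_le_min_left _ (by exact_mod_cast hNM))
    refine hsup.trans (iSup_le fun N ↦ ?_)
    refine le_of_tendsto_of_tendsto (hlim (truncatedExp s N))
      ((ENNReal.continuous_ofReal.tendsto _).comp ((hφ s hs).mono_left hU))
      (Eventually.of_forall fun n ↦ ?_)
    rw [Function.comp_apply, ← hg n s hs]
    exact lintegral_mono fun x ↦ truncatedExp_le s N x
  · obtain ⟨δ, hδ, hsδ⟩ : ∃ δ, 0 < δ ∧ s * (1 + δ) ∈ Set.Ioo (-a) b := by
      have hcont : Tendsto (fun δ : ℝ ↦ s * (1 + δ)) (𝓝[>] 0) (𝓝 s) := by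
        have : Continuous fun δ : ℝ ↦ s * (1 + δ) := by fun_prop
        simpa using (this.tendsto 0).mono_left nhdsWithin_le_nhds
      have := (hcont.eventually (isOpen_Ioo.mem_nhds hs)).and self_mem_nhdsWithin
      obtain ⟨δ, h1, h2⟩ := this.exists
      exact ⟨δ, h2, h1⟩
    have hbound : ∀ N : ℕ, 0 < N → ENNReal.ofReal (φ s) ≤ bilateralLaplace μ s +
        ENNReal.ofReal ((N : ℝ) ^ (-δ)) * ENNReal.ofReal (φ (s * (1 + δ))) := by
      intro N hN
      have hN' : (0 : NNReal) < N := by exact_mod_cast hN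
      have hle : ENNReal.ofReal (φ s) ≤ ∫⁻ x, truncatedExp s N x ∂(μ : Measure ℝ) +
          ENNReal.ofReal ((N : ℝ) ^ (-δ)) * ENNReal.ofReal (φ (s * (1 + δ))) := by
        refine le_of_tendsto_of_tendsto
          ((ENNReal.continuous_ofReal.tendsto _).comp ((hφ s hs).mono_left hU))
          ((hlim (truncatedExp s N)).add (ENNReal.Tendsto.const_mul
            ((ENNReal.continuous_ofReal.tendsto _).comp ((hφ _ hsδ).mono_left hU))
            (Or.inr ENNReal.ofReal_ne_top)))
          (Eventually.of_forall fun n ↦ ?_)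
        simp only [Function.comp_apply]
        rw [← hg n s hs, ← hg n _ hsδ]
        change _ ≤ ∫⁻ x, truncatedExp s N x ∂(ν n) + _
        unfold bilateralLaplace
        rw [← lintegral_const_mul _ (by fun_prop), ← lintegral_add_left (by fun_prop)]
        exact lintegral_mono fun x ↦ ofReal_exp_le_truncatedExp_add s x hN' hδ
      refine hle.trans (add_le_add_left (lintegral_mono fun x ↦ truncatedExp_le s N x) _)
    have hpow : Tendsto (fun N : ℕ ↦ ENNReal.ofReal ((N : ℝ) ^ (-δ))) atTop (𝓝 0) := by
      simpa [Function.comp_def] using (ENNReal.continuous_ofReal.tendsto 0).comp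
        ((tendsto_rpow_neg_atTop hδ).comp tendsto_natCast_atTop_atTop)
    have hrhs := (ENNReal.Tendsto.mul_const hpow
      (Or.inr (ENNReal.ofReal_ne_top (r := φ (s * (1 + δ)))))).const_add (bilateralLaplace μ s)
    rw [zero_mul, add_zero] at hrhs
    exact ge_of_tendsto hrhs ((eventually_gt_atTop 0).mono hbound)

theorem XExists_of_d_le_one (a b c d : ℝ) (ha : 0 < a) (hb : 0 < b) (hc : 0 < c)
    (hd : 0 < d) (hd1 : d ≤ 1) (h : a * d ≤ c) : XExists a b c d := by
  choose ν hν hL using fun n : ℕ ↦ exists_isProbabilityMeasure_bilateralLaplace_GammaSeq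
    ha hb hd hd1 h n.succ_pos
  obtain ⟨μ, hμ, hLμ⟩ := exists_isProbabilityMeasure_bilateralLaplace_of_tendsto ha hb hν hL
    (φ := fun s ↦ Gamma c / (Gamma a * Gamma b) *
      (Gamma (a + s) * Gamma (b - s) / Gamma (c + d * s))) (fun s hs ↦ by
      have hcs : 0 < c + d * s := by nlinarith [hs.1]
      have hlim (t : ℝ) := (GammaSeq_tendsto_Gamma t).comp (tendsto_add_atTop_nat 1)
      have h1 := (Gamma_pos_of_pos ha).ne'
      have h2 := (Gamma_pos_of_pos hb).ne'
      exact ((hlim c).div ((hlim a).mul_const _) (mul_ne_zero h1 h2)).mul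
        (((hlim (a + s)).mul_const _).div (hlim _) (Gamma_pos_of_pos hcs).ne'))
  refine ⟨μ.map exp, Measure.isProbabilityMeasure_map measurable_exp.aemeasurable, ?_,
    fun s hs ↦ ?_⟩
  · rw [Measure.map_apply measurable_exp measurableSet_Ioi.compl]
    convert measure_empty (μ := μ)
    ext x
    simp [exp_pos]
  · rw [← hLμ s hs, lintegral_map (by fun_prop) measurable_exp]
    refine lintegral_congr fun x ↦ ?_
    rw [← exp_mul, mul_comm]
end

section
/- Let 0 < a < 1 and b > 0 with a + b < 1, and let c, d > 0. If the random variable X_{a,1−a,c,d} exists, then the random variable X_{a,b,c,d} exists. -/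
open MeasureTheory Real

namespace ProbabilityTheory

lemma measurable_betaPDF (α β : ℝ) : Measurable (betaPDF α β) :=
  (measurable_betaPDFReal α β).ennreal_ofReal

lemma betaMeasure_compl_Ioi (α β : ℝ) : betaMeasure α β (Set.Ioi (0 : ℝ))ᶜ = 0 := by
  rw [betaMeasure, withDensity_apply _ measurableSet_Ioi.compl]
  exact setLIntegral_eq_zero measurableSet_Ioi.compl
    fun x hx => betaPDF_eq_zero_of_nonpos (not_lt.mp hx)

/-- The negative moments of the beta distribution. -/
lemma lintegral_rpow_neg_betaMeasure {α β s : ℝ} (hα : 0 < α) (hβ : 0 < β) (hs : s < α) :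
    ∫⁻ x, ENNReal.ofReal (x ^ (-s)) ∂betaMeasure α β =
      ENNReal.ofReal (beta (α - s) β / beta α β) := by
  have hαs : 0 < α - s := sub_pos.mpr hs
  have h1 := beta_pos hα hβ
  have h2 := beta_pos hαs hβ
  rw [betaMeasure, lintegral_withDensity_eq_lintegral_mul _ (measurable_betaPDF α β)
    (by fun_prop)]
  have key : ∀ x : ℝ, (betaPDF α β * fun x => ENNReal.ofReal (x ^ (-s))) x =
      ENNReal.ofReal (beta (α - s) β / beta α β) * betaPDF (α - s) β x := by
    intro x
    simp only [Pi.mul_apply, betaPDF_eq]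
    split_ifs with hx
    · have hpow : x ^ (α - s - 1) = x ^ (α - 1) * x ^ (-s) := by
        rw [← Real.rpow_add hx.1]
        ring_nf
      rw [← ENNReal.ofReal_mul' (Real.rpow_nonneg hx.1.le _),
        ← ENNReal.ofReal_mul (div_nonneg h2.le h1.le), hpow]
      congr 1
      field_simp
    · simp
  rw [lintegral_congr key, lintegral_const_mul _ (measurable_betaPDF _ _),
    lintegral_betaPDF_eq_one hαs hβ, mul_one]

end ProbabilityTheory

/-- The fractional moments of the quotient of two independent positive random variables. -/
lemma lintegral_rpow_map_div_prod {μ ν : Measure ℝ} [SFinite μ] [SFinite ν]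
    (hμ : ∀ᵐ x ∂μ, 0 < x) (hν : ∀ᵐ y ∂ν, 0 < y) (s : ℝ) :
    ∫⁻ x, ENNReal.ofReal (x ^ s) ∂((μ.prod ν).map fun p => p.1 / p.2) =
      (∫⁻ x, ENNReal.ofReal (x ^ s) ∂μ) * ∫⁻ y, ENNReal.ofReal (y ^ (-s)) ∂ν := by
  rw [lintegral_map (by fun_prop) (by fun_prop),
    ← lintegral_prod_mul (by fun_prop) (by fun_prop)]
  refine lintegral_congr_ae ?_
  filter_upwards [Measure.quasiMeasurePreserving_fst.ae hμ,
    Measure.quasiMeasurePreserving_snd.ae hν] with p hp hq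
  rw [← ENNReal.ofReal_mul (rpow_nonneg hp.le _), div_rpow hp.le hq.le, rpow_neg hq.le,
    div_eq_mul_inv]

open ProbabilityTheory in
theorem XExists_of_XExists_one_sub (a b c d : ℝ) (ha : 0 < a) (ha1 : a < 1) (hb : 0 < b)
    (hab : a + b < 1) (hc : 0 < c) (hd : 0 < d) (h : XExists a (1 - a) c d) :
    XExists a b c d := by
  obtain ⟨μ, hμ, hμ0, hmom⟩ := h
  have hβ : 0 < 1 - a - b := by linarith
  have hν := isProbabilityMeasureBeta hb hβ
  have hμpos : ∀ᵐ x ∂μ, 0 < x := hμ0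
  have hνpos : ∀ᵐ y ∂betaMeasure b (1 - a - b), 0 < y := betaMeasure_compl_Ioi _ _
  have hdiv : Measurable fun p : ℝ × ℝ => p.1 / p.2 := by fun_prop
  refine ⟨(μ.prod (betaMeasure b (1 - a - b))).map fun p => p.1 / p.2,
    Measure.isProbabilityMeasure_map hdiv.aemeasurable, ?_, fun s hs => ?_⟩
  · change ∀ᵐ x ∂(μ.prod (betaMeasure b (1 - a - b))).map fun p => p.1 / p.2, 0 < x
    rw [ae_map_iff hdiv.aemeasurable measurableSet_Ioi]
    filter_upwards [Measure.quasiMeasurePreserving_fst.ae hμpos,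
      Measure.quasiMeasurePreserving_snd.ae hνpos] with p hp hq
    exact div_pos hp hq
  · have hbs : 0 < b - s := sub_pos.mpr hs.2
    rw [lintegral_rpow_map_div_prod hμpos hνpos, hmom s ⟨hs.1, by linarith [hs.2]⟩,
      lintegral_rpow_neg_betaMeasure hb hβ hs.2,
      ← ENNReal.ofReal_mul' (div_nonneg (beta_pos hbs hβ).le (beta_pos hb hβ).le)]
    have e1 : b + (1 - a - b) = 1 - a := by ring
    have e2 : b - s + (1 - a - b) = 1 - a - s := by ring
    have h1 := (Gamma_pos_of_pos hβ).ne'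
    have h2 := (Gamma_pos_of_pos (sub_pos.mpr ha1)).ne'
    have h3 := (Gamma_pos_of_pos (show 0 < 1 - a - s by linarith)).ne'
    have h4 := (Gamma_pos_of_pos hb).ne'
    have h5 := (Gamma_pos_of_pos ha).ne'
    rw [beta, beta, e1, e2]
    congr 1
    simp only [div_eq_mul_inv, mul_inv, inv_inv]
    field_simp
end

section
/- Let 0 < a < 1 and b > 0 with a + b > 1, and let c, d > 0. If the random variable X_{a,b,c,d} exists, then the random variable X_{a,1−a,c,d} exists. -/
open MeasureTheory Real

open ProbabilityTheory in
lemma ae_pos_betaMeasure (α β : ℝ) : ∀ᵐ x ∂betaMeasure α β, 0 < x := by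
  have h : betaMeasure α β (Set.Iic 0) = 0 := by
    rw [betaMeasure, withDensity_apply _ measurableSet_Iic]
    exact setLIntegral_eq_zero measurableSet_Iic fun x hx ↦ betaPDF_eq_zero_of_nonpos hx
  simpa only [ae_iff, not_lt, Set.Iic] using h

open ProbabilityTheory in
/-- The moments of negative order of the beta distribution. -/
lemma lintegral_rpow_neg_betaMeasure {α β s : ℝ} (hα : 0 < α) (hβ : 0 < β) (hs : s < α) :
    ∫⁻ x, ENNReal.ofReal (x ^ (-s)) ∂betaMeasure α β =
      ENNReal.ofReal (beta (α - s) β / beta α β) := by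
  have hm : Measurable (betaPDF α β) := (measurable_betaPDFReal α β).ennreal_ofReal
  have hB := beta_pos hα hβ
  have hB' := beta_pos (sub_pos.2 hs) hβ
  rw [betaMeasure, lintegral_withDensity_eq_lintegral_mul _ hm (by fun_prop)]
  have key : ∀ x : ℝ, (betaPDF α β * fun x ↦ ENNReal.ofReal (x ^ (-s))) x =
      ENNReal.ofReal (beta (α - s) β / beta α β) * betaPDF (α - s) β x := by
    intro x
    rw [Pi.mul_apply]
    rcases le_or_gt x 0 with h0 | h0
    · simp [betaPDF_eq_zero_of_nonpos h0]
    rcases le_or_gt 1 x with h1 | h1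
    · simp [betaPDF_eq_zero_of_one_le h1]
    rw [betaPDF, ← ENNReal.ofReal_mul (betaPDFReal_pos h0 h1 hα hβ).le, betaPDF,
      ← ENNReal.ofReal_mul (div_pos hB' hB).le, betaPDFReal, betaPDFReal,
      if_pos ⟨h0, h1⟩, if_pos ⟨h0, h1⟩, show α - s - 1 = (α - 1) + -s by ring, rpow_add h0]
    congr 1
    field_simp
  rw [lintegral_congr key, lintegral_const_mul' _ _ ENNReal.ofReal_ne_top,
    lintegral_betaPDF_eq_one (sub_pos.2 hs) hβ, mul_one]

/-- Dividing by an independent beta variable lowers the parameter `b`. -/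
lemma XExists.mono_right {a b b' c d : ℝ} (hb' : 0 < b') (hbb : b' < b)
    (h : XExists a b c d) : XExists a b' c d := by
  obtain ⟨μ, hμ, hμ0, hμs⟩ := h
  set ν := ProbabilityTheory.betaMeasure b' (b - b') with hν
  have hβ : 0 < b - b' := sub_pos.2 hbb
  have hνp : IsProbabilityMeasure ν := ProbabilityTheory.isProbabilityMeasureBeta hb' hβ
  have hq : Measurable fun z : ℝ × ℝ ↦ z.1 / z.2 := by fun_prop
  have h1 : ∀ᵐ z ∂μ.prod ν, 0 < z.1 :=
    Measure.quasiMeasurePreserving_fst.ae (show ∀ᵐ x ∂μ, 0 < x from hμ0)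
  have h2 : ∀ᵐ z ∂μ.prod ν, 0 < z.2 :=
    Measure.quasiMeasurePreserving_snd.ae (ae_pos_betaMeasure b' (b - b'))
  refine ⟨(μ.prod ν).map fun z ↦ z.1 / z.2, Measure.isProbabilityMeasure_map hq.aemeasurable,
    ?_, fun s hs ↦ ?_⟩
  · rw [Measure.map_apply hq measurableSet_Ioi.compl]
    have h3 : ∀ᵐ z ∂μ.prod ν, 0 < z.1 / z.2 := by
      filter_upwards [h1, h2] with z hz1 hz2 using div_pos hz1 hz2
    exact h3
  have hs' : s ∈ Set.Ioo (-a) b := ⟨hs.1, hs.2.trans hbb⟩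
  have hcongr : ∀ᵐ z ∂μ.prod ν, ENNReal.ofReal ((z.1 / z.2) ^ s) =
      ENNReal.ofReal (z.1 ^ s) * ENNReal.ofReal (z.2 ^ (-s)) := by
    filter_upwards [h1, h2] with z hz1 hz2
    rw [← ENNReal.ofReal_mul (rpow_nonneg hz1.le s), div_rpow hz1.le hz2.le, rpow_neg hz2.le,
      div_eq_mul_inv]
  have hG := Gamma_pos_of_pos hb'
  have hG1 := Gamma_pos_of_pos (hb'.trans hbb)
  have hG2 := Gamma_pos_of_pos hβ
  have hG3 := Gamma_pos_of_pos (sub_pos.2 hs'.2)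
  rw [lintegral_map (by fun_prop) hq, lintegral_congr_ae hcongr,
    lintegral_prod_mul (f := fun x ↦ ENNReal.ofReal (x ^ s))
      (g := fun x ↦ ENNReal.ofReal (x ^ (-s))) (by fun_prop) (by fun_prop),
    hμs s hs', lintegral_rpow_neg_betaMeasure hb' hβ hs.2, ← ENNReal.ofReal_mul'
      (div_pos (ProbabilityTheory.beta_pos (sub_pos.2 hs.2) hβ)
        (ProbabilityTheory.beta_pos hb' hβ)).le]
  congr 1
  rw [ProbabilityTheory.beta, ProbabilityTheory.beta, show b' - s + (b - b') = b - s by ring,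
    show b' + (b - b') = b by ring]
  field_simp

theorem XExists_one_sub_of_XExists (a b c d : ℝ) (ha : 0 < a) (ha1 : a < 1) (hb : 0 < b)
    (hab : 1 < a + b) (hc : 0 < c) (hd : 0 < d) (h : XExists a b c d) :
    XExists a (1 - a) c d := by
  exact h.mono_right (sub_pos.2 ha1) (by linarith)
end

section
/- For all a, b, c > 0 with c ≥ 3a + b and 2·(c/2 − a)·(c/2 + 1/2 − a) ≥ a + b, the random variable X_{a,b,c,2} exists. -/
open MeasureTheory Real

/-- The rising factorial `x (x + 1) ⋯ (x + k - 1)`. -/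
noncomputable def poch (x : ℝ) : ℕ → ℝ
  | 0 => 1
  | k + 1 => poch x k * (x + k)

lemma poch_pos {x : ℝ} (hx : 0 < x) (k : ℕ) : 0 < poch x k := by
  induction k with
  | zero => simp [poch]
  | succ k ih => rw [poch]; positivity

/-- The weights, up to elementary factors, in the expansion of the hypergeometric function
`₁F₂(A; A + p, A + p + 1/2; -x)` into squares of Bessel functions. -/
noncomputable def sqWeight (A p : ℝ) : ℕ → ℝ
  | 0 => 1
  | 1 => 1 - (A + 2 * p + 1) * A / ((A + p) * (A + p + 1 / 2))
  | n + 2 => sqWeight A p (n + 1) +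
      ((n + 1) * (n + p) * (n + p - 1 / 2) * (sqWeight A p (n + 1) - sqWeight A p n)
        - (2 * n + A + 2 * p + 1) * (A + 2 * p + 1) * A * sqWeight A p (n + 1)) /
        ((n + A + 2 * p) * (n + 1 + (A + p)) * (n + 1 + (A + p + 1 / 2)))

lemma sqWeight_succ_succ {A p : ℝ} (hA : 0 < A) (hp : 0 < p) (n : ℕ) :
    (n + A + 2 * p) * (n + 1 + (A + p)) * (n + 1 + (A + p + 1 / 2)) *
        (sqWeight A p (n + 2) - sqWeight A p (n + 1)) =
      (n + 1) * (n + p) * (n + p - 1 / 2) * (sqWeight A p (n + 1) - sqWeight A p n)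
        - (2 * n + A + 2 * p + 1) * (A + 2 * p + 1) * A * sqWeight A p (n + 1) := by
  rw [sqWeight]
  have : (n + A + 2 * p) * (n + 1 + (A + p)) * (n + 1 + (A + p + 1 / 2)) ≠ 0 := by positivity
  rw [add_sub_cancel_left, mul_div_cancel₀ _ this]

lemma sqWeight_one {A p : ℝ} (hA : 0 < A) (hp : 0 < p) :
    (A + p) * (A + p + 1 / 2) * sqWeight A p 1 =
      (A + p) * (A + p + 1 / 2) - (A + 2 * p + 1) * A := by
  have : (A + p) * (A + p + 1 / 2) ≠ 0 := by positivity
  rw [sqWeight]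
  field_simp

lemma sqWeight_nonneg_aux {A p : ℝ} (hA : 0 < A) (hp : 0 < p) (h1 : A ≤ 2 * p)
    (h2 : A ≤ p * (2 * p + 1)) (n : ℕ) : 0 ≤ sqWeight A p (n + 1) ∧
    (n + p) * (n + p - 1 / 2) * sqWeight A p n ≤
      (n + (A + p)) * (n + (A + p + 1 / 2)) * sqWeight A p (n + 1) := by
  induction n with
  | zero =>
    have h := sqWeight_one hA hp
    have h0 : sqWeight A p 0 = 1 := rfl
    refine ⟨?_, ?_⟩
    · have : 0 < (A + p) * (A + p + 1 / 2) := by positivity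
      refine nonneg_of_mul_nonneg_right (?_ : 0 ≤ (A + p) * (A + p + 1 / 2) * _) this
      rw [h]; nlinarith
    · simp only [Nat.cast_zero, zero_add, h0, h]; nlinarith
  | succ n ih =>
    obtain ⟨ih0, ih⟩ := ih
    have hrec := sqWeight_succ_succ hA hp n
    set U := sqWeight A p n
    set V := sqWeight A p (n + 1)
    set Z := sqWeight A p (n + 2)
    have hn : (0 : ℝ) ≤ n := n.cast_nonneg
    have key : (n + 1 + p) * (n + 1 + p - 1 / 2) * V ≤
        (n + 1 + (A + p)) * (n + 1 + (A + p + 1 / 2)) * Z := by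
      have hpos : 0 < n + A + 2 * p := by positivity
      refine le_of_mul_le_mul_left ?_ hpos
      have e1 : (n + A + 2 * p) * ((n + 1 + (A + p)) * (n + 1 + (A + p + 1 / 2)) * Z) =
          (n + A + 2 * p) * (n + 1 + (A + p)) * (n + 1 + (A + p + 1 / 2)) * V
          + (n + 1) * (n + p) * (n + p - 1 / 2) * V
          - (2 * n + A + 2 * p + 1) * (A + 2 * p + 1) * A * V
          - (n + 1) * ((n + p) * (n + p - 1 / 2) * U) := by linear_combination hrec
      have e2 := mul_le_mul_of_nonneg_left ih (by positivity : (0:ℝ) ≤ n + 1)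
      have e3 : 0 ≤ (2 * p - A) * (n + A + 1 / 2 + (2 * p - A) / 2) * V :=
        mul_nonneg (mul_nonneg (by linarith) (by linarith)) ih0
      rw [e1]
      linarith
    refine ⟨?_, by push_cast; exact key⟩
    have : 0 < (n + 1 + (A + p)) * (n + 1 + (A + p + 1 / 2)) := by positivity
    refine nonneg_of_mul_nonneg_right (le_trans ?_ key) this
    exact mul_nonneg (mul_nonneg (by linarith) (by linarith)) ih0

lemma sqWeight_nonneg {A p : ℝ} (hA : 0 < A) (hp : 0 < p) (h1 : A ≤ 2 * p)
    (h2 : A ≤ p * (2 * p + 1)) : ∀ n : ℕ, 0 ≤ sqWeight A p n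
  | 0 => zero_le_one
  | n + 1 => (sqWeight_nonneg_aux hA hp h1 h2 n).1

lemma exists_sqWeight_le_pow {A p : ℝ} (hA : 0 < A) (hp : 0 < p) (h1 : A ≤ 2 * p)
    (h2 : A ≤ p * (2 * p + 1)) : ∃ K : ℝ, 1 ≤ K ∧ ∀ n : ℕ, sqWeight A p n ≤ K ^ n := by
  obtain ⟨κ, hκ1, hκ⟩ : ∃ κ : ℝ, 1 ≤ κ ∧ 1 ≤ κ * (A + 2 * p) :=
    ⟨1 + 1 / (A + 2 * p), by simp; positivity, by field_simp; nlinarith⟩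
  refine ⟨1 + 2 * κ, by linarith, ?_⟩
  suffices h : ∀ n : ℕ, sqWeight A p n ≤ (1 + 2 * κ) ^ n ∧
      sqWeight A p (n + 1) ≤ (1 + 2 * κ) ^ (n + 1) from fun n => (h n).1
  intro n
  induction n with
  | zero =>
    have h0 : sqWeight A p 0 = 1 := rfl
    refine ⟨by simp [h0], ?_⟩
    have : 0 ≤ (A + 2 * p + 1) * A / ((A + p) * (A + p + 1 / 2)) := by positivity
    simp only [sqWeight, zero_add, pow_one]
    linarith
  | succ n ih =>
    refine ⟨ih.2, ?_⟩
    have hrec := sqWeight_succ_succ hA hp n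
    have hU := sqWeight_nonneg hA hp h1 h2 n
    have hV := sqWeight_nonneg hA hp h1 h2 (n + 1)
    have hn : (0 : ℝ) ≤ n := n.cast_nonneg
    obtain ⟨hU', hV'⟩ := ih
    rw [show n + 1 + 1 = n + 2 from rfl]
    set U := sqWeight A p n
    set V := sqWeight A p (n + 1)
    set Z := sqWeight A p (n + 2)
    set a := (n + A + 2 * p) * (n + 1 + (A + p)) * (n + 1 + (A + p + 1 / 2)) with ha
    set c := (n + 1) * (n + p) * (n + p - 1 / 2) with hc
    have hapos : 0 < a := by positivity
    have hn1 : (n : ℝ) + 1 ≤ κ * (n + A + 2 * p) := by nlinarith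
    have hq : |(n + p) * (n + p - 1 / 2)| ≤ (n + 1 + (A + p)) * (n + 1 + (A + p + 1 / 2)) := by
      rw [abs_le]; constructor <;> nlinarith [mul_nonneg hn hp.le, mul_pos hA hp, mul_nonneg hn hA.le]
    have hca : |c| ≤ κ * a := by
      rw [hc, mul_assoc, abs_mul, abs_of_pos (by positivity : (0:ℝ) < n + 1), ha]
      calc _ ≤ (κ * (n + A + 2 * p)) * ((n + 1 + (A + p)) * (n + 1 + (A + p + 1 / 2))) := by
            gcongr
        _ = _ := by ring
    have hZ : a * Z ≤ a * ((1 + κ) * V + κ * U) := by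
      have h3 : 0 ≤ (2 * n + A + 2 * p + 1) * (A + 2 * p + 1) * A * V := by positivity
      have h4 := mul_le_mul_of_nonneg_right ((le_abs_self c).trans hca) hV
      have h5 := mul_le_mul_of_nonneg_right ((neg_le_abs c).trans hca) hU
      linarith
    have hZ' := le_of_mul_le_mul_left hZ hapos
    have hP : (0 : ℝ) ≤ (1 + 2 * κ) ^ n := by positivity
    calc Z ≤ (1 + κ) * V + κ * U := hZ'
      _ ≤ (1 + κ) * (1 + 2 * κ) ^ (n + 1) + κ * ((1 + 2 * κ) ^ (n + 1)) := by
        gcongr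
        refine hU'.trans ?_
        exact pow_le_pow_right₀ (by linarith) (Nat.le_succ n)
      _ = _ := by ring

/-- The combinatorial factors of an expansion into squares of Bessel functions. -/
noncomputable def sqPre (m : ℝ) : ℕ → ℝ
  | 0 => 1
  | n + 1 => (2 * n + 1 + m) * poch m n / (n + 1).factorial

/-- `1 / ((k - n)! (m)_{n + k})`, extended by zero to `n > k`. -/
noncomputable def invFactPoch (m : ℝ) (n k : ℕ) : ℝ :=
  if n ≤ k then 1 / ((k - n).factorial * poch m (n + k)) else 0

lemma invFactPoch_add {m : ℝ} (n j : ℕ) :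
    invFactPoch m n (n + j) = 1 / (j.factorial * poch m (n + (n + j))) := by
  simp [invFactPoch]

lemma invFactPoch_of_lt {m : ℝ} {n k : ℕ} (h : k < n) : invFactPoch m n k = 0 := by
  simp [invFactPoch, h]

lemma invFactPoch_eq_mul {m : ℝ} (hm : 0 < m) {n k : ℕ} (h : n ≤ k + 1) :
    invFactPoch m n k = (k + 1 - n) * (m + n + k) * invFactPoch m n (k + 1) := by
  obtain ⟨j, hj⟩ := Nat.exists_eq_add_of_le h
  rcases j with _ | j
  · have : (n : ℝ) = k + 1 := by have : n = k + 1 := by omega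
                                 rw [this]; push_cast; ring
    rw [invFactPoch_of_lt (by omega), this]; ring
  · obtain rfl : k = n + j := by omega
    rw [invFactPoch_add, show n + j + 1 = n + (j + 1) from rfl, invFactPoch_add,
      show n + (n + (j + 1)) = n + (n + j) + 1 from rfl, poch, Nat.factorial_succ]
    have := poch_pos hm (n + (n + j))
    have : (j.factorial : ℝ) ≠ 0 := by positivity
    have : m + ((n + (n + j) : ℕ) : ℝ) ≠ 0 := by positivity
    push_cast at *
    field_simp
    ring

lemma invFactPoch_succ_eq_mul {m : ℝ} (hm : 0 < m) {n k : ℕ} (h : n ≤ k + 1) :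
    invFactPoch m (n + 1) k = (k - n) * (k + 1 - n) * invFactPoch m n (k + 1) := by
  obtain ⟨j, hj⟩ := Nat.exists_eq_add_of_le h
  rcases j with _ | _ | j
  · have : (n : ℝ) = k + 1 := by have : n = k + 1 := by omega
                                 rw [this]; push_cast; ring
    rw [invFactPoch_of_lt (by omega), this]; ring
  · obtain rfl : n = k := by omega
    rw [invFactPoch_of_lt (by omega)]; ring
  · obtain rfl : k = n + 1 + j := by omega
    rw [invFactPoch_add, show n + 1 + j + 1 = n + (j + 2) by ring, invFactPoch_add,
      show n + (n + (j + 2)) = n + 1 + (n + 1 + j) by ring, Nat.factorial_succ, Nat.factorial_succ]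
    have := poch_pos hm (n + 1 + (n + 1 + j))
    have : (j.factorial : ℝ) ≠ 0 := by positivity
    push_cast
    field_simp
    ring

lemma invFactPoch_eq_mul_succ {m : ℝ} (hm : 0 < m) {n k : ℕ} (h : n ≤ k) :
    invFactPoch m n k = (m + n + 1 + k) * (m + n + k) * invFactPoch m (n + 1) (k + 1) := by
  obtain ⟨j, rfl⟩ := Nat.exists_eq_add_of_le h
  rw [invFactPoch_add, show n + j + 1 = n + 1 + j by ring, invFactPoch_add,
    show n + 1 + (n + 1 + j) = n + (n + j) + 1 + 1 by ring, poch, poch]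
  have := poch_pos hm (n + (n + j))
  have : (j.factorial : ℝ) ≠ 0 := by positivity
  have : m + ((n + (n + j) : ℕ) : ℝ) ≠ 0 := by positivity
  have : m + ((n + (n + j) + 1 : ℕ) : ℝ) ≠ 0 := by positivity
  push_cast at *
  field_simp
  ring

set_option maxRecDepth 4000 in
lemma sum_sqWeight_telescope {A p : ℝ} (hA : 0 < A) (hp : 0 < p) (k i : ℕ) (hi : i ≤ k + 1) :
    ∑ n ∈ Finset.range (i + 1), (-1) ^ n * sqPre (A + 2 * p) n * sqWeight A p n *
      (((A + 2 * p + 1) / 2 + k) * (A + k) * invFactPoch (A + 2 * p) n k -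
        (k + 1) * ((A + 2 * p) / 2 + k) * (A + p + k) * (A + p + 1 / 2 + k) *
          invFactPoch (A + 2 * p) n (k + 1)) =
    -(-1) ^ i * (invFactPoch (A + 2 * p) i k *
        (poch (A + 2 * p) i * (i + (A + p)) * (i + (A + p + 1 / 2)) / (2 * i.factorial)) *
        sqWeight A p (i + 1) +
      invFactPoch (A + 2 * p) (i + 1) k *
        (poch (A + 2 * p) i * (i + p) * (i + p - 1 / 2) / (2 * i.factorial)) *
        sqWeight A p i) := by
  have hm : 0 < A + 2 * p := by positivity
  induction i with
  | zero =>
    have h0 : sqWeight A p 0 = 1 := rfl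
    have hw := sqWeight_one hA hp
    have e1 := invFactPoch_eq_mul hm (Nat.zero_le (k + 1))
    have e2 := invFactPoch_succ_eq_mul hm (Nat.zero_le (k + 1))
    simp only [zero_add, Finset.range_one, Finset.sum_singleton, pow_zero, sqPre, h0, e1, e2,
      Nat.factorial_zero, Nat.cast_zero, Nat.cast_one, poch]
    linear_combination (1 / 2 * ((k + 1 - 0) * (A + 2 * p + 0 + k)) *
      invFactPoch (A + 2 * p) 0 (k + 1)) * hw
  | succ i ih =>
    rw [Finset.sum_range_succ, ih (by omega)]
    have hrec := sqWeight_succ_succ hA hp i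
    have e1 := invFactPoch_eq_mul hm hi
    have e2 := invFactPoch_succ_eq_mul hm hi
    have e3 := invFactPoch_eq_mul_succ hm (show i ≤ k by omega)
    rw [show i + 1 + 1 = i + 2 from rfl] at *
    rw [e1, e2, e3]
    have hF : (i.factorial : ℝ) ≠ 0 := by positivity
    rw [show sqPre (A + 2 * p) (i + 1) = (2 * i + 1 + (A + 2 * p)) * poch (A + 2 * p) i /
      (i + 1).factorial from rfl, show poch (A + 2 * p) (i + 1) = poch (A + 2 * p) i *
      (A + 2 * p + i) from rfl, Nat.factorial_succ, pow_succ]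
    set U := sqWeight A p i
    set V := sqWeight A p (i + 1)
    set Z := sqWeight A p (i + 2)
    set β := invFactPoch (A + 2 * p) (i + 1) (k + 1)
    clear_value U V Z β
    clear ih e1 e2 e3
    generalize poch (A + 2 * p) i = D
    generalize (-1 : ℝ) ^ i = ε
    simp only [Nat.cast_mul, Nat.cast_add, Nat.cast_one]
    generalize (i.factorial : ℝ) = F at *
    have hi1 : (i : ℝ) + 1 ≠ 0 := by positivity
    obtain ⟨g, rfl⟩ : ∃ g, D = g * ((i + 1) * F) := ⟨D / ((i + 1) * F), by field_simp⟩
    have d1 (x y : ℝ) : g * ((i + 1) * F) * x * y / (2 * F) = g * (i + 1) * x * y / 2 := by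
      field_simp
    have d2 (x : ℝ) : x * (g * ((i + 1) * F)) / ((i + 1) * F) = x * g := by field_simp
    have d3 (x y z : ℝ) : g * ((i + 1) * F) * x * y * z / (2 * ((i + 1) * F)) =
      g * x * y * z / 2 := by field_simp
    rw [d1, d1, d2, d3, d3]
    linear_combination (-ε * g / 2 * (k - i) * (A + 2 * p + i + 1 + k) * β) * hrec

lemma poch_ne_zero {x : ℝ} (hx : 0 < x) (k : ℕ) : poch x k ≠ 0 := (poch_pos hx k).ne'

lemma poch_add (x : ℝ) (i j : ℕ) : poch x (i + j) = poch x i * poch (x + i) j := by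
  induction j with
  | zero => simp [poch]
  | succ j ih => rw [← add_assoc, poch, poch, ih]; push_cast; ring

lemma poch_two_mul (x : ℝ) (k : ℕ) :
    poch (2 * x) (2 * k) = 4 ^ k * poch x k * poch (x + 1 / 2) k := by
  induction k with
  | zero => simp [poch]
  | succ k ih =>
    rw [show 2 * (k + 1) = 2 * k + 1 + 1 by ring, poch, poch, ih, poch, poch]
    push_cast
    ring

lemma sum_sqWeight_mul_invFactPoch {A p : ℝ} (hA : 0 < A) (hp : 0 < p) (k : ℕ) :
    ∑ n ∈ Finset.range (k + 1), (-1) ^ n * sqPre (A + 2 * p) n * sqWeight A p n *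
      invFactPoch (A + 2 * p) n k =
    poch A k * poch ((A + 2 * p + 1) / 2) k /
      (k.factorial * poch ((A + 2 * p) / 2) k * poch (A + p) k * poch (A + p + 1 / 2) k) := by
  induction k with
  | zero =>
    have h0 : sqWeight A p 0 = 1 := rfl
    simp [sqPre, h0, invFactPoch, poch]
  | succ k ih =>
    have h := sum_sqWeight_telescope hA hp k (k + 1) le_rfl
    rw [invFactPoch_of_lt (Nat.lt_succ_self k), invFactPoch_of_lt (by omega : k < k + 1 + 1)] at h
    simp only [zero_mul, add_zero, mul_zero, mul_sub, Finset.sum_sub_distrib] at h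
    rw [Finset.sum_range_succ, invFactPoch_of_lt (Nat.lt_succ_self k)] at h
    have e1 : ∀ n, (-1) ^ n * sqPre (A + 2 * p) n * sqWeight A p n *
      (((A + 2 * p + 1) / 2 + k) * (A + k) * invFactPoch (A + 2 * p) n k) =
      (((A + 2 * p + 1) / 2 + k) * (A + k)) * ((-1) ^ n * sqPre (A + 2 * p) n * sqWeight A p n *
        invFactPoch (A + 2 * p) n k) := fun n => by ring
    have e2 : ∀ n, (-1) ^ n * sqPre (A + 2 * p) n * sqWeight A p n *
      ((k + 1) * ((A + 2 * p) / 2 + k) * (A + p + k) * (A + p + 1 / 2 + k) *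
        invFactPoch (A + 2 * p) n (k + 1)) =
      ((k + 1) * ((A + 2 * p) / 2 + k) * (A + p + k) * (A + p + 1 / 2 + k)) *
      ((-1) ^ n * sqPre (A + 2 * p) n * sqWeight A p n *
        invFactPoch (A + 2 * p) n (k + 1)) := fun n => by ring
    simp only [e1, e2, ← Finset.mul_sum, ih, mul_zero, add_zero] at h
    generalize ∑ n ∈ Finset.range (k + 1 + 1), (-1) ^ n * sqPre (A + 2 * p) n * sqWeight A p n *
        invFactPoch (A + 2 * p) n (k + 1) = S at h ⊢
    rw [poch, poch, poch, poch, poch, Nat.factorial_succ]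
    have h1 := poch_ne_zero (by positivity : 0 < (A + 2 * p) / 2) k
    have h2 := poch_ne_zero (by positivity : 0 < A + p) k
    have h3 := poch_ne_zero (by positivity : 0 < A + p + 1 / 2) k
    have hR : ((k + 1) * ((A + 2 * p) / 2 + k) * (A + p + k) * (A + p + 1 / 2 + k)) ≠ 0 := by
      positivity
    refine mul_left_cancel₀ hR ?_
    rw [← sub_eq_zero.1 h]
    have h4 : (k.factorial : ℝ) ≠ 0 := by positivity
    generalize poch ((A + 2 * p) / 2) k = x1 at *
    generalize poch (A + p) k = x2 at *
    generalize poch (A + p + 1 / 2) k = x3 at *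
    push_cast
    generalize (k.factorial : ℝ) = x4 at *
    have r1 : (k : ℝ) + 1 ≠ 0 := by positivity
    have r2 : (A + 2 * p) / 2 + k ≠ 0 := by positivity
    have r3 : A + p + k ≠ 0 := by positivity
    have r4 : A + p + 1 / 2 + k ≠ 0 := by positivity
    generalize (A + 2 * p) / 2 + k = y2 at *
    generalize A + p + k = y3 at *
    generalize A + p + 1 / 2 + k = y4 at *
    field_simp

lemma multichoose_eq_poch (x : ℝ) (k : ℕ) : Ring.multichoose x k = poch x k / k.factorial := by
  have h := Ring.factorial_nsmul_multichoose_eq_ascPochhammer x k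
  have h2 : (ascPochhammer ℕ k).smeval x = poch x k := by
    rw [Polynomial.ascPochhammer_smeval_eq_eval]
    induction k with
    | zero => simp [poch]
    | succ k ih =>
      rw [ascPochhammer_succ_eval, poch, ih]
      exact Ring.factorial_nsmul_multichoose_eq_ascPochhammer x k
  rw [h2, nsmul_eq_mul] at h
  rw [← h, mul_div_cancel_left₀ _ (by positivity)]

lemma sum_antidiagonal_inv_poch {c : ℝ} (hc : 1 / 2 < c) (k : ℕ) :
    ∑ x ∈ Finset.HasAntidiagonal.antidiagonal k, 1 / (x.1.factorial * poch c x.1) *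
      (1 / (x.2.factorial * poch c x.2))
      = 4 ^ k * poch (c - 1 / 2) k / (k.factorial * poch c k * poch (2 * c - 1) k) := by
  have hc0 : 0 < c := by linarith
  have h := Ring.add_choose_eq k (Commute.all (c + k - 1) (c + k - 1))
  have hP := poch_ne_zero hc0 k
  have e : ∀ x ∈ Finset.HasAntidiagonal.antidiagonal k,
      Ring.choose (c + k - 1) x.1 * Ring.choose (c + k - 1) x.2
      = poch c k ^ 2 *
        (1 / (x.1.factorial * poch c x.1) * (1 / (x.2.factorial * poch c x.2))) := by
    rintro ⟨i, j⟩ hx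
    obtain rfl : i + j = k := by simpa using hx
    simp only [Ring.choose]
    rw [show c + (i + j : ℕ) - 1 - i + 1 = c + j by push_cast; ring,
      show c + (i + j : ℕ) - 1 - j + 1 = c + i by push_cast; ring, multichoose_eq_poch,
      multichoose_eq_poch, sq]
    nth_rewrite 1 [poch_add c i j]
    rw [add_comm i j, poch_add c j i]
    have := poch_ne_zero hc0 i
    have := poch_ne_zero hc0 j
    have : (i.factorial : ℝ) ≠ 0 := by positivity
    have : (j.factorial : ℝ) ≠ 0 := by positivity
    field_simp
  rw [Finset.sum_congr rfl e, ← Finset.mul_sum] at h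
  have e2 : Ring.choose (c + k - 1 + (c + k - 1)) k = poch (2 * c - 1 + k) k / k.factorial := by
    rw [← multichoose_eq_poch, Ring.choose]
    congr 1; ring
  rw [e2] at h
  have e3 := poch_two_mul (c - 1 / 2) k
  rw [show 2 * (c - 1 / 2) = 2 * c - 1 by ring, two_mul k, poch_add, sub_add_cancel] at e3
  have h1 := poch_ne_zero (by linarith : 0 < 2 * c - 1) k
  refine mul_left_cancel₀ (pow_ne_zero 2 hP) ?_
  rw [← h]
  have : (k.factorial : ℝ) ≠ 0 := by positivity
  generalize poch (c - 1 / 2) k = y at *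
  field_simp
  linear_combination e3

lemma inv_poch_le {x : ℝ} (hx : 0 < x) (k : ℕ) : (poch x k)⁻¹ ≤ 1 + x⁻¹ := by
  rcases k with _ | k
  · simp [poch, hx.le]
  · have h : ∀ j, x ≤ poch x (j + 1) := by
      intro j
      induction j with
      | zero => simp [poch]
      | succ j ih =>
        rw [poch]
        have : (1 : ℝ) ≤ x + (j + 1 : ℕ) := by push_cast; linarith [j.cast_nonneg (α := ℝ)]
        nlinarith
    linarith [inv_anti₀ hx (h k)]

lemma one_le_poch {x : ℝ} (hx : 1 ≤ x) (k : ℕ) : 1 ≤ poch x k := by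
  induction k with
  | zero => simp [poch]
  | succ k ih =>
    rw [poch]
    have : (1 : ℝ) ≤ x + k := by linarith [k.cast_nonneg (α := ℝ)]
    nlinarith

lemma poch_le_poch {x y : ℝ} (hx : 0 < x) (hxy : x ≤ y) (k : ℕ) : poch x k ≤ poch y k := by
  induction k with
  | zero => simp [poch]
  | succ k ih =>
    rw [poch, poch]
    have := poch_pos (hx.trans_le hxy) k
    gcongr

/-- The general term of the double series whose diagonal sums give the `₁F₂` series and whose
row sums are squares. -/
noncomputable def sqTerm (A p x : ℝ) (n l : ℕ) : ℝ :=
  sqPre (A + 2 * p) n * sqWeight A p n / (4 ^ n * poch ((A + 2 * p + 1) / 2) n ^ 2) * x ^ n *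
    ((-x) ^ l * poch ((A + 2 * p) / 2 + n) l / (l.factorial *
      poch ((A + 2 * p + 1) / 2 + n) l * poch (A + 2 * p + 2 * n) l))

lemma sqTerm_eq {A p : ℝ} (hA : 0 < A) (hp : 0 < p) (x : ℝ) (n l : ℕ) :
    sqTerm A p x n l = (-x) ^ (n + l) * (poch ((A + 2 * p) / 2) (n + l) /
      poch ((A + 2 * p + 1) / 2) (n + l)) *
      ((-1) ^ n * sqPre (A + 2 * p) n * sqWeight A p n * invFactPoch (A + 2 * p) n (n + l)) := by
  have hm : 0 < A + 2 * p := by positivity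
  rw [invFactPoch_add, sqTerm, ← add_assoc, ← two_mul, poch_add _ (2 * n), poch_add _ n l,
    poch_add _ n l]
  have h := poch_two_mul ((A + 2 * p) / 2) n
  rw [show 2 * ((A + 2 * p) / 2) = A + 2 * p by ring,
    show (A + 2 * p) / 2 + 1 / 2 = (A + 2 * p + 1) / 2 by ring] at h
  rw [h, pow_add, neg_pow x n]
  push_cast
  have h1 := poch_ne_zero (by positivity : 0 < (A + 2 * p) / 2) n
  have h2 := poch_ne_zero (by positivity : 0 < (A + 2 * p + 1) / 2) n
  have h3 := poch_ne_zero (by positivity : 0 < (A + 2 * p + 1) / 2 + n) l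
  have h4 := poch_ne_zero (by positivity : 0 < A + 2 * p + 2 * n) l
  have h5 : (l.factorial : ℝ) ≠ 0 := by positivity
  have h6 : ((-1 : ℝ) ^ n) * (-1) ^ n = 1 := by rw [← mul_pow]; simp
  generalize poch ((A + 2 * p) / 2) n = y1 at *
  generalize poch ((A + 2 * p + 1) / 2) n = y2 at *
  generalize poch ((A + 2 * p + 1) / 2 + n) l = y3 at *
  generalize poch (A + 2 * p + 2 * n) l = y4 at *
  generalize poch ((A + 2 * p) / 2 + n) l = y5 at *
  generalize (l.factorial : ℝ) = f at *
  generalize sqPre (A + 2 * p) n = d at *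
  generalize sqWeight A p n = w at *
  generalize (-1 : ℝ) ^ n = ε at *
  field_simp
  linear_combination (-d * w * x ^ n * (-x) ^ l * y5) * h6

lemma sqPre_nonneg {m : ℝ} (hm : 0 < m) (n : ℕ) : 0 ≤ sqPre m n := by
  rcases n with _ | n
  · simp [sqPre]
  · rw [sqPre]
    have := poch_pos hm n
    positivity

lemma sqPre_mul_invFactPoch_le {m : ℝ} (hm : 0 < m) (n l : ℕ) :
    sqPre m n * invFactPoch m n (n + l) ≤
      (2 + m⁻¹) * ((n.factorial : ℝ)⁻¹ * (l.factorial : ℝ)⁻¹) := by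
  rw [invFactPoch_add]
  have hl : (0 : ℝ) < l.factorial := by positivity
  rcases n with _ | n
  · simp only [sqPre, zero_add, one_div, mul_inv, Nat.factorial_zero, Nat.cast_one, inv_one,
      one_mul]
    rw [mul_comm]
    gcongr
    linarith [inv_poch_le hm l]
  · rw [sqPre, poch_add, poch]
    have h1 := poch_pos hm n
    have h2 : 1 ≤ poch (m + (n + 1 : ℕ)) (n + 1 + l) :=
      one_le_poch (by push_cast; linarith [n.cast_nonneg (α := ℝ)]) _
    have hF : (0 : ℝ) < (n + 1).factorial := by positivity
    generalize poch (m + (n + 1 : ℕ)) (n + 1 + l) = y at *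
    generalize poch m n = z at *
    generalize ((n + 1).factorial : ℝ) = F at *
    generalize (l.factorial : ℝ) = G at *
    have hy : 0 < y := by linarith
    have e : (2 * n + 1 + m) * z / F * (1 / (G * (z * (m + n) * y))) =
        (2 * n + 1 + m) / (m + n) * y⁻¹ * (F⁻¹ * G⁻¹) := by field_simp
    rw [e]
    gcongr
    have h3 : (2 * n + 1 + m) / (m + n) ≤ 2 + m⁻¹ := by
      rw [div_le_iff₀ (by positivity)]
      have : (2 + m⁻¹) * (m + n) = 2 * m + 1 + 2 * n + n * m⁻¹ := by field_simp; ring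
      have h4 : 0 ≤ n * m⁻¹ := by positivity
      linarith
    calc _ ≤ (2 + m⁻¹) * 1 := by
          gcongr
          exact inv_le_one_of_one_le₀ h2
      _ = _ := mul_one _

lemma summable_sqTerm {A p : ℝ} (hA : 0 < A) (hp : 0 < p) (h1 : A ≤ 2 * p)
    (h2 : A ≤ p * (2 * p + 1)) {x : ℝ} (hx : 0 ≤ x) :
    Summable fun y : ℕ × ℕ => sqTerm A p x y.1 y.2 := by
  have hm : 0 < A + 2 * p := by positivity
  obtain ⟨K, hK1, hK⟩ := exists_sqWeight_le_pow hA hp h1 h2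
  have hs := ((Real.summable_pow_div_factorial (x * K)).mul_of_nonneg
    (Real.summable_pow_div_factorial x) (fun n => by positivity) (fun n => by positivity)).mul_left
    (2 + (A + 2 * p)⁻¹)
  refine Summable.of_norm_bounded hs ?_
  rintro ⟨n, l⟩
  simp only
  have hW := sqWeight_nonneg hA hp h1 h2 n
  have hP := sqPre_nonneg hm n
  have hI : 0 ≤ invFactPoch (A + 2 * p) n (n + l) := by
    rw [invFactPoch_add]
    have := poch_pos hm (n + (n + l))
    positivity
  have ha := poch_pos (by positivity : 0 < (A + 2 * p) / 2) (n + l)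
  have hb := poch_pos (by positivity : 0 < (A + 2 * p + 1) / 2) (n + l)
  have hab := poch_le_poch (by positivity : 0 < (A + 2 * p) / 2)
    (by linarith : (A + 2 * p) / 2 ≤ (A + 2 * p + 1) / 2) (n + l)
  rw [sqTerm_eq hA hp, Real.norm_eq_abs, abs_mul, abs_mul, abs_mul, abs_mul, abs_mul, abs_pow,
    abs_pow, abs_neg, abs_neg, abs_one, one_pow, one_mul, abs_of_nonneg hx, abs_of_nonneg hW,
    abs_of_nonneg hP, abs_of_nonneg hI, abs_of_pos (div_pos ha hb)]
  calc _ = x ^ (n + l) * (poch ((A + 2 * p) / 2) (n + l) / poch ((A + 2 * p + 1) / 2) (n + l)) *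
        sqWeight A p n * (sqPre (A + 2 * p) n * invFactPoch (A + 2 * p) n (n + l)) := by ring
    _ ≤ x ^ (n + l) * 1 * K ^ n *
        ((2 + (A + 2 * p)⁻¹) * ((n.factorial : ℝ)⁻¹ * (l.factorial : ℝ)⁻¹)) := by
      have hle := sqPre_mul_invFactPoch_le hm n l
      have hnn := mul_nonneg hP hI
      generalize sqPre (A + 2 * p) n * invFactPoch (A + 2 * p) n (n + l) = z at *
      gcongr
      · exact div_le_one_of_le₀ hab hb.le
      · exact hK n
    _ = _ := by rw [mul_pow, pow_add]; ring

lemma tsum_sqTerm_nonneg {A p : ℝ} (hA : 0 < A) (hp : 0 < p) (h1 : A ≤ 2 * p)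
    (h2 : A ≤ p * (2 * p + 1)) {x : ℝ} (hx : 0 ≤ x) (n : ℕ) :
    0 ≤ ∑' l, sqTerm A p x n l := by
  have hm : 0 < A + 2 * p := by positivity
  have hc : (1 : ℝ) / 2 < (A + 2 * p + 1) / 2 + n := by
    have := n.cast_nonneg (α := ℝ)
    linarith
  have hc0 : 0 < (A + 2 * p + 1) / 2 + n := by linarith
  simp only [sqTerm, tsum_mul_left]
  refine mul_nonneg ?_ ?_
  · have hW := sqWeight_nonneg hA hp h1 h2 n
    have hP := sqPre_nonneg hm n
    positivity
  · have hsum : Summable fun j : ℕ => ‖(-x / 4) ^ j *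
        (1 / (j.factorial * poch ((A + 2 * p + 1) / 2 + n) j))‖ := by
      refine Summable.of_nonneg_of_le (fun _ => norm_nonneg _) (fun j => ?_)
        ((Real.summable_pow_div_factorial (x / 4)).mul_left (1 + ((A + 2 * p + 1) / 2 + n)⁻¹))
      have hy := poch_pos hc0 j
      rw [norm_mul, norm_pow, Real.norm_eq_abs, Real.norm_eq_abs, abs_div, abs_neg,
        abs_of_nonneg hx, abs_of_pos (by norm_num : (0 : ℝ) < 4), abs_of_pos (by positivity)]
      calc _ = (poch ((A + 2 * p + 1) / 2 + n) j)⁻¹ * ((x / 4) ^ j / j.factorial) := by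
            field_simp
        _ ≤ _ := by gcongr; exact inv_poch_le hc0 j
    have h := tsum_mul_tsum_eq_tsum_sum_antidiagonal_of_summable_norm hsum hsum
    have e : ∀ l : ℕ, (-x) ^ l * poch ((A + 2 * p) / 2 + n) l / (l.factorial *
        poch ((A + 2 * p + 1) / 2 + n) l * poch (A + 2 * p + 2 * n) l) =
        ∑ kl ∈ Finset.HasAntidiagonal.antidiagonal l, (-x / 4) ^ kl.1 *
        (1 / (kl.1.factorial * poch ((A + 2 * p + 1) / 2 + n) kl.1)) * ((-x / 4) ^ kl.2 *
        (1 / (kl.2.factorial * poch ((A + 2 * p + 1) / 2 + n) kl.2))) := by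
      intro l
      have h3 := sum_antidiagonal_inv_poch hc l
      rw [show (A + 2 * p + 1) / 2 + n - 1 / 2 = (A + 2 * p) / 2 + n by ring,
        show 2 * ((A + 2 * p + 1) / 2 + n) - 1 = A + 2 * p + 2 * n by ring] at h3
      have h4 : (-x) ^ l = (-x / 4) ^ l * 4 ^ l := by rw [← mul_pow]; congr 1; ring
      rw [h4, mul_assoc, mul_div_assoc, ← h3, Finset.mul_sum]
      refine Finset.sum_congr rfl fun kl hkl => ?_
      rw [← Finset.HasAntidiagonal.mem_antidiagonal.1 hkl, pow_add]
      ring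
    simp only [e]
    rw [← h]
    exact mul_self_nonneg _

/-- The hypergeometric function `₁F₂(A; A + p, A + p + 1/2; -x)`. -/
noncomputable def hyp12 (A p x : ℝ) : ℝ :=
  ∑' k : ℕ, (-x) ^ k * (poch A k / (k.factorial * poch (A + p) k * poch (A + p + 1 / 2) k))

lemma hyp12_nonneg {A p : ℝ} (hA : 0 < A) (hp : 0 < p) (h1 : A ≤ 2 * p)
    (h2 : A ≤ p * (2 * p + 1)) {x : ℝ} (hx : 0 ≤ x) : 0 ≤ hyp12 A p x := by
  have hs := summable_sqTerm hA hp h1 h2 hx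
  have hsum := hs.hasSum
  rw [hs.tsum_prod] at hsum
  have h3 := ((Finset.HasAntidiagonal.sigmaAntidiagonalEquivProd (A := ℕ)).hasSum_iff.2 hsum).sigma
    (fun k => hasSum_fintype _)
  have h4 : hyp12 A p x = ∑' n, ∑' l, sqTerm A p x n l := by
    rw [← h3.tsum_eq, hyp12]
    refine tsum_congr fun k => ?_
    have hd := poch_ne_zero (by positivity : 0 < (A + 2 * p + 1) / 2) k
    have hd2 := poch_ne_zero (by positivity : 0 < (A + 2 * p) / 2) k
    have e1 : ∑ c : Finset.HasAntidiagonal.antidiagonal k,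
        ((fun y : ℕ × ℕ => sqTerm A p x y.1 y.2) ∘ Finset.HasAntidiagonal.sigmaAntidiagonalEquivProd) ⟨k, c⟩ =
        ∑ c ∈ Finset.HasAntidiagonal.antidiagonal k, sqTerm A p x c.1 c.2 :=
      Finset.sum_coe_sort (Finset.HasAntidiagonal.antidiagonal k)
        (fun c : ℕ × ℕ => sqTerm A p x c.1 c.2)
    rw [e1, Finset.Nat.sum_antidiagonal_eq_sum_range_succ (sqTerm A p x)]
    have e2 : ∀ n ∈ Finset.range k.succ, sqTerm A p x n (k - n) =
        (-x) ^ k * (poch ((A + 2 * p) / 2) k / poch ((A + 2 * p + 1) / 2) k) *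
      ((-1) ^ n * sqPre (A + 2 * p) n * sqWeight A p n * invFactPoch (A + 2 * p) n k) := by
      intro n hn
      rw [sqTerm_eq hA hp, Nat.add_sub_cancel' (by simpa [Nat.lt_succ_iff] using hn)]
    rw [Finset.sum_congr rfl e2, ← Finset.mul_sum, sum_sqWeight_mul_invFactPoch hA hp]
    have h5 := poch_ne_zero (by positivity : 0 < A + p) k
    have h6 := poch_ne_zero (by positivity : 0 < A + p + 1 / 2) k
    generalize poch ((A + 2 * p + 1) / 2) k = y1 at *
    generalize poch ((A + 2 * p) / 2) k = y2 at *
    generalize poch (A + p) k = y3 at *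
    generalize poch (A + p + 1 / 2) k = y4 at *
    have h5 : (k.factorial : ℝ) ≠ 0 := by positivity
    field_simp
  rw [h4]
  exact tsum_nonneg fun n => tsum_sqTerm_nonneg hA hp h1 h2 hx n

lemma Gamma_add_nat {x : ℝ} (hx : 0 < x) (k : ℕ) :
    Real.Gamma (x + k) = poch x k * Real.Gamma x := by
  induction k with
  | zero => simp [poch]
  | succ k ih =>
    rw [Nat.cast_add_one, ← add_assoc, Real.Gamma_add_one (by positivity), ih, poch]
    ring

lemma setIntegral_beta {a b : ℝ} (ha : 0 < a) (hb : 0 < b) :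
    ∫ v in Set.Ioo (0 : ℝ) 1, v ^ (a - 1) * (1 - v) ^ (b - 1) =
      Real.Gamma a * Real.Gamma b / Real.Gamma (a + b) := by
  have h := ProbabilityTheory.lintegral_betaPDF_eq_one ha hb
  have hb0 := ProbabilityTheory.beta_pos ha hb
  rw [ProbabilityTheory.lintegral_betaPDF] at h
  have h2 : ∫ v in Set.Ioo (0 : ℝ) 1,
      1 / ProbabilityTheory.beta a b * v ^ (a - 1) * (1 - v) ^ (b - 1) = 1 := by
    rw [integral_eq_lintegral_of_nonneg_ae _ (Measurable.aestronglyMeasurable (by fun_prop)), h,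
      ENNReal.toReal_one]
    refine (ae_restrict_iff' measurableSet_Ioo).2 (Filter.Eventually.of_forall fun v hv => ?_)
    have h3 := hv.1
    have h4 : 0 < 1 - v := sub_pos.2 hv.2
    simp only [Pi.zero_apply]
    positivity
  simp_rw [mul_assoc, integral_const_mul] at h2
  rw [one_div, inv_mul_eq_one₀ hb0.ne'] at h2
  rw [← h2, ProbabilityTheory.beta]

lemma integrableOn_beta {a b : ℝ} (ha : 0 < a) (hb : 0 < b) :
    IntegrableOn (fun v : ℝ => v ^ (a - 1) * (1 - v) ^ (b - 1)) (Set.Ioo 0 1) := by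
  refine Integrable.of_integral_ne_zero ?_
  rw [setIntegral_beta ha hb]
  exact (ProbabilityTheory.beta_pos ha hb).ne'

lemma integrableOn_rpow_mul_exp {a r : ℝ} (ha : 0 < a) (hr : 0 < r) :
    IntegrableOn (fun u : ℝ => u ^ (a - 1) * Real.exp (-(r * u))) (Set.Ioi 0) := by
  refine Integrable.of_integral_ne_zero ?_
  rw [Real.integral_rpow_mul_exp_neg_mul_Ioi ha hr]
  have := Real.Gamma_pos_of_pos ha
  positivity

lemma integral_exp_mul_beta {A p : ℝ} (hA : 0 < A) (hp : 0 < p) {t : ℝ} (ht : 0 < t) :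
    ∫ v in Set.Ioo (0 : ℝ) 1, Real.exp (-(t * v)) * (v ^ (A - 1) * (1 - v) ^ (p - 1)) =
      Real.Gamma A * Real.Gamma p / Real.Gamma (A + p) *
        ∑' k : ℕ, (-t) ^ k / k.factorial * (poch A k / poch (A + p) k) := by
  have hG := Real.Gamma_pos_of_pos hA
  have hGp := Real.Gamma_pos_of_pos hp
  have hGB := Real.Gamma_pos_of_pos (add_pos hA hp)
  have hbeta (k : ℕ) : ∫ v in Set.Ioo (0 : ℝ) 1, v ^ (A + k - 1) * (1 - v) ^ (p - 1) =
      Real.Gamma A * Real.Gamma p / Real.Gamma (A + p) * (poch A k / poch (A + p) k) := by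
    rw [setIntegral_beta (by positivity) hp, show A + k + p = A + p + k by ring,
      Gamma_add_nat hA, Gamma_add_nat (add_pos hA hp)]
    have := poch_ne_zero (add_pos hA hp) k
    field_simp
  have h := hasSum_integral_of_summable_integral_norm
    (μ := volume.restrict (Set.Ioo (0 : ℝ) 1))
    (F := fun (k : ℕ) (v : ℝ) => (-t) ^ k / k.factorial * (v ^ (A + k - 1) * (1 - v) ^ (p - 1)))
    (fun k => (integrableOn_beta (by positivity) hp).const_mul _) ?_
  · have e : ∫ v in Set.Ioo (0 : ℝ) 1, Real.exp (-(t * v)) * (v ^ (A - 1) * (1 - v) ^ (p - 1)) =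
        ∫ v in Set.Ioo (0 : ℝ) 1, ∑' k : ℕ, (-t) ^ k / k.factorial *
          (v ^ (A + k - 1) * (1 - v) ^ (p - 1)) := by
      refine setIntegral_congr_fun measurableSet_Ioo fun v hv => ?_
      have e1 : ∀ k : ℕ, (-t) ^ k / k.factorial * (v ^ (A + k - 1) * (1 - v) ^ (p - 1)) =
          (-(t * v)) ^ k / k.factorial * (v ^ (A - 1) * (1 - v) ^ (p - 1)) := by
        intro k
        rw [show A + k - 1 = A - 1 + k by ring, Real.rpow_add_natCast hv.1.ne',
          ← neg_mul, mul_pow]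
        ring
      simp only [e1]
      rw [tsum_mul_right, Real.exp_eq_exp_ℝ, NormedSpace.exp_eq_tsum_div]
    rw [e, ← h.tsum_eq, ← tsum_mul_left]
    refine tsum_congr fun k => ?_
    rw [integral_const_mul, hbeta]
    ring
  · have e2 (k : ℕ) : ∫ v in Set.Ioo (0 : ℝ) 1, ‖(-t) ^ k / k.factorial *
        (v ^ (A + k - 1) * (1 - v) ^ (p - 1))‖ = t ^ k / k.factorial *
        (Real.Gamma A * Real.Gamma p / Real.Gamma (A + p) * (poch A k / poch (A + p) k)) := by
      rw [← hbeta, ← integral_const_mul]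
      refine setIntegral_congr_fun measurableSet_Ioo fun v hv => ?_
      have h3 := hv.1
      have h4 : 0 < 1 - v := sub_pos.2 hv.2
      rw [norm_mul, norm_div, norm_pow, norm_neg, Real.norm_of_nonneg ht.le, RCLike.norm_natCast,
        Real.norm_of_nonneg (by positivity)]
    simp only [e2]
    refine Summable.of_nonneg_of_le (fun k => ?_) (fun k => ?_)
      ((Real.summable_pow_div_factorial t).mul_right
        (Real.Gamma A * Real.Gamma p / Real.Gamma (A + p)))
    · have := poch_pos hA k
      have := poch_pos (add_pos hA hp) k
      positivity
    · have h3 : poch A k / poch (A + p) k ≤ 1 :=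
        div_le_one_of_le₀ (poch_le_poch hA (by linarith) k) (poch_pos (add_pos hA hp) k).le
      gcongr
      exact mul_le_of_le_one_right (by positivity) h3

lemma integral_exp_mul_hyp12 {A p : ℝ} (hA : 0 < A) (hp : 0 < p) {r : ℝ} (hr : 0 < r) :
    ∫ u in Set.Ioi (0 : ℝ), u ^ (A + p + 1 / 2 - 1) * Real.exp (-(r * u)) * hyp12 A p u =
      (1 / r) ^ (A + p + 1 / 2) * Real.Gamma (A + p + 1 / 2) *
        ∑' k : ℕ, (-(1 / r)) ^ k / k.factorial * (poch A k / poch (A + p) k) := by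
  have hC : 0 < A + p + 1 / 2 := by positivity
  have hG := Real.Gamma_pos_of_pos hC
  have hbeta (k : ℕ) : poch A k / (k.factorial * poch (A + p) k * poch (A + p + 1 / 2) k) *
      ∫ u in Set.Ioi (0 : ℝ), u ^ (A + p + 1 / 2 + k - 1) * Real.exp (-(r * u)) =
      (1 / r) ^ (A + p + 1 / 2) * Real.Gamma (A + p + 1 / 2) *
       ((1 / r) ^ k / k.factorial * (poch A k / poch (A + p) k)) := by
    rw [Real.integral_rpow_mul_exp_neg_mul_Ioi (by positivity) hr, Gamma_add_nat hC,
      Real.rpow_add_natCast (by positivity)]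
    have := poch_ne_zero (add_pos hA hp) k
    have := poch_ne_zero hC k
    generalize poch (A + p + 1 / 2) k = y at *
    field_simp
  have h := hasSum_integral_of_summable_integral_norm
    (μ := volume.restrict (Set.Ioi (0 : ℝ)))
    (F := fun (k : ℕ) (u : ℝ) => (-1) ^ k *
      (poch A k / (k.factorial * poch (A + p) k * poch (A + p + 1 / 2) k) *
      (u ^ (A + p + 1 / 2 + k - 1) * Real.exp (-(r * u)))))
    (fun k => ((integrableOn_rpow_mul_exp (by positivity) hr).const_mul _).const_mul _) ?_
  · have e : ∫ u in Set.Ioi (0 : ℝ),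
          u ^ (A + p + 1 / 2 - 1) * Real.exp (-(r * u)) * hyp12 A p u =
        ∫ u in Set.Ioi (0 : ℝ), ∑' k : ℕ, (-1) ^ k *
          (poch A k / (k.factorial * poch (A + p) k * poch (A + p + 1 / 2) k) *
          (u ^ (A + p + 1 / 2 + k - 1) * Real.exp (-(r * u)))) := by
      refine setIntegral_congr_fun measurableSet_Ioi fun u hu => ?_
      simp only [hyp12]
      rw [← tsum_mul_left]
      refine tsum_congr fun k => ?_
      rw [show A + p + 1 / 2 + k - 1 = A + p + 1 / 2 - 1 + k by ring,
        Real.rpow_add_natCast (ne_of_gt hu), neg_pow u]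
      ring
    rw [e, ← h.tsum_eq, ← tsum_mul_left]
    refine tsum_congr fun k => ?_
    rw [integral_const_mul, integral_const_mul, hbeta, neg_pow (1 / r)]
    ring
  · have e2 (k : ℕ) : ∫ u in Set.Ioi (0 : ℝ), ‖(-1) ^ k *
      (poch A k / (k.factorial * poch (A + p) k * poch (A + p + 1 / 2) k) *
      (u ^ (A + p + 1 / 2 + k - 1) * Real.exp (-(r * u))))‖ =
      (1 / r) ^ (A + p + 1 / 2) * Real.Gamma (A + p + 1 / 2) *
       ((1 / r) ^ k / k.factorial * (poch A k / poch (A + p) k)) := by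
      rw [← hbeta, ← integral_const_mul]
      refine setIntegral_congr_fun measurableSet_Ioi fun u hu => ?_
      have h3 : 0 < u := hu
      have := poch_pos hA k
      have := poch_pos (add_pos hA hp) k
      have := poch_pos hC k
      rw [norm_mul, norm_pow, norm_neg, norm_one, one_pow, one_mul,
        Real.norm_of_nonneg (by positivity)]
    simp only [e2]
    refine Summable.of_nonneg_of_le (fun k => ?_) (fun k => ?_)
      ((Real.summable_pow_div_factorial (1 / r)).mul_left
        ((1 / r) ^ (A + p + 1 / 2) * Real.Gamma (A + p + 1 / 2)))
    · have := poch_pos hA k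
      have := poch_pos (add_pos hA hp) k
      positivity
    · have h3 : poch A k / poch (A + p) k ≤ 1 :=
        div_le_one_of_le₀ (poch_le_poch hA (by linarith) k) (poch_pos (add_pos hA hp) k).le
      gcongr
      exact mul_le_of_le_one_right (by positivity) h3

lemma integral_exp_mul_beta_pos {A p : ℝ} (hA : 0 < A) (hp : 0 < p) {t : ℝ} (ht : 0 < t) :
    0 < ∫ v in Set.Ioo (0 : ℝ) 1, Real.exp (-(t * v)) * (v ^ (A - 1) * (1 - v) ^ (p - 1)) := by
  have hb := integrableOn_beta hA hp
  have hpos : 0 < ∫ v in Set.Ioo (0 : ℝ) 1, Real.exp (-t) * (v ^ (A - 1) * (1 - v) ^ (p - 1)) := by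
    rw [integral_const_mul, setIntegral_beta hA hp]
    exact mul_pos (Real.exp_pos _) (ProbabilityTheory.beta_pos hA hp)
  refine hpos.trans_le (setIntegral_mono_on (hb.const_mul _) ?_ measurableSet_Ioo ?_)
  · refine Integrable.mono' hb (Measurable.aestronglyMeasurable (by fun_prop)) ?_
    refine (ae_restrict_iff' measurableSet_Ioo).2 (Filter.Eventually.of_forall fun v hv => ?_)
    have h3 := hv.1
    have h4 : 0 < 1 - v := sub_pos.2 hv.2
    rw [Real.norm_of_nonneg (by positivity)]
    refine mul_le_of_le_one_left (by positivity) (Real.exp_le_one_iff.2 ?_)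
    have := mul_pos ht h3
    linarith
  · intro v hv
    have h3 := hv.1
    have h4 : 0 < 1 - v := sub_pos.2 hv.2
    gcongr
    nlinarith

lemma lintegral_exp_mul_hyp12 {A p : ℝ} (hA : 0 < A) (hp : 0 < p) (h1 : A ≤ 2 * p)
    (h2 : A ≤ p * (2 * p + 1)) {r : ℝ} (hr : 0 < r) :
    ∫⁻ u in Set.Ioi (0 : ℝ),
        ENNReal.ofReal (u ^ (A + p + 1 / 2 - 1) * Real.exp (-(r * u)) * hyp12 A p u) =
      ENNReal.ofReal (Real.Gamma (A + p + 1 / 2) * Real.Gamma (A + p) /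
        (Real.Gamma A * Real.Gamma p) * (1 / r) ^ (A + p + 1 / 2)) *
      ∫⁻ v in Set.Ioo (0 : ℝ) 1,
        ENNReal.ofReal (Real.exp (-(1 / r * v)) * (v ^ (A - 1) * (1 - v) ^ (p - 1))) := by
  have hG := Real.Gamma_pos_of_pos hA
  have hGp := Real.Gamma_pos_of_pos hp
  have hGB := Real.Gamma_pos_of_pos (add_pos hA hp)
  have hGC := Real.Gamma_pos_of_pos (by positivity : 0 < A + p + 1 / 2)
  have hpos := integral_exp_mul_beta_pos hA hp (one_div_pos.2 hr)
  have e : ∫ u in Set.Ioi (0 : ℝ), u ^ (A + p + 1 / 2 - 1) * Real.exp (-(r * u)) * hyp12 A p u =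
      Real.Gamma (A + p + 1 / 2) * Real.Gamma (A + p) /
        (Real.Gamma A * Real.Gamma p) * (1 / r) ^ (A + p + 1 / 2) *
        ∫ v in Set.Ioo (0 : ℝ) 1, Real.exp (-(1 / r * v)) * (v ^ (A - 1) * (1 - v) ^ (p - 1)) := by
    rw [integral_exp_mul_hyp12 hA hp hr, integral_exp_mul_beta hA hp (one_div_pos.2 hr)]
    field_simp
  have hK : 0 < Real.Gamma (A + p + 1 / 2) * Real.Gamma (A + p) /
        (Real.Gamma A * Real.Gamma p) * (1 / r) ^ (A + p + 1 / 2) := by positivity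
  rw [← ofReal_integral_eq_lintegral_ofReal (.of_integral_ne_zero ?_) ?_,
    ← ofReal_integral_eq_lintegral_ofReal (.of_integral_ne_zero hpos.ne') ?_,
    ← ENNReal.ofReal_mul hK.le, e]
  · refine (ae_restrict_iff' measurableSet_Ioo).2 (Filter.Eventually.of_forall fun v hv => ?_)
    have h3 := hv.1
    have h4 : 0 < 1 - v := sub_pos.2 hv.2
    simp only [Pi.zero_apply]
    positivity
  · rw [e]
    exact (mul_pos hK hpos).ne'
  · refine (ae_restrict_iff' measurableSet_Ioi).2 (Filter.Eventually.of_forall fun u hu => ?_)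
    have h3 : 0 < u := hu
    have := hyp12_nonneg hA hp h1 h2 h3.le
    simp only [Pi.zero_apply]
    positivity

lemma measurable_hyp12 {A p : ℝ} (hA : 0 < A) (hp : 0 < p) : Measurable (hyp12 A p) := by
  have hsum (x : ℝ) : Summable fun k : ℕ => (-x) ^ k *
      (poch A k / (k.factorial * poch (A + p) k * poch (A + p + 1 / 2) k)) := by
    have hC : 0 < A + p + 1 / 2 := by positivity
    refine Summable.of_norm_bounded
      ((Real.summable_pow_div_factorial |x|).mul_left (1 + (A + p + 1 / 2)⁻¹)) fun k => ?_
    have h1 := poch_pos hA k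
    have h2 := poch_pos (add_pos hA hp) k
    have h3 := poch_pos hC k
    have h4 : poch A k / poch (A + p) k ≤ 1 :=
      div_le_one_of_le₀ (poch_le_poch hA (by linarith) k) h2.le
    have h5 := inv_poch_le hC k
    rw [norm_mul, norm_pow, norm_neg, Real.norm_eq_abs, Real.norm_of_nonneg (by positivity)]
    generalize poch (A + p + 1 / 2) k = y at *
    generalize A + p + 1 / 2 = C at *
    calc _ = |x| ^ k / k.factorial * ((poch A k / poch (A + p) k) * y⁻¹) := by field_simp
      _ ≤ |x| ^ k / k.factorial * (1 * (1 + C⁻¹)) := by gcongr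
      _ = _ := by ring
  refine measurable_of_tendsto_metrizable (f := fun (n : ℕ) (x : ℝ) =>
    ∑ k ∈ Finset.range n, (-x) ^ k *
      (poch A k / (k.factorial * poch (A + p) k * poch (A + p + 1 / 2) k)))
    (fun n => by fun_prop) ?_
  exact tendsto_pi_nhds.2 fun x => (hsum x).hasSum.tendsto_sum_nat

lemma lintegral_ofReal_of_integral {μ : Measure ℝ} {f : ℝ → ℝ} {c : ℝ} (hf : 0 ≤ᵐ[μ] f)
    (h : ∫ x, f x ∂μ = c) (hc : c ≠ 0) : ∫⁻ x, ENNReal.ofReal (f x) ∂μ = ENNReal.ofReal c := by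
  rw [← ofReal_integral_eq_lintegral_ofReal (.of_integral_ne_zero (h ▸ hc)) hf, h]

lemma lintegral_rpow_mul_exp {a r : ℝ} (ha : 0 < a) (hr : 0 < r) :
    ∫⁻ t in Set.Ioi (0 : ℝ), ENNReal.ofReal (t ^ (a - 1) * Real.exp (-(r * t))) =
      ENNReal.ofReal ((1 / r) ^ a * Real.Gamma a) := by
  have := Real.Gamma_pos_of_pos ha
  refine lintegral_ofReal_of_integral ?_ (Real.integral_rpow_mul_exp_neg_mul_Ioi ha hr)
    (by positivity)
  refine (ae_restrict_iff' measurableSet_Ioi).2 (Filter.Eventually.of_forall fun u hu => ?_)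
  have h3 : 0 < u := hu
  simp only [Pi.zero_apply]
  positivity

lemma lintegral_rpow_mul_exp_inv {z v : ℝ} (hz : 0 < z) (hv : 0 < v) :
    ∫⁻ r in Set.Ioi (0 : ℝ), ENNReal.ofReal (r ^ (-z - 1) * Real.exp (-(1 / r * v))) =
      ENNReal.ofReal ((1 / v) ^ z * Real.Gamma z) := by
  have := Real.Gamma_pos_of_pos hz
  refine lintegral_ofReal_of_integral ?_ ?_ (by positivity)
  · refine (ae_restrict_iff' measurableSet_Ioi).2 (Filter.Eventually.of_forall fun u hu => ?_)
    have h3 : 0 < u := hu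
    simp only [Pi.zero_apply]
    positivity
  · rw [← Real.integral_rpow_mul_exp_neg_mul_Ioi hz hv, ← integral_comp_rpow_Ioi
      (fun t : ℝ => t ^ (z - 1) * Real.exp (-(v * t))) (p := -1) (by norm_num)]
    refine setIntegral_congr_fun measurableSet_Ioi fun r hr => ?_
    have h3 : 0 < r := hr
    simp only [smul_eq_mul, abs_neg, abs_one, one_mul]
    rw [← Real.rpow_mul h3.le, ← mul_assoc, ← Real.rpow_add h3, Real.rpow_neg_one]
    congr 2
    · ring
    · rw [one_div, mul_comm]

lemma lintegral_mul_lintegral_swap {S T : Set ℝ} {α β : ℝ → ENNReal} {k : ℝ → ℝ → ENNReal}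
    (hα : Measurable α) (hβ : Measurable β) (hk : Measurable (Function.uncurry k)) :
    ∫⁻ r in S, α r * ∫⁻ u in T, β u * k r u = ∫⁻ u in T, β u * ∫⁻ r in S, α r * k r u := by
  have hk1 (r : ℝ) : Measurable (k r) := hk.comp measurable_prodMk_left
  have hk2 (u : ℝ) : Measurable fun r => k r u := hk.comp measurable_prodMk_right
  have e1 (r : ℝ) : α r * ∫⁻ u in T, β u * k r u = ∫⁻ u in T, α r * (β u * k r u) :=
    (lintegral_const_mul _ (hβ.mul (hk1 r))).symm
  have e2 (u : ℝ) : β u * ∫⁻ r in S, α r * k r u = ∫⁻ r in S, α r * (β u * k r u) := by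
    refine (lintegral_const_mul (f := fun r => α r * k r u) _ (hα.mul (hk2 u))).symm.trans ?_
    exact lintegral_congr fun r => by ring
  simp only [e1, e2]
  refine lintegral_lintegral_swap (Measurable.aemeasurable ?_)
  exact (hα.comp measurable_fst).mul ((hβ.comp measurable_snd).mul hk)

lemma lintegral_rpow_mul_hyp12 {A p : ℝ} (hA : 0 < A) (hp : 0 < p) (h1 : A ≤ 2 * p)
    (h2 : A ≤ p * (2 * p + 1)) {z : ℝ} (hz : 0 < z) (hzA : z < A) :
    ∫⁻ u in Set.Ioi (0 : ℝ), ENNReal.ofReal (u ^ (z - 1) * hyp12 A p u) =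
      ENNReal.ofReal (Real.Gamma z * Real.Gamma (A - z) * Real.Gamma (A + p) *
        Real.Gamma (A + p + 1 / 2) / (Real.Gamma A * Real.Gamma (A + p - z) *
        Real.Gamma (A + p + 1 / 2 - z))) := by
  have hG := Real.Gamma_pos_of_pos hA
  have hGp := Real.Gamma_pos_of_pos hp
  have hGz := Real.Gamma_pos_of_pos hz
  have hGB := Real.Gamma_pos_of_pos (add_pos hA hp)
  have hGC := Real.Gamma_pos_of_pos (by positivity : 0 < A + p + 1 / 2)
  have hGAz := Real.Gamma_pos_of_pos (sub_pos.2 hzA)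
  have hGBz := Real.Gamma_pos_of_pos (by linarith : 0 < A + p - z)
  have hCz : 0 < A + p + 1 / 2 - z := by linarith
  have hGCz := Real.Gamma_pos_of_pos hCz
  have hmeas := measurable_hyp12 hA hp
  have hφ {u : ℝ} (hu : 0 < u) := hyp12_nonneg hA hp h1 h2 hu.le
  -- the Laplace transform identity, with the constant factors separated
  have hlap : ∀ r ∈ Set.Ioi (0 : ℝ),
      ENNReal.ofReal (r ^ (A + p + 1 / 2 - z - 1)) * ∫⁻ u in Set.Ioi (0 : ℝ),
        ENNReal.ofReal (u ^ (A + p + 1 / 2 - 1) * hyp12 A p u) *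
          ENNReal.ofReal (Real.exp (-(u * r))) =
      ENNReal.ofReal (Real.Gamma (A + p + 1 / 2) * Real.Gamma (A + p) /
        (Real.Gamma A * Real.Gamma p)) * (ENNReal.ofReal (r ^ (-z - 1)) *
      ∫⁻ v in Set.Ioo (0 : ℝ) 1, ENNReal.ofReal (v ^ (A - 1) * (1 - v) ^ (p - 1)) *
        ENNReal.ofReal (Real.exp (-(1 / r * v)))) := by
    intro r hr
    have hr0 : 0 < r := hr
    have e1 : ∫⁻ u in Set.Ioi (0 : ℝ),
        ENNReal.ofReal (u ^ (A + p + 1 / 2 - 1) * hyp12 A p u) *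
          ENNReal.ofReal (Real.exp (-(u * r))) = ∫⁻ u in Set.Ioi (0 : ℝ),
        ENNReal.ofReal (u ^ (A + p + 1 / 2 - 1) * Real.exp (-(r * u)) * hyp12 A p u) := by
      refine setLIntegral_congr_fun measurableSet_Ioi fun u hu => ?_
      have hu0 : 0 < u := hu
      have := hφ hu0
      rw [← ENNReal.ofReal_mul (by positivity)]
      congr 1
      rw [mul_comm u r]
      ring
    have e2 : ∫⁻ v in Set.Ioo (0 : ℝ) 1, ENNReal.ofReal (v ^ (A - 1) * (1 - v) ^ (p - 1)) *
        ENNReal.ofReal (Real.exp (-(1 / r * v))) = ∫⁻ v in Set.Ioo (0 : ℝ) 1,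
        ENNReal.ofReal (Real.exp (-(1 / r * v)) * (v ^ (A - 1) * (1 - v) ^ (p - 1))) :=
      lintegral_congr fun v => by rw [ENNReal.ofReal_mul (Real.exp_pos _).le, mul_comm]
    rw [e1, e2, lintegral_exp_mul_hyp12 hA hp h1 h2 hr0, ← mul_assoc, ← mul_assoc,
      ← ENNReal.ofReal_mul (by positivity), ← ENNReal.ofReal_mul (by positivity)]
    congr 2
    rw [show -z - 1 = A + p + 1 / 2 - z - 1 + -(A + p + 1 / 2) by ring, Real.rpow_add hr0,
      Real.rpow_neg hr0.le, Real.div_rpow zero_le_one hr0.le, Real.one_rpow, one_div (r ^ _)]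
    ring
  have hJ := setLIntegral_congr_fun (μ := volume) measurableSet_Ioi hlap
  rw [lintegral_mul_lintegral_swap (k := fun r u => ENNReal.ofReal (Real.exp (-(u * r))))
      (by fun_prop) (by fun_prop) (by fun_prop), lintegral_const_mul' _ _ ENNReal.ofReal_ne_top,
    lintegral_mul_lintegral_swap (k := fun r v => ENNReal.ofReal (Real.exp (-(1 / r * v))))
      (by fun_prop) (by fun_prop) (by fun_prop)] at hJ
  have hleft : ∫⁻ u in Set.Ioi (0 : ℝ), ENNReal.ofReal (u ^ (A + p + 1 / 2 - 1) * hyp12 A p u) *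
        ∫⁻ r in Set.Ioi (0 : ℝ), ENNReal.ofReal (r ^ (A + p + 1 / 2 - z - 1)) *
          ENNReal.ofReal (Real.exp (-(u * r))) =
      ENNReal.ofReal (Real.Gamma (A + p + 1 / 2 - z)) *
        ∫⁻ u in Set.Ioi (0 : ℝ), ENNReal.ofReal (u ^ (z - 1) * hyp12 A p u) := by
    rw [← lintegral_const_mul' _ _ ENNReal.ofReal_ne_top]
    refine setLIntegral_congr_fun measurableSet_Ioi fun u hu => ?_
    have hu0 : 0 < u := hu
    have := hφ hu0
    have e : ∫⁻ r in Set.Ioi (0 : ℝ), ENNReal.ofReal (r ^ (A + p + 1 / 2 - z - 1)) *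
          ENNReal.ofReal (Real.exp (-(u * r))) =
        ENNReal.ofReal ((1 / u) ^ (A + p + 1 / 2 - z) * Real.Gamma (A + p + 1 / 2 - z)) := by
      rw [← lintegral_rpow_mul_exp hCz hu0]
      refine lintegral_congr fun r => ?_
      rw [mul_comm, ← ENNReal.ofReal_mul (Real.exp_pos _).le, mul_comm]
    simp only [e]
    rw [← ENNReal.ofReal_mul (by positivity), ← ENNReal.ofReal_mul (by positivity)]
    congr 1
    rw [show z - 1 = A + p + 1 / 2 - 1 + -(A + p + 1 / 2 - z) by ring, Real.rpow_add hu0,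
      Real.rpow_neg hu0.le, Real.div_rpow zero_le_one hu0.le, Real.one_rpow, one_div (u ^ _)]
    ring
  have hright : ∫⁻ v in Set.Ioo (0 : ℝ) 1, ENNReal.ofReal (v ^ (A - 1) * (1 - v) ^ (p - 1)) *
        ∫⁻ r in Set.Ioi (0 : ℝ), ENNReal.ofReal (r ^ (-z - 1)) *
          ENNReal.ofReal (Real.exp (-(1 / r * v))) =
      ENNReal.ofReal (Real.Gamma z * (Real.Gamma (A - z) * Real.Gamma p /
        Real.Gamma (A - z + p))) := by
    rw [ENNReal.ofReal_mul hGz.le, ← lintegral_ofReal_of_integral ?_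
      (setIntegral_beta (sub_pos.2 hzA) hp) (ProbabilityTheory.beta_pos (sub_pos.2 hzA) hp).ne',
      ← lintegral_const_mul' _ _ ENNReal.ofReal_ne_top]
    · refine setLIntegral_congr_fun measurableSet_Ioo fun v hv => ?_
      have h3 := hv.1
      have h4 : 0 < 1 - v := sub_pos.2 hv.2
      have e : ∫⁻ r in Set.Ioi (0 : ℝ), ENNReal.ofReal (r ^ (-z - 1)) *
          ENNReal.ofReal (Real.exp (-(1 / r * v))) =
          ENNReal.ofReal ((1 / v) ^ z * Real.Gamma z) := by
        rw [← lintegral_rpow_mul_exp_inv hz h3]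
        refine lintegral_congr fun r => ?_
        rw [mul_comm, ← ENNReal.ofReal_mul (Real.exp_pos _).le, mul_comm]
      simp only [e]
      rw [← ENNReal.ofReal_mul (by positivity), ← ENNReal.ofReal_mul (by positivity)]
      congr 1
      rw [show A - z - 1 = A - 1 + -z by ring, Real.rpow_add h3,
        Real.rpow_neg h3.le, Real.div_rpow zero_le_one h3.le, Real.one_rpow, one_div (v ^ _)]
      ring
    · refine (ae_restrict_iff' measurableSet_Ioo).2 (Filter.Eventually.of_forall fun v hv => ?_)
      have h3 := hv.1
      have h4 : 0 < 1 - v := sub_pos.2 hv.2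
      simp only [Pi.zero_apply]
      positivity
  rw [hleft, hright, ← ENNReal.ofReal_mul (by positivity)] at hJ
  have h0 : ENNReal.ofReal (Real.Gamma (A + p + 1 / 2 - z)) ≠ 0 := by simpa using hGCz
  refine (ENNReal.mul_right_inj h0 ENNReal.ofReal_ne_top).1 ?_
  rw [hJ, ← ENNReal.ofReal_mul hGCz.le]
  congr 1
  rw [show A - z + p = A + p - z by ring]
  generalize Real.Gamma (A + p + 1 / 2 - z) = y1 at *
  generalize Real.Gamma (A + p + 1 / 2) = y2 at *
  field_simp

theorem XExists_d_eq_two (a b c : ℝ) (ha : 0 < a) (hb : 0 < b) (hc : 0 < c)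
    (h1 : 3 * a + b ≤ c) (h2 : a + b ≤ 2 * (c / 2 - a) * (c / 2 + 1 / 2 - a)) :
    XExists a b c 2 := by
  have hA : 0 < a + b := by positivity
  have hp : 0 < c / 2 - a := by linarith
  have hφ {u : ℝ} (hu : 0 < u) : 0 ≤ hyp12 (a + b) (c / 2 - a) u :=
    hyp12_nonneg hA hp (by linarith) (by linarith) hu.le
  have hmeas := measurable_hyp12 hA hp
  have hG1 := Real.Gamma_pos_of_pos ha
  have hG2 := Real.Gamma_pos_of_pos hb
  have hG3 := Real.Gamma_pos_of_pos hc
  have hG4 := Real.Gamma_pos_of_pos hA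
  have hG5 := Real.Gamma_pos_of_pos (by positivity : 0 < c / 2 + b)
  have hG6 := Real.Gamma_pos_of_pos (by positivity : 0 < c / 2 + b + 1 / 2)
  obtain ⟨κ, hκ⟩ : ∃ κ : ℝ, κ = Real.Gamma c * Real.Gamma (a + b) * (2 ^ (1 - c) * √Real.pi) /
      (Real.Gamma a * Real.Gamma b * Real.Gamma (c / 2 + b) * Real.Gamma (c / 2 + b + 1 / 2)) :=
    ⟨_, rfl⟩
  have hκ0 : 0 < κ := by rw [hκ]; positivity
  let ν : Measure ℝ := (volume.restrict (Set.Ioi (0 : ℝ))).withDensity fun u =>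
    ENNReal.ofReal (κ * (u ^ (b - 1) * hyp12 (a + b) (c / 2 - a) u))
  let μ : Measure ℝ := ν.map fun u => (4 * u)⁻¹
  have hmoment : ∀ s ∈ Set.Ioo (-a) b, ∫⁻ x, ENNReal.ofReal (x ^ s) ∂μ =
      ENNReal.ofReal (Real.Gamma c / (Real.Gamma a * Real.Gamma b) *
        (Real.Gamma (a + s) * Real.Gamma (b - s) / Real.Gamma (c + 2 * s))) := by
    intro s hs
    have hs1 := hs.1
    have hs2 := hs.2
    have hM := lintegral_rpow_mul_hyp12 hA hp (by linarith) (by linarith)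
      (by linarith : 0 < b - s) (by linarith : b - s < a + b)
    rw [lintegral_map (by fun_prop) (by fun_prop),
      lintegral_withDensity_eq_lintegral_mul _ (by fun_prop) (by fun_prop)]
    have e : ∫⁻ u in Set.Ioi (0 : ℝ), ((fun u : ℝ =>
        ENNReal.ofReal (κ * (u ^ (b - 1) * hyp12 (a + b) (c / 2 - a) u))) *
          fun u : ℝ => ENNReal.ofReal ((4 * u)⁻¹ ^ s)) u =
        ∫⁻ u in Set.Ioi (0 : ℝ), ENNReal.ofReal (κ * 4 ^ (-s)) *
          ENNReal.ofReal (u ^ (b - s - 1) * hyp12 (a + b) (c / 2 - a) u) := by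
      refine setLIntegral_congr_fun measurableSet_Ioi fun u hu => ?_
      have hu0 : 0 < u := hu
      have := hφ hu0
      simp only [Pi.mul_apply]
      rw [← ENNReal.ofReal_mul (by positivity), ← ENNReal.ofReal_mul (by positivity)]
      congr 1
      rw [show b - s - 1 = b - 1 + -s by ring, Real.rpow_add hu0, Real.inv_rpow (by positivity),
        ← Real.rpow_neg (by positivity), Real.mul_rpow (by norm_num) hu0.le]
      ring
    rw [e, lintegral_const_mul' _ _ ENNReal.ofReal_ne_top, hM,
      ← ENNReal.ofReal_mul (by positivity)]
    congr 1
    have hd := Real.Gamma_mul_Gamma_add_half (c / 2 + s)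
    rw [show a + b - (b - s) = a + s by ring, show a + b + (c / 2 - a) = c / 2 + b by ring,
      show c / 2 + b - (b - s) = c / 2 + s by ring,
      show c / 2 + b + 1 / 2 - (b - s) = c / 2 + s + 1 / 2 by ring, mul_assoc (Real.Gamma (a + b)),
      hd, show 2 * (c / 2 + s) = c + 2 * s by ring,
      show 1 - (c + 2 * s) = 1 - c + 2 * -s by ring, Real.rpow_add two_pos,
      Real.rpow_mul zero_le_two, hκ, show (2 : ℝ) ^ (2 : ℝ) = 4 by norm_num]
    have hG7 := Real.Gamma_pos_of_pos (by linarith : 0 < c + 2 * s)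
    have h4 : (0 : ℝ) < 4 ^ (-s) := by positivity
    have h5 : (0 : ℝ) < 2 ^ (1 - c) := by positivity
    have h6 : 0 < √Real.pi := by positivity
    generalize Real.Gamma (c / 2 + b + 1 / 2) = y1 at *
    generalize Real.Gamma (c / 2 + b) = y2 at *
    generalize (4 : ℝ) ^ (-s) = y3 at *
    generalize (2 : ℝ) ^ (1 - c) = y4 at *
    field_simp
  refine ⟨μ, ⟨?_⟩, ?_, hmoment⟩
  · have h := hmoment 0 ⟨by linarith, hb⟩
    simp only [Real.rpow_zero, ENNReal.ofReal_one, lintegral_const, one_mul, add_zero, sub_zero,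
      mul_zero] at h
    rw [h, ← ENNReal.ofReal_one]
    congr 1
    field_simp
  · rw [Measure.map_apply (by fun_prop) measurableSet_Ioi.compl]
    refine withDensity_absolutelyContinuous _ _ ?_
    have : (fun u : ℝ => (4 * u)⁻¹) ⁻¹' (Set.Ioi 0)ᶜ = (Set.Ioi 0)ᶜ := by
      ext u
      simp only [Set.mem_preimage, Set.mem_compl_iff, Set.mem_Ioi, inv_pos,
        mul_pos_iff_of_pos_left (four_pos : (0 : ℝ) < 4)]
    rw [this, Measure.restrict_apply measurableSet_Ioi.compl, Set.compl_inter_self, measure_empty]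
end
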